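/- arXiv:2012.04523 — 3 statements merged into one kernel-verified Lean document; each statement's English description precedes it below -/
import Mathlib

section
/- Let p be a prime with p ≡ 1 (mod 4), and write p = x^2 + 4y^2 with integers x, y and x ≡ 1 (mod 4). Then ∑_{k=0}^{p-1} T_k(2,2)^2 / 4^k ≡ (2/p)·(2x - p/(2x)) (mod p^2), where (2/p) is the Legendre symbol; both sides are p-adic integers since p ∤ 2x. -/
/-- The generalized central trinomial coefficient `T_n(b,c)`, the coefficient of `x^n`
in `(x^2 + b*x + c)^n`. -/
def genCentralTrinomial (b c : ℤ) (n : ℕ) : ℤ :=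
  ∑ k ∈ Finset.range (n / 2 + 1),
    (n.choose (2 * k) : ℤ) * ((2 * k).choose k : ℤ) * b ^ (n - 2 * k) * c ^ k

lemma cast_choose_succ_mul (m j : ℕ) :
    (m.choose (j + 1) : ℚ) * (j + 1) = m.choose j * (m - j) := by
  rcases le_or_gt j m with h | h
  · have := Nat.choose_succ_right_eq m j
    rw [← Nat.cast_sub h]
    exact_mod_cast this
  · simp [Nat.choose_eq_zero_of_lt h, Nat.choose_eq_zero_of_lt (Nat.lt_succ_of_lt h)]

lemma cast_succ_choose_succ_mul (m j : ℕ) :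
    ((m + 1).choose (j + 1) : ℚ) * (j + 1) = (m + 1) * m.choose j := by
  exact_mod_cast (Nat.add_one_mul_choose_eq m j).symm

lemma cast_choose_two_mul_succ (k : ℕ) :
    ((2 * (k + 1)).choose (k + 1) : ℚ) * (k + 1) = 2 * (2 * k + 1) * (2 * k).choose k := by
  have := Nat.succ_mul_centralBinom_succ k
  simp only [Nat.centralBinom] at this
  have h : (((k + 1) * (2 * (k + 1)).choose (k + 1) : ℕ) : ℚ) =
    ((2 * (2 * k + 1) * (2 * k).choose k : ℕ) : ℚ) := by rw [this]
  push_cast at h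
  linarith

lemma choose_mul_central_recs (n k : ℕ) :
    ((k : ℚ) + 1) ^ 2 * ((n + 2).choose (2 * (k + 1)) * (2 * (k + 1)).choose (k + 1)) =
        (n + 2) * (n + 1) * (n.choose (2 * k) * (2 * k).choose k) ∧
    ((k : ℚ) + 1) ^ 2 * ((n + 1).choose (2 * (k + 1)) * (2 * (k + 1)).choose (k + 1)) =
        (n + 1) * (n - 2 * k) * (n.choose (2 * k) * (2 * k).choose k) ∧
    ((k : ℚ) + 1) ^ 2 * (n.choose (2 * (k + 1)) * (2 * (k + 1)).choose (k + 1)) =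
        (n - 2 * k) * (n - 2 * k - 1) * (n.choose (2 * k) * (2 * k).choose k) := by
  have e1 := cast_choose_two_mul_succ k
  have hk : (2 * (k : ℚ) + 1) ≠ 0 := by positivity
  have r1 := cast_succ_choose_succ_mul (n + 1) (2 * k + 1)
  have r2 := cast_succ_choose_succ_mul n (2 * k)
  have r3 := cast_succ_choose_succ_mul n (2 * k + 1)
  have r4 := cast_choose_succ_mul n (2 * k)
  have r5 := cast_choose_succ_mul n (2 * k + 1)
  push_cast at r1 r2 r3 r4 r5
  rw [show 2 * (k + 1) = 2 * k + 1 + 1 by ring] at *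
  refine ⟨?_, ?_, ?_⟩ <;> apply mul_left_cancel₀ hk
  · linear_combination ((2 * k + 1 : ℚ) * (k + 1) * (n + 2).choose (2 * k + 1 + 1)) * e1 +
      ((2 * k).choose k * (2 * k + 1 : ℚ) * (2 * k + 1)) * r1 +
      ((2 * k).choose k * (2 * k + 1 : ℚ) * (n + 2)) * r2
  · linear_combination ((2 * k + 1 : ℚ) * (k + 1) * (n + 1).choose (2 * k + 1 + 1)) * e1 +
      ((2 * k).choose k * (2 * k + 1 : ℚ) * (2 * k + 1)) * r3 +
      ((2 * k).choose k * (2 * k + 1 : ℚ) * (n + 1)) * r4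
  · linear_combination ((2 * k + 1 : ℚ) * (k + 1) * n.choose (2 * k + 1 + 1)) * e1 +
      ((2 * k).choose k * (2 * k + 1 : ℚ) * (2 * k + 1)) * r5 +
      ((2 * k).choose k * (2 * k + 1 : ℚ) * (n - 2 * k - 1)) * r4

lemma genCentralTrinomial_two_two_eq_sum (n N : ℕ) (h : n / 2 < N) :
    (genCentralTrinomial 2 2 n : ℚ) = ∑ k ∈ Finset.range N,
      (n.choose (2 * k) * (2 * k).choose k : ℚ) * (2 ^ n * 2⁻¹ ^ k) := by
  have hsub : Finset.range (n / 2 + 1) ⊆ Finset.range N := by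
    intro a; simp only [Finset.mem_range]; omega
  rw [← Finset.sum_subset hsub]
  · unfold genCentralTrinomial
    push_cast
    refine Finset.sum_congr rfl fun k hk => ?_
    have hk' : 2 * k ≤ n := by have := Finset.mem_range.1 hk; omega
    obtain ⟨m, rfl⟩ := Nat.exists_eq_add_of_le hk'
    rw [Nat.add_sub_cancel_left, pow_add, pow_mul' 2 2 k, inv_pow]
    field_simp
  · intro k _ hk
    have : n < 2 * k := by simp only [Finset.mem_range] at hk; omega
    simp [Nat.choose_eq_zero_of_lt this]

lemma genCentralTrinomial_two_two_rec (n : ℕ) :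
    ((n : ℚ) + 2) * genCentralTrinomial 2 2 (n + 2) =
      2 * (2 * n + 3) * genCentralTrinomial 2 2 (n + 1) +
        4 * (n + 1) * genCentralTrinomial 2 2 n := by
  have h0 : (genCentralTrinomial 2 2 n : ℚ) = -(∑ k ∈ Finset.range (n + 2 + 1),
      (n.choose (2 * k) * (2 * k).choose k : ℚ) * (2 ^ n * 2⁻¹ ^ k)) +
      2 * ∑ k ∈ Finset.range (n + 2),
      (n.choose (2 * k) * (2 * k).choose k : ℚ) * (2 ^ n * 2⁻¹ ^ k) := by
    rw [← genCentralTrinomial_two_two_eq_sum n _ (by omega),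
      ← genCentralTrinomial_two_two_eq_sum n _ (by omega)]
    ring
  rw [h0, genCentralTrinomial_two_two_eq_sum (n + 1) (n + 2 + 1) (by omega),
    genCentralTrinomial_two_two_eq_sum (n + 2) (n + 2 + 1) (by omega)]
  simp only [Finset.sum_range_succ' _ (n + 2)]
  have key : ∀ k ∈ Finset.range (n + 2), ((n : ℚ) + 2) * (((n + 2).choose (2 * (k + 1)) *
      (2 * (k + 1)).choose (k + 1)) * (2 ^ (n + 2) * 2⁻¹ ^ (k + 1))) =
      2 * (2 * n + 3) * (((n + 1).choose (2 * (k + 1)) *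
      (2 * (k + 1)).choose (k + 1)) * (2 ^ (n + 1) * 2⁻¹ ^ (k + 1))) -
      4 * (n + 1) * ((n.choose (2 * (k + 1)) *
      (2 * (k + 1)).choose (k + 1)) * (2 ^ n * 2⁻¹ ^ (k + 1))) +
      4 * (n + 1) * (2 * ((n.choose (2 * k) * (2 * k).choose k) * (2 ^ n * 2⁻¹ ^ k))) := by
    intro k _
    obtain ⟨a, b, c⟩ := choose_mul_central_recs n k
    have hk : ((k : ℚ) + 1) ^ 2 ≠ 0 := by positivity
    apply mul_left_cancel₀ hk
    rw [pow_succ, pow_succ, pow_succ]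
    linear_combination (2 ^ n * 2⁻¹ ^ k * 2 * (n + 2 : ℚ)) * a -
      (2 ^ n * 2⁻¹ ^ k * (2 * (2 * n + 3) : ℚ)) * b + (2 ^ n * 2⁻¹ ^ k * 2 * (n + 1 : ℚ)) * c
  have key' := Finset.sum_congr rfl key
  simp only [Finset.sum_add_distrib, Finset.sum_sub_distrib, ← Finset.mul_sum] at key'
  simp only [mul_zero, Nat.choose_zero_right, Nat.cast_one, pow_zero]
  linear_combination key'

/-- The coefficients of the expansion of `P_n(x)^2` in powers of `(x^2 - 1) / 4`, where `P_n` is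
the `n`-th Legendre polynomial. -/
def legendreSqCoeff (n j : ℕ) : ℚ := (n + j).choose (2 * j) * (2 * j).choose j ^ 2

lemma legendreSqCoeff_zero_right (n : ℕ) : legendreSqCoeff n 0 = 1 := by simp [legendreSqCoeff]

lemma legendreSqCoeff_eq_zero {n j : ℕ} (h : n < j) : legendreSqCoeff n j = 0 := by
  simp [legendreSqCoeff, Nat.choose_eq_zero_of_lt (show n + j < 2 * j by omega)]

lemma legendreSqCoeff_succ_right (n j : ℕ) :
    ((j : ℚ) + 1) ^ 3 * legendreSqCoeff n (j + 1) =
      2 * (2 * j + 1) * (n + j + 1) * (n - j) * legendreSqCoeff n j := by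
  have e := cast_choose_two_mul_succ j
  have r1 := cast_succ_choose_succ_mul (n + j) (2 * j + 1)
  have r2 := cast_choose_succ_mul (n + j) (2 * j)
  push_cast at r1 r2
  have hk : (2 * (j : ℚ) + 1) ≠ 0 := by positivity
  unfold legendreSqCoeff
  rw [show 2 * (j + 1) = 2 * j + 1 + 1 by ring, ← add_assoc] at *
  apply mul_left_cancel₀ hk
  have e2 : ((2 * j + 1 + 1).choose (j + 1) * (j + 1 : ℚ)) ^ 2 =
      (2 * (2 * j + 1) * (2 * j).choose j) ^ 2 := by rw [e]
  linear_combination (2 * j + 1 : ℚ) * (j + 1) * (n + j + 1).choose (2 * j + 1 + 1) * e2 +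
    2 * (2 * j + 1 : ℚ) ^ 3 * (2 * j).choose j ^ 2 * r1 +
    2 * (2 * j + 1 : ℚ) ^ 2 * (n + j + 1) * (2 * j).choose j ^ 2 * r2

lemma legendreSqCoeff_succ_left (n j : ℕ) :
    legendreSqCoeff (n + 1) j * (n + 1 - j) = legendreSqCoeff n j * (n + 1 + j) := by
  unfold legendreSqCoeff
  have r1 := cast_succ_choose_succ_mul (n + j) (2 * j)
  have r2 := cast_choose_succ_mul (n + j + 1) (2 * j)
  push_cast at r1 r2
  rw [show n + 1 + j = n + j + 1 by ring]
  linear_combination (2 * j).choose j ^ 2 * (r1 - r2)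

lemma legendreSqCoeff_three_term (n j : ℕ) :
    ((n : ℚ) + 2) ^ 2 * legendreSqCoeff (n + 2) (j + 1) =
      (2 * n + 3) * ((2 * j + 3) * legendreSqCoeff (n + 1) (j + 1) +
        4 * (2 * j + 1) * legendreSqCoeff (n + 1) j) +
      (n + 1) ^ 2 * legendreSqCoeff n (j + 1) := by
  have hj : ((j : ℚ) + 1) ^ 3 ≠ 0 := by positivity
  have a2 := legendreSqCoeff_succ_right (n + 2) j
  have a1 := legendreSqCoeff_succ_right (n + 1) j
  have a0 := legendreSqCoeff_succ_right n j
  have b1 := legendreSqCoeff_succ_left (n + 1) j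
  have b0 := legendreSqCoeff_succ_left n j
  apply mul_left_cancel₀ hj
  push_cast at a2 a1 a0 b1 b0
  linear_combination (n + 2 : ℚ) ^ 2 * a2 - (2 * n + 3 : ℚ) * (2 * j + 3) * a1 -
    (n + 1 : ℚ) ^ 2 * a0 + (n + 2 : ℚ) ^ 2 * (2 * (2 * j + 1) * (n + j + 3)) * b1
    + (n + 1 : ℚ) ^ 2 * (2 * (2 * j + 1) * (n - j)) * b0

lemma sum_range_legendreSqCoeff {n N : ℕ} (h : n < N) (g : ℕ → ℚ) :
    ∑ j ∈ Finset.range N, legendreSqCoeff n j * g j =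
      ∑ j ∈ Finset.range (n + 1), legendreSqCoeff n j * g j := by
  refine (Finset.sum_subset (Finset.range_mono h) fun j _ hj => ?_).symm
  rw [legendreSqCoeff_eq_zero (by simpa using hj), zero_mul]

/-- Both statements are needed for the induction; the second one expands the product of two
consecutive terms. -/
lemma genCentralTrinomial_two_two_sq_aux (n : ℕ) :
    (genCentralTrinomial 2 2 n : ℚ) ^ 2 =
        (-4) ^ n * ∑ j ∈ Finset.range (n + 1), legendreSqCoeff n j * (-2⁻¹) ^ j ∧
    (genCentralTrinomial 2 2 (n + 1) : ℚ) ^ 2 =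
        (-4) ^ (n + 1) * ∑ j ∈ Finset.range (n + 2), legendreSqCoeff (n + 1) j * (-2⁻¹) ^ j ∧
    ((n : ℚ) + 1) * genCentralTrinomial 2 2 (n + 1) * genCentralTrinomial 2 2 n =
        2 * (-4) ^ n *
          ∑ j ∈ Finset.range (n + 2), legendreSqCoeff (n + 1) j * ((n + 1 - j) * (-2⁻¹) ^ j) := by
  induction n with
  | zero => simp [genCentralTrinomial, legendreSqCoeff, Finset.sum_range_succ]; norm_num
  | succ n ih =>
    obtain ⟨h0, h1, h2⟩ := ih
    have hrec := genCentralTrinomial_two_two_rec n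
    set T0 : ℚ := (genCentralTrinomial 2 2 n : ℚ)
    set T1 : ℚ := (genCentralTrinomial 2 2 (n + 1) : ℚ)
    rw [show n + 1 + 1 = n + 2 by ring, show n + 1 + 2 = n + 2 + 1 by ring]
    set T2 : ℚ := (genCentralTrinomial 2 2 (n + 2) : ℚ)
    rw [← sum_range_legendreSqCoeff (show n < n + 2 + 1 by omega)] at h0
    rw [← sum_range_legendreSqCoeff (show n + 1 < n + 2 + 1 by omega)] at h1 h2
    have hsq : (n + 2 : ℚ) ^ 2 * T2 ^ 2 = 4 * (2 * n + 3) ^ 2 * T1 ^ 2 +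
        16 * (2 * n + 3) * ((n + 1) * T1 * T0) + 16 * (n + 1) ^ 2 * T0 ^ 2 := by
      rw [← mul_pow, hrec]; ring
    have hmul : (n + 2 : ℚ) * T2 * T1 = 2 * (2 * n + 3) * T1 ^ 2 + 4 * ((n + 1) * T1 * T0) := by
      rw [hrec]; ring
    refine ⟨?_, ?_, ?_⟩
    · rw [h1, sum_range_legendreSqCoeff (show n + 1 < n + 2 + 1 by omega)]
    · have hn : (n + 2 : ℚ) ^ 2 ≠ 0 := by positivity
      apply mul_left_cancel₀ hn
      rw [hsq, h0, h1, h2]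
      have key : (n + 2 : ℚ) ^ 2 * ∑ j ∈ Finset.range (n + 2 + 1),
            legendreSqCoeff (n + 2) j * (-2⁻¹) ^ j =
          (-(2 * n + 3) ^ 2) * ∑ j ∈ Finset.range (n + 2 + 1),
            legendreSqCoeff (n + 1) j * (-2⁻¹) ^ j +
          2 * (2 * n + 3) * ∑ j ∈ Finset.range (n + 2 + 1),
            legendreSqCoeff (n + 1) j * ((n + 1 - j) * (-2⁻¹) ^ j) +
          (n + 1) ^ 2 * ∑ j ∈ Finset.range (n + 2 + 1),
            legendreSqCoeff n j * (-2⁻¹) ^ j := by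
        have e (j : ℕ) : (2 * n + 3 : ℚ) * (-(2 * j + 1)) *
            (legendreSqCoeff (n + 1) j * (-2⁻¹) ^ j) =
            (-(2 * n + 3) ^ 2) * (legendreSqCoeff (n + 1) j * (-2⁻¹) ^ j) +
            2 * (2 * n + 3) * (legendreSqCoeff (n + 1) j * ((n + 1 - j) * (-2⁻¹) ^ j)) := by
          ring
        simp only [Finset.mul_sum]
        rw [← Finset.sum_add_distrib, ← Finset.sum_congr rfl fun j _ => e j]
        have top : ∑ j ∈ Finset.range (n + 2 + 1), (2 * n + 3 : ℚ) * (-(2 * j + 1)) *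
            (legendreSqCoeff (n + 1) j * (-2⁻¹) ^ j) =
            2 * ∑ j ∈ Finset.range (n + 2), (2 * n + 3 : ℚ) * (-(2 * j + 1)) *
            (legendreSqCoeff (n + 1) j * (-2⁻¹) ^ j) -
            ∑ j ∈ Finset.range (n + 2 + 1), (2 * n + 3 : ℚ) * (-(2 * j + 1)) *
            (legendreSqCoeff (n + 1) j * (-2⁻¹) ^ j) := by
          rw [Finset.sum_range_succ _ (n + 2),
            legendreSqCoeff_eq_zero (show n + 1 < n + 2 by omega)]
          ring
        rw [top]
        simp only [Finset.sum_range_succ' _ (n + 2)]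
        have key' := Finset.sum_congr (rfl : Finset.range (n + 2) = Finset.range (n + 2))
          fun j _ => show (n + 2 : ℚ) ^ 2 * (legendreSqCoeff (n + 2) (j + 1) * (-2⁻¹) ^ (j + 1)) =
            2 * ((2 * n + 3 : ℚ) * (-(2 * j + 1)) * (legendreSqCoeff (n + 1) j * (-2⁻¹) ^ j)) -
            (2 * n + 3 : ℚ) * (-(2 * (j + 1 : ℕ) + 1)) *
              (legendreSqCoeff (n + 1) (j + 1) * (-2⁻¹) ^ (j + 1)) +
            (n + 1) ^ 2 * (legendreSqCoeff n (j + 1) * (-2⁻¹) ^ (j + 1)) by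
              push_cast
              linear_combination (-2⁻¹ : ℚ) ^ (j + 1) * legendreSqCoeff_three_term n j
        simp only [Finset.sum_add_distrib, Finset.sum_sub_distrib, ← Finset.mul_sum] at key' ⊢
        simp only [legendreSqCoeff_zero_right]
        push_cast at key' ⊢
        linear_combination key'
      linear_combination -((-4) ^ (n + 2) : ℚ) * key
    · have key := Finset.sum_congr (rfl : Finset.range (n + 2 + 1) = Finset.range (n + 2 + 1))
          fun j _ => show
            legendreSqCoeff (n + 2) j * ((n + 2 - j) * (-2⁻¹) ^ j) =
            (2 * n + 3) * (legendreSqCoeff (n + 1) j * (-2⁻¹) ^ j) -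
            legendreSqCoeff (n + 1) j * ((n + 1 - j) * (-2⁻¹) ^ j) by
              have := legendreSqCoeff_succ_left (n + 1) j
              push_cast at this
              linear_combination (-2⁻¹ : ℚ) ^ j * this
      simp only [Finset.sum_sub_distrib, ← Finset.mul_sum] at key
      push_cast
      rw [show (n + 1 + 1 : ℚ) = n + 2 by ring, hmul, h1, h2, key]
      ring

lemma genCentralTrinomial_two_two_sq {n N : ℕ} (h : n < N) :
    (genCentralTrinomial 2 2 n : ℚ) ^ 2 = (-4) ^ n * ∑ j ∈ Finset.range N,
      ((n + j).choose (2 * j) * (2 * j).choose j ^ 2 : ℚ) * (-2⁻¹) ^ j := by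
  rw [(genCentralTrinomial_two_two_sq_aux n).1, ← sum_range_legendreSqCoeff h]
  rfl

lemma genCentralTrinomial_two_two_sq_of_two_mul_eq_one {R : Type*} [CommRing R] {w : R}
    (hw : 2 * w = 1) {n N : ℕ} (h : n < N) :
    (genCentralTrinomial 2 2 n : R) ^ 2 = (-4) ^ n * ∑ j ∈ Finset.range N,
      ((n + j).choose (2 * j) * (2 * j).choose j ^ 2 : R) * (-w) ^ j := by
  have hZ : 2 ^ N * genCentralTrinomial 2 2 n ^ 2 = (-4) ^ n * ∑ j ∈ Finset.range N,
      ((n + j).choose (2 * j) * (2 * j).choose j ^ 2 : ℤ) * ((-1) ^ j * 2 ^ (N - j)) := by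
    have hQ : (2 ^ N * genCentralTrinomial 2 2 n ^ 2 : ℚ) = (-4) ^ n * ∑ j ∈ Finset.range N,
      ((n + j).choose (2 * j) * (2 * j).choose j ^ 2 : ℚ) * ((-1) ^ j * 2 ^ (N - j)) := by
      rw [genCentralTrinomial_two_two_sq h, mul_left_comm, Finset.mul_sum]
      congr 1
      refine Finset.sum_congr rfl fun j hj => ?_
      have hN : (2 : ℚ) ^ N = 2 ^ (N - j) * 2 ^ j := by
        rw [← pow_add, Nat.sub_add_cancel (Finset.mem_range.1 hj).le]
      rw [hN, neg_pow, inv_pow]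
      field_simp
    exact_mod_cast hQ
  have hR := congrArg (Int.cast : ℤ → R) hZ
  push_cast at hR
  have hw' (m : ℕ) : w ^ m * 2 ^ m = 1 := by rw [← mul_pow, mul_comm, hw, one_pow]
  have hR' := congrArg (w ^ N * ·) hR
  beta_reduce at hR'
  rw [← mul_assoc, hw', one_mul, mul_left_comm, Finset.mul_sum] at hR'
  rw [hR']
  congr 1
  refine Finset.sum_congr rfl fun j hj => ?_
  have hN : w ^ N = w ^ (N - j) * w ^ j := by
    rw [← pow_add, Nat.sub_add_cancel (Finset.mem_range.1 hj).le]
  rw [hN, neg_pow w]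
  linear_combination ((n + j).choose (2 * j) * (2 * j).choose j ^ 2 * (-1) ^ j * w ^ j : R) *
    hw' (N - j)

lemma alternating_sum_choose_add (j N : ℕ) :
    ∑ k ∈ Finset.range N, (-1 : ℤ) ^ k * (k + j).choose (2 * j) +
      4 * ∑ k ∈ Finset.range N, (-1 : ℤ) ^ k * (k + (j + 1)).choose (2 * (j + 1)) =
    -(-1) ^ N * ((N + j + 1).choose (2 * j + 2) + (N + j).choose (2 * j + 2)) := by
  induction N with
  | zero => simp [Nat.choose_eq_zero_of_lt (show j + 1 < 2 * j + 2 by omega),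
      Nat.choose_eq_zero_of_lt (show j < 2 * j + 2 by omega)]
  | succ N ih =>
    have h1 : ((N + j + 1 + 1).choose (2 * j + 2) : ℤ) =
        (N + j + 1).choose (2 * j + 1) + (N + j + 1).choose (2 * j + 2) := by
      exact_mod_cast Nat.choose_succ_succ (N + j + 1) (2 * j + 1)
    have h2 : ((N + j + 1).choose (2 * j + 2) : ℤ) =
        (N + j).choose (2 * j + 1) + (N + j).choose (2 * j + 2) := by
      exact_mod_cast Nat.choose_succ_succ (N + j) (2 * j + 1)
    have h3 : ((N + j + 1).choose (2 * j + 1) : ℤ) =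
        (N + j).choose (2 * j) + (N + j).choose (2 * j + 1) := by
      exact_mod_cast Nat.choose_succ_succ (N + j) (2 * j)
    rw [Finset.sum_range_succ, Finset.sum_range_succ, pow_succ,
      show N + 1 + j + 1 = N + j + 1 + 1 by ring, show N + 1 + j = N + j + 1 by ring,
      show N + (j + 1) = N + j + 1 by ring, show 2 * (j + 1) = 2 * j + 2 by ring] at *
    linear_combination ih - (-1) ^ N * (h1 + h3) + (-1) ^ N * h2

section ModPrimeSq

variable {p : ℕ}

lemma natCast_mul_self_eq_zero : (p : ZMod (p ^ 2)) * p = 0 := by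
  rw [← Nat.cast_mul, ← sq, ZMod.natCast_self]

lemma natCast_eq_zero_of_sq_dvd {m : ℕ} (h : p ^ 2 ∣ m) : (m : ZMod (p ^ 2)) = 0 :=
  (ZMod.natCast_eq_zero_iff _ _).2 h

variable [hp : Fact p.Prime]

lemma isUnit_natCast_of_not_dvd {m : ℕ} (h : ¬ p ∣ m) : IsUnit (m : ZMod (p ^ 2)) := by
  rw [ZMod.isUnit_iff_coprime]
  exact ((hp.out.coprime_iff_not_dvd.2 h).pow_left 2).symm

/-- Reduction from `ℤ / p ^ 2` to `ℤ / p`. -/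
def redModPrime (p : ℕ) : ZMod (p ^ 2) →+* ZMod p := ZMod.castHom (dvd_pow_self p two_ne_zero) _

lemma exists_eq_mul_of_redModPrime_eq {a b : ZMod (p ^ 2)}
    (h : redModPrime p a = redModPrime p b) : ∃ c, a - b = p * c := by
  obtain ⟨m, hm⟩ := ZMod.intCast_surjective (a - b)
  have h0 : redModPrime p (a - b) = 0 := by rw [map_sub, h, sub_self]
  rw [← hm, map_intCast, ZMod.intCast_zmod_eq_zero_iff_dvd] at h0
  obtain ⟨c, rfl⟩ := h0
  exact ⟨c, by rw [← hm]; push_cast; rfl⟩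

lemma prime_mul_eq_of_redModPrime_eq {a b : ZMod (p ^ 2)}
    (h : redModPrime p a = redModPrime p b) : (p : ZMod (p ^ 2)) * a = p * b := by
  obtain ⟨c, hc⟩ := exists_eq_mul_of_redModPrime_eq h
  rw [← sub_eq_zero, ← mul_sub, hc, ← mul_assoc, natCast_mul_self_eq_zero, zero_mul]

lemma isUnit_of_redModPrime_ne_zero {a : ZMod (p ^ 2)} (h : redModPrime p a ≠ 0) : IsUnit a := by
  obtain ⟨m, rfl⟩ := ZMod.natCast_zmod_surjective a
  rw [map_natCast, Ne, ZMod.natCast_eq_zero_iff] at h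
  exact isUnit_natCast_of_not_dvd h

lemma choose_add_prime_add_choose_eq_zero {j : ℕ} (hj : 2 * j + 2 < p) :
    ((p + j + 1).choose (2 * j + 2) + (p + j).choose (2 * j + 2) : ZMod (p ^ 2)) = 0 := by
  have hdvd : p ∣ (p + j).choose (2 * j + 1) := by
    have := Choose.choose_modEq_choose_mod_mul_choose_div_nat (n := p + j) (k := 2 * j + 1) (p := p)
    rw [Nat.add_mod_left, Nat.mod_eq_of_lt (show j < p by omega),
      Nat.mod_eq_of_lt (show 2 * j + 1 < p by omega),
      Nat.choose_eq_zero_of_lt (show j < 2 * j + 1 by omega), zero_mul] at this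
    exact (Nat.modEq_zero_iff_dvd).1 this
  have h1 := Nat.add_one_mul_choose_eq (p + j) (2 * j + 1)
  have h2 := Nat.choose_succ_right_eq (p + j) (2 * j + 1)
  rw [show p + j - (2 * j + 1) = p - j - 1 by omega] at h2
  have key : ((p + j + 1).choose (2 * j + 2) + (p + j).choose (2 * j + 2)) * (2 * j + 2) =
      2 * p * (p + j).choose (2 * j + 1) := by
    rw [add_mul, h2, show 2 * j + 2 = 2 * j + 1 + 1 by ring, ← h1, mul_comm _ (p - j - 1),
      ← add_mul, show p + j + 1 + (p - j - 1) = 2 * p by omega]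
  have hu : IsUnit ((2 * j + 2 : ℕ) : ZMod (p ^ 2)) :=
    isUnit_natCast_of_not_dvd fun h => absurd (Nat.le_of_dvd (by omega) h) (by omega)
  rw [← hu.mul_left_eq_zero]
  have := natCast_eq_zero_of_sq_dvd (p := p) (m := 2 * p * (p + j).choose (2 * j + 1))
    (by rw [sq]; exact mul_dvd_mul (Dvd.intro_left _ rfl) hdvd)
  rw [← key] at this
  exact_mod_cast this

lemma alternating_sum_choose_add_prime {w : ZMod (p ^ 2)} (hw : 2 * w = 1) (hodd : Odd p)
    {j : ℕ} (hj : 2 * j < p) :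
    ∑ k ∈ Finset.range p, (-1 : ZMod (p ^ 2)) ^ k * (k + j).choose (2 * j) = (-w ^ 2) ^ j := by
  induction j with
  | zero =>
    simp [neg_one_geom_sum, Nat.not_even_iff_odd.2 hodd]
  | succ j ih =>
    have h := congrArg (Int.cast : ℤ → ZMod (p ^ 2)) (alternating_sum_choose_add j p)
    push_cast at h
    rw [choose_add_prime_add_choose_eq_zero (by omega), ih (by omega)] at h
    rw [pow_succ _ j]
    set B := ∑ k ∈ Finset.range p, (-1 : ZMod (p ^ 2)) ^ k * (k + (j + 1)).choose (2 * (j + 1))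
    linear_combination w ^ 2 * h - B * (2 * w + 1) * hw

lemma choose_two_mul_sq_eq_zero {j : ℕ} (h1 : p < 2 * j) (h2 : j < p) :
    ((2 * j).choose j ^ 2 : ZMod (p ^ 2)) = 0 := by
  have : p ∣ (2 * j).choose j :=
    hp.out.dvd_choose h2 (by omega) h1.le
  exact_mod_cast natCast_eq_zero_of_sq_dvd (p := p) (pow_dvd_pow_of_dvd this 2)

lemma choose_two_mul_sq_eq {n j : ℕ} (hn : p = 2 * n + 1) (hj : j ≤ n) :
    ((2 * j).choose j ^ 2 : ZMod (p ^ 2)) = (-16) ^ j * (n.choose j * (n + j).choose j) := by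
  induction j with
  | zero => simp
  | succ j ih =>
    have hu : IsUnit (((j + 1) ^ 2 : ℕ) : ZMod (p ^ 2)) :=
      isUnit_natCast_of_not_dvd fun h =>
        absurd (Nat.le_of_dvd (by omega) (hp.out.dvd_of_dvd_pow h)) (by omega)
    apply hu.mul_left_cancel
    have c1 := Nat.succ_mul_centralBinom_succ j
    simp only [Nat.centralBinom] at c1
    have c2 := Nat.choose_succ_right_eq n j
    have c3 := Nat.add_one_mul_choose_eq (n + j) j
    obtain ⟨m, rfl⟩ : ∃ m, n = j + m := ⟨n - j, by omega⟩
    rw [Nat.add_sub_cancel_left] at c2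
    apply_fun (Nat.cast : ℕ → ZMod (p ^ 2)) at c1 c2 c3
    have hp' := congrArg (Nat.cast : ℕ → ZMod (p ^ 2)) hn
    have hz := natCast_mul_self_eq_zero (p := p)
    push_cast at c1 c2 c3 hp' ⊢
    rw [hp'] at hz
    have ih' := ih (by omega)
    have c1' : ((j + 1 : ZMod (p ^ 2)) * (2 * (j + 1)).choose (j + 1)) ^ 2 =
      (2 * (2 * j + 1)) ^ 2 * (2 * j).choose j ^ 2 := by rw [c1]; ring
    have c23 : ((j + m).choose (j + 1) * (j + 1) *
        ((j + m + j + 1).choose (j + 1) * (j + 1)) : ZMod (p ^ 2)) =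
        (j + m).choose j * m * ((j + m + j + 1) * (j + m + j).choose j) := by rw [c2, c3]
    rw [show j + m + (j + 1) = j + m + j + 1 by ring, pow_succ _ j]
    linear_combination c1' + (2 * (2 * j + 1) : ZMod (p ^ 2)) ^ 2 * ih' +
      16 * (-16) ^ j * c23 +
      4 * (-16) ^ j * ((j + m).choose j * (j + m + j).choose j) * hz

lemma sum_genCentralTrinomial_sq_eq {w : ZMod (p ^ 2)} (hw : 2 * w = 1) {n : ℕ}
    (hn : p = 2 * n + 1) :
    ∑ k ∈ Finset.range p, (genCentralTrinomial 2 2 k : ZMod (p ^ 2)) ^ 2 * (w ^ 2) ^ k =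
      ∑ j ∈ Finset.range (n + 1), (n.choose j * (n + j).choose j : ZMod (p ^ 2)) * (-2) ^ j := by
  calc _ = ∑ k ∈ Finset.range p, ∑ j ∈ Finset.range p, ((2 * j).choose j ^ 2 * (-w) ^ j) *
        ((-1 : ZMod (p ^ 2)) ^ k * (k + j).choose (2 * j)) := by
        refine Finset.sum_congr rfl fun k hk => ?_
        rw [genCentralTrinomial_two_two_sq_of_two_mul_eq_one hw (Finset.mem_range.1 hk),
          mul_right_comm, ← mul_pow,
          show -4 * w ^ 2 = -1 by linear_combination (-2 * w - 1) * hw, Finset.mul_sum]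
        exact Finset.sum_congr rfl fun j _ => by ring
    _ = ∑ j ∈ Finset.range p, ((2 * j).choose j ^ 2 * (-w) ^ j) *
        ∑ k ∈ Finset.range p, ((-1 : ZMod (p ^ 2)) ^ k * (k + j).choose (2 * j)) := by
        rw [Finset.sum_comm]
        simp only [Finset.mul_sum]
    _ = ∑ j ∈ Finset.range (n + 1), ((2 * j).choose j ^ 2 * (-w) ^ j) *
        ∑ k ∈ Finset.range p, ((-1 : ZMod (p ^ 2)) ^ k * (k + j).choose (2 * j)) := by
        refine (Finset.sum_subset (Finset.range_mono (by omega)) fun j hj hj' => ?_).symm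
        simp only [Finset.mem_range] at hj hj'
        rw [choose_two_mul_sq_eq_zero (by omega) hj, zero_mul, zero_mul]
    _ = _ := by
        refine Finset.sum_congr rfl fun j hj => ?_
        have hj := Finset.mem_range.1 hj
        rw [alternating_sum_choose_add_prime hw ⟨n, hn⟩ (by omega),
          choose_two_mul_sq_eq hn (by omega)]
        rw [mul_assoc, ← mul_pow, mul_right_comm, ← mul_pow, mul_comm]
        congr 2
        linear_combination (-2 : ZMod (p ^ 2)) * (4 * w ^ 2 + 2 * w + 1) * hw

end ModPrimeSq
lemma sum_choose_mul_choose_mul_neg_two_pow {n : ℕ} (hn : Even n) :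
    ∑ j ∈ Finset.range (n + 1), (n.choose j * (n + j).choose j : ℤ) * (-2) ^ j =
      ∑ j ∈ Finset.range (n + 1), (n.choose j * (n + j).choose j : ℤ) := by
  have h := Polynomial.shiftedLegendre_eval_symm n (2 : ℤ)
  rw [hn.neg_one_pow, one_mul, Polynomial.aeval_eq_sum_range, Polynomial.aeval_eq_sum_range,
    Polynomial.natDegree_shiftedLegendre] at h
  simp only [Polynomial.coeff_shiftedLegendre, smul_eq_mul] at h
  convert h using 2 with j _ j _
  · rw [Nat.choose_symm_add, neg_pow]; ring
  · have h1 : ((-1 : ℤ) ^ j) * (-1) ^ j = 1 := by rw [← mul_pow]; simp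
    rw [Nat.choose_symm_add, show (1 - 2 : ℤ) = -1 by norm_num]
    linear_combination (-(n.choose j * (n + j).choose j) : ℤ) * h1

open PowerSeries in
lemma sum_choose_mul_choose_eq_alternating_sum (h : ℕ) :
    ∑ j ∈ Finset.range (2 * h + 1), ((2 * h).choose j * (2 * h + j).choose j : ℤ) =
      ∑ i ∈ Finset.range (h + 1),
        (-1 : ℤ) ^ i * (2 * h).choose i * ((4 * h + 2 * (h - i)).choose (4 * h) : ℕ) := by
  set n := 2 * h with hn
  have e1 : ((invOneSubPow ℤ (n + 1)).val : ℤ⟦X⟧) * (1 + X) ^ n =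
      (1 - X ^ 2) ^ n * (invOneSubPow ℤ (2 * n + 1)).val := by
    have h1 : (1 - X : ℤ⟦X⟧) ^ (n + 1) * (invOneSubPow ℤ (n + 1)).val = 1 := by
      rw [← invOneSubPow_inv_eq_one_sub_pow]; exact (invOneSubPow ℤ _).inv_val
    have h2 : (1 - X : ℤ⟦X⟧) ^ (2 * n + 1) * (invOneSubPow ℤ (2 * n + 1)).val = 1 := by
      rw [← invOneSubPow_inv_eq_one_sub_pow]; exact (invOneSubPow ℤ _).inv_val
    have h3 : (1 - X ^ 2 : ℤ⟦X⟧) ^ n = (1 - X) ^ n * (1 + X) ^ n := by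
      rw [← mul_pow]; ring
    have h4 : (1 - X : ℤ⟦X⟧) ^ (2 * n + 1) = (1 - X) ^ (n + 1) * (1 - X) ^ n := by
      rw [← pow_add]; ring
    rw [h3]
    rw [h4] at h2
    set a := (invOneSubPow ℤ (n + 1)).val
    linear_combination (-a * (1 + X) ^ n) * h2 +
      ((1 - X) ^ n * (1 + X) ^ n * (invOneSubPow ℤ (2 * n + 1)).val) * h1
  have e2 := congrArg (coeff n) e1
  rw [invOneSubPow_val_succ_eq_mk_add_choose, invOneSubPow_val_succ_eq_mk_add_choose,
    coeff_mul, Finset.Nat.sum_antidiagonal_eq_sum_range_succ_mk, sub_eq_neg_add,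
    add_pow (-X ^ 2 : ℤ⟦X⟧) 1 n,
    Finset.sum_mul, map_sum] at e2
  have lhs : ∀ j ∈ Finset.range n.succ, (coeff (j, n - j).1)
      (mk fun k => ((n + k).choose n : ℤ)) * (coeff (j, n - j).2) ((1 + X : ℤ⟦X⟧) ^ n) =
      (n.choose j * (n + j).choose j : ℤ) := by
    intro j hj
    have hj : j ≤ n := Nat.lt_succ_iff.1 (Finset.mem_range.1 hj)
    have : (1 + X : ℤ⟦X⟧) ^ n =
        (((1 + Polynomial.X : Polynomial ℤ) ^ n : Polynomial ℤ) : ℤ⟦X⟧) := by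
      simp
    rw [coeff_mk, this, Polynomial.coeff_coe, Polynomial.coeff_one_add_X_pow, Nat.choose_symm hj,
      Nat.choose_symm_add]
    ring
  rw [Finset.sum_congr rfl lhs] at e2
  rw [Nat.succ_eq_add_one] at e2
  rw [e2]
  have rhs : ∀ i ∈ Finset.range (n + 1), (coeff n) ((-X ^ 2 : ℤ⟦X⟧) ^ i * 1 ^ (n - i) *
      (n.choose i : ℤ⟦X⟧) * mk fun k => ((2 * n + k).choose (2 * n) : ℤ)) =
      if 2 * i ≤ n then (-1) ^ i * n.choose i * ((2 * n + (n - 2 * i)).choose (2 * n) : ℤ)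
        else 0 := by
    intro i _
    have : (-X ^ 2 : ℤ⟦X⟧) ^ i * 1 ^ (n - i) *
      (n.choose i : ℤ⟦X⟧) * (mk fun k => ((2 * n + k).choose (2 * n) : ℤ)) =
      X ^ (2 * i) * (C ((-1) ^ i * n.choose i : ℤ) *
        mk fun k => ((2 * n + k).choose (2 * n) : ℤ)) := by
      rw [neg_pow, one_pow, ← pow_mul]
      simp only [map_mul, map_pow, map_neg, map_one, map_natCast]
      ring
    rw [this, coeff_X_pow_mul', coeff_C_mul, coeff_mk]
  rw [Finset.sum_congr rfl rhs, ← Finset.sum_subset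
    (Finset.range_mono (show h + 1 ≤ n + 1 by omega))]
  · refine Finset.sum_congr rfl fun i hi => ?_
    have := Finset.mem_range.1 hi
    rw [if_pos (by omega), show 2 * n = 4 * h by omega, show n - 2 * i = 2 * (h - i) by omega]
  · intro i _ hi
    rw [if_neg (by simp only [Finset.mem_range] at hi; omega)]

section ModPrimeSq

variable {p : ℕ} [hp : Fact p.Prime]

lemma natCast_mul_choose_add_eq {s : ℕ} (h0 : 0 < s) (hs : s < p) :
    (s * (p - 1 + s).choose (p - 1) : ZMod (p ^ 2)) = p := by
  have hp1 := hp.out.one_lt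
  have h1 := Nat.choose_succ_right_eq (p - 1 + s) (p - 1)
  rw [Nat.add_sub_cancel_left, Nat.sub_add_cancel hp1.le] at h1
  have h2 := Choose.choose_modEq_choose_mod_mul_choose_div_nat (n := p - 1 + s) (k := p) (p := p)
  rw [show p - 1 + s = p + (s - 1) by omega, Nat.mod_self, Nat.add_div_left _ hp.out.pos,
    Nat.div_self hp.out.pos, Nat.choose_zero_right, Nat.div_eq_of_lt (show s - 1 < p by omega),
    Nat.choose_self, mul_one, ← show p - 1 + s = p + (s - 1) by omega] at h2
  rw [mul_comm, ← Nat.cast_mul, ← h1, mul_comm, Nat.cast_mul,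
    prime_mul_eq_of_redModPrime_eq (b := 1),
    mul_one]
  rw [map_natCast, map_one, (ZMod.natCast_eq_natCast_iff _ 1 _).2 h2, Nat.cast_one]

lemma natCast_mul_inv_of_lt {s : ℕ} (h0 : 0 < s) (hs : s < p) :
    (s : ZMod (p ^ 2)) * (s : ZMod (p ^ 2))⁻¹ = 1 :=
  ZMod.mul_inv_of_unit _ <| isUnit_natCast_of_not_dvd fun h =>
    absurd (Nat.le_of_dvd h0 h) (by omega)

lemma sum_choose_mul_choose_eq {w : ZMod (p ^ 2)} (hw : 2 * w = 1) {h : ℕ} (hh : p = 4 * h + 1) :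
    ∑ j ∈ Finset.range (2 * h + 1),
        ((2 * h).choose j * (2 * h + j).choose j : ZMod (p ^ 2)) * (-2) ^ j =
      (-1) ^ h * (2 * h).choose h + p * ∑ i ∈ Finset.range h,
        (-1 : ZMod (p ^ 2)) ^ i * ((2 * h).choose i : ZMod (p ^ 2)) *
          (w * ((h - i : ℕ) : ZMod (p ^ 2))⁻¹) := by
  have h1 := congrArg (Int.cast : ℤ → ZMod (p ^ 2))
    ((sum_choose_mul_choose_mul_neg_two_pow (even_two_mul h)).trans
      (sum_choose_mul_choose_eq_alternating_sum h))
  push_cast at h1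
  rw [h1, Finset.sum_range_succ, Nat.sub_self, mul_zero, add_zero, Nat.choose_self, Nat.cast_one,
    mul_one, add_comm, Finset.mul_sum]
  congr 1
  refine Finset.sum_congr rfl fun i hi => ?_
  have hi := Finset.mem_range.1 hi
  have h2 := natCast_mul_choose_add_eq (p := p) (s := 2 * (h - i)) (by omega) (by omega)
  have h3 := natCast_mul_inv_of_lt (p := p) (s := h - i) (by omega) (by omega)
  rw [show p - 1 = 4 * h by omega] at h2
  rw [Nat.cast_mul, Nat.cast_two] at h2
  rw [← h2]
  set q : ZMod (p ^ 2) := ((h - i : ℕ) : ZMod (p ^ 2))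
  linear_combination (-(-1 : ZMod (p ^ 2)) ^ i * (2 * h).choose i *
    ((4 * h + 2 * (h - i)).choose (4 * h) : ℕ)) * (q * q⁻¹ * hw + h3)

end ModPrimeSq
lemma add_pow_succ_of_mul_self_eq_zero {R : Type*} [CommRing R] {a e : R} (he : e * e = 0)
    (n : ℕ) : (a + e) ^ (n + 1) = a ^ (n + 1) + (n + 1) * e * a ^ n := by
  induction n with
  | zero => simp
  | succ n ih =>
    rw [pow_succ, ih]
    push_cast
    linear_combination ((n + 1) * a ^ n) * he

section Teichmuller

variable {p : ℕ} [hp : Fact p.Prime]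

lemma redModPrime_surjective : Function.Surjective (redModPrime p) := fun t =>
  ⟨(t.val : ZMod (p ^ 2)), by rw [map_natCast, ZMod.natCast_zmod_val]⟩

lemma pow_prime_eq_of_redModPrime_eq {a b : ZMod (p ^ 2)}
    (h : redModPrime p a = redModPrime p b) : a ^ p = b ^ p := by
  obtain ⟨c, hc⟩ := exists_eq_mul_of_redModPrime_eq h
  have h1 := dvd_sub_pow_of_dvd_sub (Dvd.intro _ hc.symm) 1
  rw [← Nat.cast_pow, ZMod.natCast_self, zero_dvd_iff, pow_one] at h1
  exact sub_eq_zero.1 h1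

variable (p) in
/-- The Teichmüller character of `ZMod p`, with values in `ZMod (p ^ 2)`. -/
def teichmullerChar : MulChar (ZMod p) (ZMod (p ^ 2)) where
  toFun t := (t.val : ZMod (p ^ 2)) ^ p
  map_one' := by rw [ZMod.val_one, Nat.cast_one, one_pow]
  map_mul' s t := by
    rw [← mul_pow]
    apply pow_prime_eq_of_redModPrime_eq
    simp
  map_nonunit' t ht := by
    rw [isUnit_iff_ne_zero, not_not] at ht
    simp [ht, hp.out.ne_zero]

lemma teichmullerChar_redModPrime (a : ZMod (p ^ 2)) :
    teichmullerChar p (redModPrime p a) = a ^ p :=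
  pow_prime_eq_of_redModPrime_eq (by simp)

lemma redModPrime_teichmullerChar (t : ZMod p) : redModPrime p (teichmullerChar p t) = t := by
  obtain ⟨a, rfl⟩ := redModPrime_surjective t
  rw [teichmullerChar_redModPrime, map_pow, ZMod.pow_card]

lemma teichmullerChar_pow_prime (t : ZMod p) : teichmullerChar p t ^ p = teichmullerChar p t := by
  rw [← teichmullerChar_redModPrime, redModPrime_teichmullerChar]

lemma teichmullerChar_one_sub (t : ZMod p) :
    teichmullerChar p (1 - t) = (1 - teichmullerChar p t) ^ p := by
  rw [← teichmullerChar_redModPrime, map_sub (redModPrime p), map_one, redModPrime_teichmullerChar]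

lemma sum_teichmullerChar_pow_of_not_dvd {m : ℕ} (hm : ¬ p - 1 ∣ m) :
    ∑ t, teichmullerChar p t ^ m = 0 := by
  have h := mt (FiniteField.forall_pow_eq_one_iff (ZMod p) m).1 (by rwa [ZMod.card])
  push Not at h
  obtain ⟨a, ha⟩ := h
  have h1 : teichmullerChar p a ^ m * ∑ t, teichmullerChar p t ^ m =
      ∑ t, teichmullerChar p t ^ m := by
    rw [Finset.mul_sum]
    exact Fintype.sum_equiv (Equiv.mulLeft₀ (a : ZMod p) a.ne_zero) _ _ fun t => by
      simp [mul_pow]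
  have hu : IsUnit (teichmullerChar p a ^ m - 1) := by
    apply isUnit_of_redModPrime_ne_zero
    rw [map_sub, map_pow, redModPrime_teichmullerChar, map_one, sub_ne_zero]
    exact fun h => ha (Units.ext (by simpa using h))
  exact hu.mul_right_eq_zero.1 (by rw [sub_mul, h1, one_mul, sub_self])

lemma sum_teichmullerChar_pow_of_dvd {m : ℕ} (hm : p - 1 ∣ m) (h0 : m ≠ 0) :
    ∑ t, teichmullerChar p t ^ m = p - 1 := by
  have h1 (t : ZMod p) : teichmullerChar p t ^ m = 1 - if t = 0 then 1 else 0 := by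
    split_ifs with ht
    · rw [ht, MulChar.map_zero, zero_pow h0, sub_self]
    · obtain ⟨c, rfl⟩ := hm
      rw [← map_pow, pow_mul, ZMod.pow_card_sub_one_eq_one ht, one_pow, map_one, sub_zero]
  simp [h1, ZMod.card]

lemma choose_prime_mul_neg_one_pow {k : ℕ} (h0 : 0 < k) (hk : k < p) :
    (p.choose k : ZMod (p ^ 2)) * (-1) ^ k = -p * (k : ZMod (p ^ 2))⁻¹ := by
  have hmod {k : ℕ} (hk : k < p) : ((p - 1).choose k : ZMod p) = (-1) ^ k := by
    induction k with
    | zero => simp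
    | succ k ih =>
      have h1 := Nat.choose_succ_succ (p - 1) k
      rw [Nat.succ_eq_add_one, Nat.sub_add_cancel hp.out.one_lt.le] at h1
      have h2 := congrArg (Nat.cast : ℕ → ZMod p) h1
      rw [(ZMod.natCast_eq_zero_iff _ _).2 (hp.out.dvd_choose_self (by omega) hk),
        Nat.cast_add, ih (by omega)] at h2
      rw [pow_succ]
      linear_combination -h2
  obtain ⟨k, rfl⟩ := Nat.exists_eq_add_one.2 h0
  have h1 := Nat.add_one_mul_choose_eq (p - 1) k
  rw [Nat.sub_add_cancel hp.out.one_lt.le] at h1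
  have h2 := congrArg (Nat.cast : ℕ → ZMod (p ^ 2)) h1
  rw [Nat.cast_mul, Nat.cast_mul, prime_mul_eq_of_redModPrime_eq (b := (-1) ^ k)
    (by simpa using hmod (by omega))] at h2
  have h3 := natCast_mul_inv_of_lt (p := p) h0 hk
  have h4 : ((-1 : ZMod (p ^ 2)) ^ k) * (-1) ^ k = 1 := by rw [← mul_pow]; simp
  rw [pow_succ (-1 : ZMod (p ^ 2)) k]
  set q : ZMod (p ^ 2) := ((k + 1 : ℕ) : ZMod (p ^ 2))
  linear_combination (-1) ^ k * q⁻¹ * h2 - p * q⁻¹ * h4 + (-1) ^ k * (p.choose (k + 1)) * h3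

lemma one_sub_teichmullerChar_pow_prime (hodd : Odd p) (t : ZMod p) :
    (1 - teichmullerChar p t) ^ p = 1 - teichmullerChar p t +
      -p * ∑ k ∈ Finset.Ico 1 p, (k : ZMod (p ^ 2))⁻¹ * teichmullerChar p t ^ k := by
  rw [sub_eq_neg_add, add_pow, Finset.sum_range_succ, Finset.range_eq_Ico,
    Finset.sum_eq_sum_Ico_succ_bot hp.out.pos, hodd.neg_pow, teichmullerChar_pow_prime,
    Finset.mul_sum]
  have : ∀ k ∈ Finset.Ico (0 + 1) p, (-teichmullerChar p t) ^ k * 1 ^ (p - k) * p.choose k =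
      -p * ((k : ZMod (p ^ 2))⁻¹ * teichmullerChar p t ^ k) := by
    intro k hk
    have hk := Finset.mem_Ico.1 hk
    rw [neg_pow]
    linear_combination teichmullerChar p t ^ k * choose_prime_mul_neg_one_pow (p := p) hk.1 hk.2
  rw [Finset.sum_congr rfl this]
  simp
  ring

lemma sum_teichmullerChar_pow_mul_sum {m k : ℕ} (hk : k ∈ Finset.Ico 1 p) (h : p - 1 ∣ m + k) :
    ∑ t, teichmullerChar p t ^ m * ∑ k ∈ Finset.Ico 1 p,
      (k : ZMod (p ^ 2))⁻¹ * teichmullerChar p t ^ k = (p - 1) * (k : ZMod (p ^ 2))⁻¹ := by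
  simp_rw [Finset.mul_sum]
  rw [Finset.sum_comm]
  have (l : ℕ) : ∑ t, teichmullerChar p t ^ m * ((l : ZMod (p ^ 2))⁻¹ * teichmullerChar p t ^ l) =
      (l : ZMod (p ^ 2))⁻¹ * ∑ t, teichmullerChar p t ^ (m + l) := by
    rw [Finset.mul_sum]
    exact Finset.sum_congr rfl fun t _ => by ring
  simp_rw [this]
  have hk' := Finset.mem_Ico.1 hk
  rw [Finset.sum_eq_single_of_mem k hk, sum_teichmullerChar_pow_of_dvd h (by omega), mul_comm]
  intro l hl hlk
  have hl := Finset.mem_Ico.1 hl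
  rw [sum_teichmullerChar_pow_of_not_dvd, mul_zero]
  intro h'
  have h1 : ((p - 1 : ℕ) : ℤ) ∣ l - k := by
    rw [show (l - k : ℤ) = ((m + l : ℕ) : ℤ) - ((m + k : ℕ) : ℤ) by push_cast; ring]
    exact dvd_sub (Int.natCast_dvd_natCast.2 h') (Int.natCast_dvd_natCast.2 h)
  have := Int.eq_zero_of_abs_lt_dvd h1 (by rw [abs_lt]; omega)
  omega

lemma one_sub_teichmullerChar_pow_expand (t : ZMod p) (n : ℕ) :
    (1 - teichmullerChar p t) ^ n =
      ∑ j ∈ Finset.range (n + 1), (-1) ^ j * (n.choose j : ZMod (p ^ 2)) *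
        teichmullerChar p t ^ j := by
  rw [sub_eq_neg_add, add_pow]
  exact Finset.sum_congr rfl fun j _ => by rw [neg_pow]; ring

lemma prime_mul_inv_prime_sub {s : ℕ} (h0 : 0 < s) (hs : s < p) :
    (p * ((p - s : ℕ) : ZMod (p ^ 2))⁻¹ : ZMod (p ^ 2)) = -(p * (s : ZMod (p ^ 2))⁻¹) := by
  have hz := natCast_mul_self_eq_zero (p := p)
  have h1 := natCast_mul_inv_of_lt (p := p) h0 hs
  have h2 := natCast_mul_inv_of_lt (p := p) (s := p - s) (by omega) (by omega)
  have h3 : ((p - s : ℕ) + s : ZMod (p ^ 2)) = p := by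
    rw [← Nat.cast_add, Nat.sub_add_cancel hs.le]
  set a : ZMod (p ^ 2) := ((p - s : ℕ) : ZMod (p ^ 2))
  linear_combination (-p * a⁻¹) * h1 + p * a⁻¹ * (s : ZMod (p ^ 2))⁻¹ * h3 +
    a⁻¹ * (s : ZMod (p ^ 2))⁻¹ * hz - p * (s : ZMod (p ^ 2))⁻¹ * h2

lemma sum_teichmullerChar_pow_mul_eq {h : ℕ} (h0 : 0 < h) (hh : p = 4 * h + 1) :
    ∑ t, teichmullerChar p t ^ (3 * h) * teichmullerChar p (1 - t) ^ (2 * h) =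
      (p - 1) * (-1) ^ h * (2 * h).choose h - p * ∑ i ∈ Finset.range h,
        (-1 : ZMod (p ^ 2)) ^ i * ((2 * h - 1).choose i : ZMod (p ^ 2)) *
          ((h - i : ℕ) : ZMod (p ^ 2))⁻¹ := by
  have hz := natCast_mul_self_eq_zero (p := p)
  have hodd : Odd p := ⟨2 * h, by omega⟩
  obtain ⟨m, hm⟩ : ∃ m, 2 * h = m + 1 := ⟨2 * h - 1, by omega⟩
  have e1 (t : ZMod p) : teichmullerChar p t ^ (3 * h) * teichmullerChar p (1 - t) ^ (2 * h) =
      ∑ j ∈ Finset.range (2 * h + 1), (-1) ^ j * ((2 * h).choose j : ZMod (p ^ 2)) *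
        teichmullerChar p t ^ (3 * h + j) - (2 * h : ℕ) * p *
      ∑ j ∈ Finset.range (2 * h), (-1) ^ j * ((2 * h - 1).choose j : ZMod (p ^ 2)) *
        (teichmullerChar p t ^ (3 * h + j) * ∑ k ∈ Finset.Ico 1 p,
          (k : ZMod (p ^ 2))⁻¹ * teichmullerChar p t ^ k) := by
    rw [teichmullerChar_one_sub, one_sub_teichmullerChar_pow_prime hodd]
    set g := ∑ k ∈ Finset.Ico 1 p, (k : ZMod (p ^ 2))⁻¹ * teichmullerChar p t ^ k
    have e2 := add_pow_succ_of_mul_self_eq_zero (a := 1 - teichmullerChar p t) (e := -p * g)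
      (by linear_combination g * g * hz) m
    have e3 : ((m : ZMod (p ^ 2)) + 1) = (2 * h : ℕ) := by rw [hm]; push_cast; rfl
    rw [e3, ← hm] at e2
    rw [e2, one_sub_teichmullerChar_pow_expand, one_sub_teichmullerChar_pow_expand, mul_add,
      sub_eq_add_neg, Finset.mul_sum, hm, Nat.add_sub_cancel]
    congr 1
    · exact Finset.sum_congr rfl fun j _ => by ring
    · have e4 : ∑ j ∈ Finset.range (m + 1), (-1) ^ j * (m.choose j : ZMod (p ^ 2)) *
          (teichmullerChar p t ^ (3 * h + j) * g) = teichmullerChar p t ^ (3 * h) * g *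
          ∑ j ∈ Finset.range (m + 1), (-1) ^ j * (m.choose j : ZMod (p ^ 2)) *
            teichmullerChar p t ^ j := by
        rw [Finset.mul_sum]
        exact Finset.sum_congr rfl fun j _ => by ring
      rw [e4]
      ring
  rw [Finset.sum_congr rfl fun t _ => e1 t, Finset.sum_sub_distrib, Finset.sum_comm,
    ← Finset.mul_sum Finset.univ, Finset.sum_comm (s := Finset.univ) (t := Finset.range (2 * h))]
  have s1 : ∑ j ∈ Finset.range (2 * h + 1), ∑ t, (-1) ^ j * ((2 * h).choose j : ZMod (p ^ 2)) *
      teichmullerChar p t ^ (3 * h + j) = (p - 1) * (-1) ^ h * (2 * h).choose h := by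
    simp_rw [← Finset.mul_sum]
    rw [Finset.sum_eq_single_of_mem h (by simp; omega), sum_teichmullerChar_pow_of_dvd
      ⟨1, by omega⟩ (by omega)]
    · ring
    · intro j hj hjh
      have hj := Finset.mem_range.1 hj
      rw [sum_teichmullerChar_pow_of_not_dvd, mul_zero]
      rintro ⟨c, hc⟩
      have : c < 2 := by by_contra! hc'; have := Nat.mul_le_mul_left (p - 1) hc'; omega
      interval_cases c <;> omega
  have s2 : (p * ∑ j ∈ Finset.range (2 * h), ∑ t, (-1) ^ j *
      ((2 * h - 1).choose j : ZMod (p ^ 2)) * (teichmullerChar p t ^ (3 * h + j) *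
        ∑ k ∈ Finset.Ico 1 p, (k : ZMod (p ^ 2))⁻¹ * teichmullerChar p t ^ k)) =
      p * (2 * (p - 1) * ∑ i ∈ Finset.range h, (-1 : ZMod (p ^ 2)) ^ i *
        ((2 * h - 1).choose i : ZMod (p ^ 2)) * ((h - i : ℕ) : ZMod (p ^ 2))⁻¹) := by
    have t1 {j : ℕ} (hj : j < h) :
        ∑ t, teichmullerChar p t ^ (3 * h + j) * ∑ k ∈ Finset.Ico 1 p, (k : ZMod (p ^ 2))⁻¹ *
          teichmullerChar p t ^ k = (p - 1) * ((h - j : ℕ) : ZMod (p ^ 2))⁻¹ :=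
      sum_teichmullerChar_pow_mul_sum (Finset.mem_Ico.2 (by omega)) ⟨1, by omega⟩
    have t2 {j : ℕ} (hj : j < h) :
        p * ∑ t, teichmullerChar p t ^ (3 * h + (h + (h - 1 - j))) * ∑ k ∈ Finset.Ico 1 p,
          (k : ZMod (p ^ 2))⁻¹ * teichmullerChar p t ^ k =
        -(p * ((p - 1) * ((h - j : ℕ) : ZMod (p ^ 2))⁻¹)) := by
      rw [sum_teichmullerChar_pow_mul_sum (k := p - (h - j)) (Finset.mem_Ico.2 (by omega))
        ⟨2, by omega⟩, mul_left_comm, prime_mul_inv_prime_sub (by omega) (by omega)]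
      ring
    simp_rw [← Finset.mul_sum Finset.univ]
    rw [show Finset.range (2 * h) = Finset.range (h + h) by rw [two_mul], Finset.sum_range_add,
      ← Finset.sum_range_reflect (fun j => _ * ∑ t, teichmullerChar p t ^ (3 * h + (h + j)) * _) h,
      ← Finset.sum_add_distrib, Finset.mul_sum, Finset.mul_sum, Finset.mul_sum]
    refine Finset.sum_congr rfl fun j hj => ?_
    have hj := Finset.mem_range.1 hj
    have c1 : ((2 * h - 1).choose (h + (h - 1 - j))) = (2 * h - 1).choose j := by
      rw [show h + (h - 1 - j) = 2 * h - 1 - j by omega, Nat.choose_symm (by omega)]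
    have c2 : (-1 : ZMod (p ^ 2)) ^ (h + (h - 1 - j)) = -(-1) ^ j := by
      have : (-1 : ZMod (p ^ 2)) ^ (h + (h - 1 - j)) * (-1) ^ (j + 1) = 1 := by
        rw [← pow_add, show h + (h - 1 - j) + (j + 1) = 2 * h by omega, pow_mul]
        simp
      have c4 : ((-1 : ZMod (p ^ 2)) ^ j) * (-1) ^ j = 1 := by rw [← mul_pow]; simp
      rw [pow_succ (-1 : ZMod (p ^ 2)) j] at this
      linear_combination (-(-1) ^ j) * this - (-1 : ZMod (p ^ 2)) ^ (h + (h - 1 - j)) * c4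
    rw [c1, c2, t1 hj]
    linear_combination (-(-1) ^ j * ((2 * h - 1).choose j : ZMod (p ^ 2))) * t2 hj
  rw [s1, mul_assoc ((2 * h : ℕ) : ZMod (p ^ 2)), s2]
  have hc : (p : ZMod (p ^ 2)) = 4 * h + 1 := by
    have := congrArg (Nat.cast : ℕ → ZMod (p ^ 2)) hh
    push_cast at this
    exact this
  set S := ∑ i ∈ Finset.range h, (-1 : ZMod (p ^ 2)) ^ i *
        ((2 * h - 1).choose i : ZMod (p ^ 2)) * ((h - i : ℕ) : ZMod (p ^ 2))⁻¹
  rw [Nat.cast_mul, Nat.cast_two]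
  linear_combination (2 - p) * S * hz + p * (p - 1) * S * hc

lemma sum_teichmullerChar_pow_mul_eq_neg {h : ℕ} (h0 : 0 < h) (hh : p = 4 * h + 1) :
    ∑ t, teichmullerChar p t ^ (3 * h) * teichmullerChar p (1 - t) ^ (2 * h) =
      -∑ j ∈ Finset.range (2 * h + 1),
        ((2 * h).choose j * (2 * h + j).choose j : ZMod (p ^ 2)) * (-2) ^ j := by
  have hu : IsUnit (2 : ZMod (p ^ 2)) := by
    have := isUnit_natCast_of_not_dvd (p := p) (m := 2)
      fun h => absurd (Nat.le_of_dvd two_pos h) (by omega)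
    exact_mod_cast this
  obtain ⟨w, hw⟩ := hu.exists_right_inv
  have hc : (p : ZMod (p ^ 2)) = 4 * h + 1 := by
    have := congrArg (Nat.cast : ℕ → ZMod (p ^ 2)) hh
    push_cast at this
    exact this
  have hz := natCast_mul_self_eq_zero (p := p)
  rw [sum_teichmullerChar_pow_mul_eq h0 hh, sum_choose_mul_choose_eq hw hh]
  have b1 : 2 * ∑ i ∈ Finset.range h, (-1 : ZMod (p ^ 2)) ^ i * ((2 * h).choose i : ZMod (p ^ 2)) =
      -((-1) ^ h * (2 * h).choose h) := by
    obtain ⟨m, rfl⟩ := Nat.exists_eq_add_one.2 h0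
    have a1 := congrArg (Int.cast : ℤ → ZMod (p ^ 2))
      (Int.alternating_sum_range_choose_eq_choose (n := 2 * m + 1) (m := m))
    have a2 := congrArg (Nat.cast : ℕ → ZMod (p ^ 2)) (Nat.choose_succ_succ' (2 * m + 1) m)
    rw [Nat.choose_symm_half] at a2
    push_cast at a1 a2
    rw [show 2 * (m + 1) = 2 * m + 1 + 1 by ring, a1, a2, pow_succ (-1 : ZMod (p ^ 2)) m]
    ring
  have b2 : ∀ i ∈ Finset.range h, 4 * h * ((-1 : ZMod (p ^ 2)) ^ i *
      ((2 * h).choose i : ZMod (p ^ 2)) * (w * ((h - i : ℕ) : ZMod (p ^ 2))⁻¹) -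
      (-1 : ZMod (p ^ 2)) ^ i * ((2 * h - 1).choose i : ZMod (p ^ 2)) *
        ((h - i : ℕ) : ZMod (p ^ 2))⁻¹) =
      -(2 * ((-1 : ZMod (p ^ 2)) ^ i * ((2 * h).choose i : ZMod (p ^ 2)))) := by
    intro i hi
    have hi := Finset.mem_range.1 hi
    have a1 := Nat.choose_mul_succ_eq (2 * h - 1) i
    rw [Nat.sub_add_cancel (by omega), show 2 * h - i = h + (h - i) by omega] at a1
    have a2 := congrArg (Nat.cast : ℕ → ZMod (p ^ 2)) a1
    have a3 := natCast_mul_inv_of_lt (p := p) (s := h - i) (by omega) (by omega)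
    rw [Nat.cast_mul, Nat.cast_mul, Nat.cast_mul, Nat.cast_add, Nat.cast_two] at a2
    set q : ZMod (p ^ 2) := ((h - i : ℕ) : ZMod (p ^ 2))
    linear_combination (2 * h * (-1) ^ i * ((2 * h).choose i : ZMod (p ^ 2)) * q⁻¹) * hw -
      (2 * (-1) ^ i * q⁻¹) * a2 - (2 * (-1) ^ i * ((2 * h).choose i : ZMod (p ^ 2))) * a3
  have b3 := Finset.sum_congr rfl b2
  rw [← Finset.mul_sum, Finset.sum_sub_distrib, Finset.sum_neg_distrib, ← Finset.mul_sum, b1] at b3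
  set S := ∑ i ∈ Finset.range h, (-1 : ZMod (p ^ 2)) ^ i * ((2 * h - 1).choose i : ZMod (p ^ 2)) *
    ((h - i : ℕ) : ZMod (p ^ 2))⁻¹
  set S' := ∑ i ∈ Finset.range h, (-1 : ZMod (p ^ 2)) ^ i * ((2 * h).choose i : ZMod (p ^ 2)) *
    (w * ((h - i : ℕ) : ZMod (p ^ 2))⁻¹)
  linear_combination (-p : ZMod (p ^ 2)) * b3 - p * (S' - S) * hc + (S' - S) * hz

end Teichmuller
lemma sq_eq_sq_of_prime_eq_add_sq {p : ℕ} (hp : p.Prime) {a b c d : ℤ}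
    (h1 : (p : ℤ) = a ^ 2 + b ^ 2)
    (h2 : (p : ℤ) = c ^ 2 + d ^ 2) (ha : Odd a) (hb : Even b) (hc : Odd c) :
    a ^ 2 = c ^ 2 := by
  have hp0 : (0 : ℤ) < p := by exact_mod_cast hp.pos
  have aux {b d : ℤ} (h1 : (p : ℤ) = a ^ 2 + b ^ 2) (h2 : (p : ℤ) = c ^ 2 + d ^ 2) (hb : Even b)
      (h : (p : ℤ) ∣ a * d - b * c) : a ^ 2 = c ^ 2 := by
    obtain ⟨k, hk⟩ := h
    have h3 : (a * c + b * d) ^ 2 = p ^ 2 * (1 - k ^ 2) := by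
      have : (a * c + b * d) ^ 2 + (a * d - b * c) ^ 2 = p * p := by
        nth_rewrite 1 [h1]
        rw [h2]; ring
      rw [hk] at this
      linear_combination this
    have h4 : a * c + b * d ≠ 0 := by
      have : Odd (a * c + b * d) := (ha.mul hc).add_even (hb.mul_right d)
      rintro h
      simp [h] at this
    have h5 : k = 0 := by
      by_contra hk0
      have h6 : 0 < (a * c + b * d) ^ 2 := by positivity
      have h7 : 1 ≤ k ^ 2 := by
        have : 0 < k ^ 2 := by positivity
        linarith
      nlinarith [sq_nonneg (p : ℤ)]
    have h8 : (p : ℤ) * (a ^ 2 - c ^ 2) = 0 := by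
      rw [h5, mul_zero] at hk
      linear_combination (a * d + b * c) * hk + a ^ 2 * h2 - c ^ 2 * h1
    have := (mul_eq_zero.1 h8).resolve_left hp0.ne'
    linarith
  have h3 : (p : ℤ) ∣ (a * d - b * c) * (a * d - -b * c) :=
    ⟨a ^ 2 - c ^ 2, by linear_combination c ^ 2 * h1 - a ^ 2 * h2⟩
  rcases (Nat.prime_iff_prime_int.1 hp).dvd_mul.1 h3 with h | h
  · exact aux h1 h2 hb h
  · exact aux (by rw [neg_sq]; exact h1) h2 hb.neg h

lemma eq_neg_one_pow_mul_of_prime_eq_add_sq {p h : ℕ} (hp : p.Prime) (hh : p = 4 * h + 1)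
    {x y A B c d : ℤ} (hxy : (p : ℤ) = x ^ 2 + 4 * y ^ 2) (hx : x % 4 = 1)
    (hAB : (p : ℤ) = A ^ 2 + B ^ 2) (hA : A + p = 2 * (c + d)) (hB : B = 2 * (d - c)) :
    A = -((-1) ^ h * x) := by
  have hAodd : Odd A := by
    rw [Int.odd_iff]; omega
  have h1 : A ^ 2 = x ^ 2 := sq_eq_sq_of_prime_eq_add_sq hp hAB
    (show (p : ℤ) = x ^ 2 + (2 * y) ^ 2 by rw [hxy]; ring) hAodd
    (by rw [Int.even_iff]; omega) (by rw [Int.odd_iff]; omega)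
  obtain ⟨m, hm⟩ := hAodd
  obtain ⟨l, hl⟩ : ∃ l, m * (m + 1) = 2 * l := (Int.even_mul_succ_self m).two_dvd
  have h2 : (h : ℤ) = 2 * l + (d - c) ^ 2 := by
    have h3 : (p : ℤ) = 4 * h + 1 := by exact_mod_cast hh
    have h4 : (2 * m + 1) ^ 2 = 8 * l + 1 := by linear_combination 4 * hl
    rw [hm, h4, hB] at hAB
    linarith
  have h5 : Even (h : ℤ) ↔ Even (d - c) := by
    rw [h2, Int.even_add, Int.even_pow' two_ne_zero]
    simp
  have h6 := sq_eq_sq_iff_eq_or_eq_neg.1 h1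
  rcases Nat.even_or_odd h with he | ho
  · rw [he.neg_one_pow, one_mul]
    have := Int.even_iff.1 (h5.1 (by exact_mod_cast he))
    omega
  · rw [ho.neg_one_pow]
    have : ¬ Even (d - c) := fun h7 => by
      have := h5.2 h7
      rw [Int.even_coe_nat] at this
      exact Nat.not_even_iff_odd.2 ho this
    rw [Int.even_iff] at this
    have := Nat.odd_iff.1 ho
    omega

section GaussianJacobi

variable {F : Type*} [Field F] [Fintype F]

/-- The square root of `-1` in the Gaussian integers has order four. -/
lemma isPrimitiveRoot_sqrtd_gaussianInt : IsPrimitiveRoot (Zsqrtd.sqrtd : GaussianInt) 4 := by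
  refine IsPrimitiveRoot.mk_of_lt _ (by norm_num) (by decide) fun l h0 h4 => ?_
  interval_cases l <;> decide

lemma re_sq_add_im_sq_jacobiSum {χ ψ : MulChar F GaussianInt} (h1 : χ ≠ 1) (h2 : ψ ≠ 1)
    (h3 : χ * ψ ≠ 1) :
    (jacobiSum χ ψ).re ^ 2 + (jacobiSum χ ψ).im ^ 2 = Fintype.card F := by
  have hinj := GaussianInt.toComplex_injective
  have h := jacobiSum_mul_jacobiSum_inv (F := F) (F' := ℂ)
    (χ := χ.ringHomComp GaussianInt.toComplex) (φ := ψ.ringHomComp GaussianInt.toComplex)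
    (by rw [ringChar.eq_zero]; exact (CharP.ringChar_ne_zero_of_finite F).symm)
    ((MulChar.ringHomComp_ne_one_iff hinj).2 h1) ((MulChar.ringHomComp_ne_one_iff hinj).2 h2)
    (by rw [← MulChar.ringHomComp_mul]; exact (MulChar.ringHomComp_ne_one_iff hinj).2 h3)
  have h4 (α β : MulChar F ℂ) : jacobiSum α⁻¹ β⁻¹ = starRingEnd ℂ (jacobiSum α β) := by
    simp [jacobiSum, ← MulChar.star_apply']
  rw [h4, jacobiSum_ringHomComp, Complex.mul_conj] at h
  have h5 : Complex.normSq (GaussianInt.toComplex (jacobiSum χ ψ)) = Fintype.card F := by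
    exact_mod_cast h
  rw [Complex.normSq_apply, ← GaussianInt.intCast_re, ← GaussianInt.intCast_im] at h5
  have h6 : (jacobiSum χ ψ).re * (jacobiSum χ ψ).re + (jacobiSum χ ψ).im * (jacobiSum χ ψ).im =
    (Fintype.card F : ℤ) := by exact_mod_cast h5
  linarith

lemma sub_one_dvd_mulChar_apply_sub_one {R : Type*} [CommRing R] [IsDomain R] {n : ℕ} [NeZero n]
    {χ : MulChar F R} {μ : R} (hχ : χ ^ n = 1) (hμ : IsPrimitiveRoot μ n) {x : F} (hx : x ≠ 0) :
    μ - 1 ∣ χ x - 1 := by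
  obtain ⟨k, -, hk⟩ := MulChar.exists_apply_eq_pow hχ hμ hx
  rw [hk]
  exact sub_one_dvd_pow_sub_one μ k

lemma exists_jacobiSum_sq_add_card {χ : MulChar F GaussianInt} (h1 : χ ^ 2 ≠ 1) (h4 : χ ^ 4 = 1) :
    ∃ z, jacobiSum χ (χ ^ 2) + (Fintype.card F : GaussianInt) = z * (2 * (1 - Zsqrtd.sqrtd)) := by
  classical
  have hχ : χ ≠ 1 := fun h => h1 (by rw [h, one_pow])
  have h2 (x : F) : ∃ z, (χ x - 1) * ((χ ^ 2) (1 - x) - 1) = z * (2 * (1 - Zsqrtd.sqrtd)) := by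
    rcases eq_or_ne x 0 with rfl | hx₀
    · exact ⟨0, by simp⟩
    rcases eq_or_ne x 1 with rfl | hx₁
    · exact ⟨0, by simp⟩
    obtain ⟨z, hz⟩ := sub_one_dvd_mulChar_apply_sub_one h4 isPrimitiveRoot_sqrtd_gaussianInt hx₀
    obtain ⟨z', hz'⟩ := sub_one_dvd_mulChar_apply_sub_one (χ := χ ^ 2) (n := 2)
      (μ := (-1 : GaussianInt)) (by rw [← pow_mul, h4])
      (IsPrimitiveRoot.mk_of_lt _ (by norm_num) (by decide) fun l h0 h4 => by
        interval_cases l; decide) (sub_ne_zero.2 hx₁.symm)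
    exact ⟨z * z', by rw [hz, hz']; ring⟩
  choose f hf using h2
  refine ⟨∑ x, f x, ?_⟩
  rw [Finset.sum_mul, ← Finset.sum_congr rfl fun x _ => hf x]
  have h5 : ∑ x, (χ ^ 2) (1 - x) = 0 := by
    exact ((Equiv.subLeft (1 : F)).sum_comp fun x => (χ ^ 2) x).trans
      (MulChar.sum_eq_zero_of_ne_one h1)
  have h6 (x : F) : (χ x - 1) * ((χ ^ 2) (1 - x) - 1) =
    χ x * (χ ^ 2) (1 - x) - χ x - (χ ^ 2) (1 - x) + 1 := by ring
  simp_rw [h6]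
  rw [Finset.sum_add_distrib, Finset.sum_sub_distrib, Finset.sum_sub_distrib, h5,
    MulChar.sum_eq_zero_of_ne_one hχ, jacobiSum]
  simp

end GaussianJacobi

section ModPrimeSq

variable {p : ℕ} [hp : Fact p.Prime]

lemma sq_teichmullerChar_generator {h : ℕ} (h0 : 0 < h) (hh : p = 4 * h + 1) {g : (ZMod p)ˣ}
    (hg : ∀ x, x ∈ Subgroup.zpowers g) :
    teichmullerChar p g ^ (3 * h) * teichmullerChar p g ^ (3 * h) = -1 := by
  have hord : orderOf g = 4 * h := by
    rw [orderOf_eq_card_of_forall_mem_zpowers hg, Nat.card_eq_fintype_card, ZMod.card_units]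
    omega
  have h1 : teichmullerChar p g ^ (4 * h) = 1 := by
    rw [← map_pow, ← Units.val_pow_eq_pow_val, ← hord, pow_orderOf_eq_one, Units.val_one, map_one]
  have hu : IsUnit (teichmullerChar p g ^ (2 * h) - 1) := by
    apply isUnit_of_redModPrime_ne_zero
    rw [map_sub, map_pow, redModPrime_teichmullerChar, map_one, sub_ne_zero]
    intro h2
    have h3 : g ^ (2 * h) = 1 := Units.ext (by simpa using h2)
    have := Nat.le_of_dvd (by omega) (hord ▸ orderOf_dvd_of_pow_eq_one h3)
    omega
  have h2 : teichmullerChar p g ^ (2 * h) = -1 := by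
    rw [eq_neg_iff_add_eq_zero, ← hu.mul_right_eq_zero]
    rw [show 4 * h = 2 * h + 2 * h by ring, pow_add] at h1
    linear_combination h1
  rw [← pow_add, show 3 * h + 3 * h = 4 * h + 2 * h by ring, pow_add, h1, h2, one_mul]

lemma exists_mulChar_ringHomComp_eq {h : ℕ} (h0 : 0 < h) (hh : p = 4 * h + 1) :
    ∃ (χ : MulChar (ZMod p) GaussianInt) (f : GaussianInt →+* ZMod (p ^ 2)),
      χ ^ 2 ≠ 1 ∧ χ * χ ^ 2 ≠ 1 ∧ χ ^ 4 = 1 ∧ χ.ringHomComp f = teichmullerChar p ^ (3 * h) := by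
  obtain ⟨g, hg⟩ := IsCyclic.exists_generator (α := (ZMod p)ˣ)
  have hi := isPrimitiveRoot_sqrtd_gaussianInt
  have hmem : (hi.isUnit (by norm_num)).unit ∈
      rootsOfUnity (Fintype.card (ZMod p)ˣ) GaussianInt := by
    rw [mem_rootsOfUnity', IsUnit.unit_spec, ZMod.card_units, show p - 1 = 4 * h by omega, pow_mul,
      hi.pow_eq_one, one_pow]
  have hs := MulChar.ofRootOfUnity_spec hmem hg
  rw [IsUnit.unit_spec] at hs
  refine ⟨MulChar.ofRootOfUnity hmem hg,
    Zsqrtd.lift ⟨teichmullerChar p g ^ (3 * h), ?_⟩, ?_, ?_, ?_, ?_⟩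
  · rw [sq_teichmullerChar_generator h0 hh hg]; simp
  · refine MulChar.ne_one_iff.2 ⟨g, ?_⟩
    rw [MulChar.pow_apply_coe, hs]
    decide
  · refine MulChar.ne_one_iff.2 ⟨g, ?_⟩
    rw [MulChar.mul_apply, MulChar.pow_apply_coe, hs]
    decide
  · rw [MulChar.eq_iff hg, MulChar.pow_apply_coe, hs, MulChar.one_apply_coe, hi.pow_eq_one]
  · rw [MulChar.eq_iff hg, MulChar.pow_apply_coe, MulChar.ringHomComp_apply, hs]
    simp [Zsqrtd.lift]

lemma sum_choose_mul_choose_quadratic {h : ℕ} (h0 : 0 < h) (hh : p = 4 * h + 1) {x y : ℤ}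
    (hxy : (p : ℤ) = x ^ 2 + 4 * y ^ 2) (hx : x % 4 = 1) {D : ZMod (p ^ 2)}
    (hD : D = ∑ j ∈ Finset.range (2 * h + 1),
      ((2 * h).choose j * (2 * h + j).choose j : ZMod (p ^ 2)) * (-2) ^ j) :
    D ^ 2 - 2 * (-1) ^ h * x * D + p = 0 := by
  obtain ⟨χ, f, h1, h3, h4, hf⟩ := exists_mulChar_ringHomComp_eq h0 hh
  have hχ : χ ≠ 1 := fun h => h1 (by rw [h, one_pow])
  have hfJ : f (jacobiSum χ (χ ^ 2)) = -D := by
    rw [hD, ← sum_teichmullerChar_pow_mul_eq_neg h0 hh, ← jacobiSum_ringHomComp,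
      ← MulChar.ringHomComp_pow, hf, jacobiSum]
    refine Finset.sum_congr rfl fun t _ => ?_
    rw [MulChar.pow_apply' _ (by omega), ← pow_mul, MulChar.pow_apply' _ (by omega)]
    congr 1
    rcases eq_or_ne (1 - t) 0 with ht | ht
    · rw [ht, MulChar.map_zero, zero_pow (by omega), zero_pow (by omega)]
    · rw [show 3 * h * 2 = (p - 1) + 2 * h by omega, pow_add, ← map_pow _ _ (p - 1),
        ZMod.pow_card_sub_one_eq_one ht, map_one, one_mul]
  have hnorm := re_sq_add_im_sq_jacobiSum hχ h1 h3
  obtain ⟨z, hz⟩ := exists_jacobiSum_sq_add_card h1 h4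
  rw [ZMod.card] at hnorm hz
  set J := jacobiSum χ (χ ^ 2)
  have hre := congrArg Zsqrtd.re hz
  have him := congrArg Zsqrtd.im hz
  simp at hre him
  have hA := eq_neg_one_pow_mul_of_prime_eq_add_sq (c := z.re) (d := z.im) hp.out hh hxy hx
    hnorm.symm (by linarith) (by linarith)
  have hJ : J * J - 2 * J.re * J + p = 0 := by
    ext
    · simp
      linear_combination -hnorm
    · simp
      ring
  have hJ' := congrArg f hJ
  rw [map_add, map_sub, map_mul, map_mul, map_mul, hfJ, map_intCast, map_natCast, map_ofNat,
    map_zero, hA] at hJ'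
  push_cast at hJ'
  linear_combination hJ'

lemma two_mul_mul_sum_choose_mul_choose {h : ℕ} (h0 : 0 < h) (hh : p = 4 * h + 1) {x y : ℤ}
    (hxy : (p : ℤ) = x ^ 2 + 4 * y ^ 2) (hx : x % 4 = 1) :
    2 * x * ∑ j ∈ Finset.range (2 * h + 1),
      ((2 * h).choose j * (2 * h + j).choose j : ZMod (p ^ 2)) * (-2) ^ j =
    (-1) ^ h * (4 * x ^ 2 - p) := by
  set D := ∑ j ∈ Finset.range (2 * h + 1),
      ((2 * h).choose j * (2 * h + j).choose j : ZMod (p ^ 2)) * (-2) ^ j with hD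
  have hz := natCast_mul_self_eq_zero (p := p)
  have hq := sum_choose_mul_choose_quadratic h0 hh hxy hx hD
  have hu2 : IsUnit (2 : ZMod (p ^ 2)) := by
    have := isUnit_natCast_of_not_dvd (p := p) (m := 2)
      fun h => absurd (Nat.le_of_dvd two_pos h) (by omega)
    exact_mod_cast this
  obtain ⟨w, hw⟩ := hu2.exists_right_inv
  have hu : IsUnit D := by
    apply isUnit_of_redModPrime_ne_zero
    rw [hD, sum_choose_mul_choose_eq hw hh, map_add, map_mul, map_mul, map_pow, map_neg, map_one,
      map_natCast, map_natCast, ZMod.natCast_self, zero_mul, add_zero]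
    refine mul_ne_zero (pow_ne_zero _ (neg_ne_zero.2 one_ne_zero)) ?_
    rw [Ne, ZMod.natCast_eq_zero_iff]
    intro hdvd
    have hf := Nat.choose_mul_factorial_mul_factorial (show h ≤ 2 * h by omega)
    rw [mul_assoc] at hf
    have := hp.out.dvd_factorial.1 (hdvd.trans (Dvd.intro _ hf))
    omega
  have he : ((-1 : ZMod (p ^ 2)) ^ h) * (-1) ^ h = 1 := by rw [← mul_pow]; simp
  have hsq : (D - 2 * (-1) ^ h * x) ^ 2 = 0 := by
    rw [← (hu.pow 2).mul_right_eq_zero]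
    linear_combination (D ^ 2 - 2 * (-1) ^ h * x * D - p) * hq + hz
  linear_combination (-1) ^ h * (hq - hsq) - 2 * x * D * he + 4 * x ^ 2 * (-1) ^ h * he

end ModPrimeSq

lemma legendreSym_two_eq_neg_one_pow {p : ℕ} [Fact p.Prime] {h : ℕ} (hh : p = 4 * h + 1) :
    legendreSym p 2 = (-1) ^ h := by
  rw [legendreSym.at_two (by omega), ZMod.χ₈_nat_eq_if_mod_eight, if_neg (by omega)]
  rcases Nat.even_or_odd h with hp | hp
  · rw [hp.neg_one_pow, if_pos]
    obtain ⟨k, rfl⟩ := hp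
    omega
  · rw [hp.neg_one_pow, if_neg]
    obtain ⟨k, rfl⟩ := hp
    omega

lemma prime_not_dvd_of_prime_eq_sq_add {p : ℕ} (hp : p.Prime) (hodd : Odd p) {x y : ℤ}
    (hxy : (p : ℤ) = x ^ 2 + 4 * y ^ 2) : ¬ (p : ℤ) ∣ x := by
  intro hx
  have hpZ := Nat.prime_iff_prime_int.1 hp
  have hy : (p : ℤ) ∣ y := by
    have h1 : (p : ℤ) ∣ 2 ^ 2 * y ^ 2 := by
      have h2 : (2 : ℤ) ^ 2 * y ^ 2 = p - x ^ 2 := by linear_combination -hxy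
      rw [h2]
      exact dvd_sub dvd_rfl (dvd_pow hx two_ne_zero)
    rcases hpZ.dvd_or_dvd h1 with h2 | h2
    · have h3 : p ∣ 2 := by exact_mod_cast hpZ.dvd_of_dvd_pow h2
      rw [(Nat.prime_dvd_prime_iff_eq hp Nat.prime_two).1 h3] at hodd
      exact absurd hodd (by decide)
    · exact hpZ.dvd_of_dvd_pow h2
  obtain ⟨a, rfl⟩ := hx
  obtain ⟨b, rfl⟩ := hy
  exact hpZ.not_dvd_one ⟨a ^ 2 + 4 * b ^ 2,
    mul_left_cancel₀ hpZ.ne_zero (by linear_combination hxy)⟩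

lemma prime_sq_dvd_sum_genCentralTrinomial_sub {p : ℕ} [hp : Fact p.Prime] {h : ℕ} (h0 : 0 < h)
    (hh : p = 4 * h + 1) {x y : ℤ} (hxy : (p : ℤ) = x ^ 2 + 4 * y ^ 2) (hx : x % 4 = 1) :
    ((p ^ 2 : ℕ) : ℤ) ∣ 2 * x * ∑ k ∈ Finset.range p, genCentralTrinomial 2 2 k ^ 2 * 4 ^ (p - k) -
      (-1) ^ h * (4 * x ^ 2 - p) * 4 ^ p := by
  rw [← ZMod.intCast_zmod_eq_zero_iff_dvd]
  obtain ⟨w, hw⟩ := isUnit_iff_exists_inv.1 (isUnit_natCast_of_not_dvd (p := p) (m := 2)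
    (fun hd => by have := Nat.le_of_dvd two_pos hd; omega))
  rw [Nat.cast_ofNat] at hw
  have hsum : ∑ k ∈ Finset.range p,
      (genCentralTrinomial 2 2 k : ZMod (p ^ 2)) ^ 2 * 4 ^ (p - k) =
      4 ^ p * ∑ k ∈ Finset.range p,
        (genCentralTrinomial 2 2 k : ZMod (p ^ 2)) ^ 2 * (w ^ 2) ^ k := by
    rw [Finset.mul_sum]
    refine Finset.sum_congr rfl fun k hk => ?_
    have h1 : (4 : ZMod (p ^ 2)) ^ k * (w ^ 2) ^ k = 1 := by
      rw [← mul_pow, show (4 : ZMod (p ^ 2)) * w ^ 2 = (2 * w) ^ 2 by ring, hw, one_pow, one_pow]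
    have h2 : (4 : ZMod (p ^ 2)) ^ p = 4 ^ (p - k) * 4 ^ k := by
      rw [← pow_add, Nat.sub_add_cancel (Finset.mem_range.1 hk).le]
    rw [h2]
    linear_combination (-(genCentralTrinomial 2 2 k : ZMod (p ^ 2)) ^ 2 * 4 ^ (p - k)) * h1
  have hmain := two_mul_mul_sum_choose_mul_choose h0 hh hxy hx
  push_cast
  rw [hsum, sum_genCentralTrinomial_sq_eq hw (n := 2 * h) (by omega)]
  linear_combination 4 ^ p * hmain

theorem sum_T22_sq_div_four_pow_one_mod_four (p : ℕ) [Fact p.Prime]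
    (hp1 : p % 4 = 1) (x y : ℤ) (hxy : (p : ℤ) = x ^ 2 + 4 * y ^ 2)
    (hx : x % 4 = 1) :
    ‖(∑ k ∈ Finset.range p,
        (genCentralTrinomial 2 2 k : ℚ_[p]) ^ 2 / (4 : ℚ_[p]) ^ k) -
      (legendreSym p 2 : ℚ_[p]) *
        (2 * (x : ℚ_[p]) - (p : ℚ_[p]) / (2 * (x : ℚ_[p])))‖ ≤
      (p : ℝ)⁻¹ ^ 2 := by
  have hp : p.Prime := Fact.out
  obtain ⟨h, hh⟩ : ∃ h, p = 4 * h + 1 := ⟨p / 4, by omega⟩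
  have h0 : 0 < h := by have := hp.two_le; omega
  have hxp := prime_not_dvd_of_prime_eq_sq_add hp (Nat.odd_iff.2 (by omega)) hxy
  have hx0 : (x : ℚ_[p]) ≠ 0 := by
    rw [Int.cast_ne_zero]
    rintro rfl
    exact hxp (dvd_zero _)
  have hpZ := Nat.prime_iff_prime_int.1 hp
  have hp2 : ¬ (p : ℤ) ∣ 2 := fun hd => by
    have := Int.le_of_dvd two_pos hd
    omega
  have hD : ‖((2 * x * 2 ^ (2 * p) : ℤ) : ℚ_[p])‖ = 1 := by
    refine le_antisymm (Padic.norm_int_le_one _) (not_lt.1 fun hlt => ?_)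
    rcases hpZ.dvd_or_dvd (Padic.norm_intCast_lt_one_iff.1 hlt) with hd | hd
    · exact (hpZ.dvd_or_dvd hd).elim hp2 hxp
    · exact hp2 (hpZ.dvd_of_dvd_pow hd)
  have hN := prime_sq_dvd_sum_genCentralTrinomial_sub h0 hh hxy hx
  rw [Nat.cast_pow, ← Padic.norm_int_le_pow_iff_dvd, zpow_neg, zpow_natCast, ← inv_pow] at hN
  refine le_trans (le_of_eq ?_) hN
  rw [← one_mul ‖_ - _‖, ← hD, ← norm_mul]
  congr 1
  have hsum : ∑ k ∈ Finset.range p, (genCentralTrinomial 2 2 k : ℚ_[p]) ^ 2 * 4 ^ (p - k) =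
      4 ^ p * ∑ k ∈ Finset.range p, (genCentralTrinomial 2 2 k : ℚ_[p]) ^ 2 / 4 ^ k := by
    rw [Finset.mul_sum]
    refine Finset.sum_congr rfl fun k hk => ?_
    rw [pow_sub₀ _ (by norm_num : (4 : ℚ_[p]) ≠ 0) (Finset.mem_range.1 hk).le]
    ring
  rw [legendreSym_two_eq_neg_one_pow hh]
  push_cast
  rw [hsum, pow_mul, show (2 : ℚ_[p]) ^ 2 = 4 by norm_num]
  field_simp
  ring
end

section
/- Let p be a prime with p ≡ 3 (mod 4). Then ∑_{k=0}^{p-1} T_k(2,2)^2 / 4^k ≡ (-1)^{(p+1)/4} · 2p / binom((p+1)/2, (p+1)/4) (mod p^2); both sides are p-adic integers. -/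
open Finset Polynomial

/-- The `k`-th summand of `T_n(2,2) / 2^n`, as a polynomial function of `n`. -/
noncomputable def trinomialTerm (x : ℚ) (k : ℕ) : ℚ :=
  (descPochhammer ℚ (2 * k)).eval x / (2 ^ k * (k.factorial : ℚ) ^ 2)

/-- The `j`-th summand in the expansion of `(T_n(2,2) / 2^n)^2`, as a polynomial function of `n`. -/
noncomputable def squareTerm (x : ℚ) (j : ℕ) : ℚ :=
  (descPochhammer ℚ (4 * j)).eval (x + 2 * j) *
    (j.centralBinom / (4 ^ j * ((2 * j).factorial : ℚ) ^ 2))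

lemma descPochhammer_eval_succ_left (x : ℚ) (k : ℕ) :
    (descPochhammer ℚ (k + 1)).eval x = x * (descPochhammer ℚ k).eval (x - 1) := by
  simp [descPochhammer_succ_left]

lemma sum_trinomialTerm_recurrence (x : ℚ) (N : ℕ) :
    ∑ k ∈ range (N + 1), ((x + 1) * trinomialTerm (x + 1) k - (2 * x + 1) * trinomialTerm x k
      - x * trinomialTerm (x - 1) k) = -2 * x * trinomialTerm (x - 1) N := by
  induction N with
  | zero => simp [trinomialTerm]
  | succ N ih =>
    rw [sum_range_succ, ih]
    have e1 : (descPochhammer ℚ (2 * (N + 1))).eval (x + 1)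
        = (x + 1) * x * (descPochhammer ℚ (2 * N)).eval (x - 1) := by
      rw [show 2 * (N + 1) = 2 * N + 1 + 1 by ring, descPochhammer_eval_succ_left,
        descPochhammer_eval_succ_left]
      ring_nf
    have e2 : (descPochhammer ℚ (2 * (N + 1))).eval x
        = x * (descPochhammer ℚ (2 * N)).eval (x - 1) * (x - 2 * N - 1) := by
      rw [show 2 * (N + 1) = 2 * N + 1 + 1 by ring, descPochhammer_succ_eval,
        descPochhammer_eval_succ_left]
      push_cast; ring
    have e3 : (descPochhammer ℚ (2 * (N + 1))).eval (x - 1)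
        = (descPochhammer ℚ (2 * N)).eval (x - 1) * (x - 1 - 2 * N) * (x - 2 - 2 * N) := by
      rw [show 2 * (N + 1) = 2 * N + 1 + 1 by ring, descPochhammer_succ_eval,
        descPochhammer_succ_eval]
      push_cast; ring
    have hN : (N.factorial : ℚ) ≠ 0 := by positivity
    simp only [trinomialTerm, e1, e2, e3, Nat.factorial_succ]
    push_cast
    field_simp
    ring

lemma sum_squareTerm_recurrence (x : ℚ) (N : ℕ) :
    ∑ j ∈ range (N + 1), ((2 * x + 1) * ((x + 2) ^ 2 * squareTerm (x + 2) j
        - (2 * x + 3) ^ 2 * squareTerm (x + 1) j - (x + 1) ^ 2 * squareTerm x j)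
      - 2 * (2 * x + 1) ^ 2 * (2 * x + 3) * squareTerm x j
      - (2 * x + 3) * ((x + 1) ^ 2 * squareTerm (x + 1) j
        - (2 * x + 1) ^ 2 * squareTerm x j - x ^ 2 * squareTerm (x - 1) j)) =
    -4 * (2 * x + 1) * (2 * x + 3) * (descPochhammer ℚ (4 * N + 1)).eval (x + 2 * N + 1) *
      (N.centralBinom / (4 ^ N * ((2 * N).factorial : ℚ) ^ 2)) := by
  induction N with
  | zero => simp [squareTerm]; ring
  | succ N ih =>
    rw [sum_range_succ, ih]
    set W := (descPochhammer ℚ (4 * N + 1)).eval (x + 2 * N + 1) with hW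
    have e0 : (descPochhammer ℚ (4 * (N + 1))).eval (x - 1 + 2 * (N + 1 : ℕ))
        = W * (x - 2 * N) * (x - 2 * N - 1) * (x - 2 * N - 2) := by
      rw [show 4 * (N + 1) = 4 * N + 1 + 1 + 1 + 1 by ring,
        show x - 1 + 2 * (N + 1 : ℕ) = x + 2 * N + 1 by push_cast; ring,
        descPochhammer_succ_eval, descPochhammer_succ_eval, descPochhammer_succ_eval, ← hW]
      push_cast; ring
    have e1 : (descPochhammer ℚ (4 * (N + 1))).eval (x + 2 * (N + 1 : ℕ))
        = W * (x + 2 * N + 2) * (x - 2 * N) * (x - 2 * N - 1) := by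
      rw [show 4 * (N + 1) = 4 * N + 1 + 1 + 1 + 1 by ring, descPochhammer_eval_succ_left,
        show x + 2 * (N + 1 : ℕ) - 1 = x + 2 * N + 1 by push_cast; ring,
        descPochhammer_succ_eval, descPochhammer_succ_eval, ← hW]
      push_cast; ring
    have e2 : (descPochhammer ℚ (4 * (N + 1))).eval (x + 1 + 2 * (N + 1 : ℕ))
        = W * (x + 2 * N + 3) * (x + 2 * N + 2) * (x - 2 * N) := by
      rw [show 4 * (N + 1) = 4 * N + 1 + 1 + 1 + 1 by ring, descPochhammer_eval_succ_left,
        descPochhammer_eval_succ_left,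
        show x + 1 + 2 * (N + 1 : ℕ) - 1 - 1 = x + 2 * N + 1 by push_cast; ring,
        descPochhammer_succ_eval, ← hW]
      push_cast; ring
    have e3 : (descPochhammer ℚ (4 * (N + 1))).eval (x + 2 + 2 * (N + 1 : ℕ))
        = W * (x + 2 * N + 4) * (x + 2 * N + 3) * (x + 2 * N + 2) := by
      rw [show 4 * (N + 1) = 4 * N + 1 + 1 + 1 + 1 by ring, descPochhammer_eval_succ_left,
        descPochhammer_eval_succ_left, descPochhammer_eval_succ_left,
        show x + 2 + 2 * (N + 1 : ℕ) - 1 - 1 - 1 = x + 2 * N + 1 by push_cast; ring, ← hW]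
      push_cast; ring
    have e4 : (descPochhammer ℚ (4 * (N + 1) + 1)).eval (x + 2 * (N + 1 : ℕ) + 1)
        = W * (x + 2 * N + 3) * (x + 2 * N + 2) * (x - 2 * N) * (x - 2 * N - 1) := by
      rw [show 4 * (N + 1) + 1 = 4 * N + 1 + 1 + 1 + 1 + 1 by ring, descPochhammer_eval_succ_left,
        descPochhammer_eval_succ_left,
        show x + 2 * (N + 1 : ℕ) + 1 - 1 - 1 = x + 2 * N + 1 by push_cast; ring,
        descPochhammer_succ_eval, descPochhammer_succ_eval, ← hW]
      push_cast; ring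
    have hN : ((2 * N).factorial : ℚ) ≠ 0 := by positivity
    have hc : ((N + 1).centralBinom : ℚ) = 2 * (2 * N + 1) * N.centralBinom / (N + 1) := by
      rw [eq_div_iff (by positivity), mul_comm]
      exact_mod_cast Nat.succ_mul_centralBinom_succ N
    simp only [squareTerm, e0, e1, e2, e3, e4, hc]
    rw [show 2 * (N + 1) = 2 * N + 1 + 1 by ring, Nat.factorial_succ, Nat.factorial_succ]
    push_cast
    field_simp
    ring

lemma trinomialTerm_eq_zero {n k : ℕ} (h : n < 2 * k) : trinomialTerm n k = 0 := by
  simp [trinomialTerm, descPochhammer_eval_coe_nat_of_lt h]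

lemma squareTerm_eq_zero {n j : ℕ} (h : n < 2 * j) : squareTerm n j = 0 := by
  have : (n : ℚ) + 2 * j = ((n + 2 * j : ℕ) : ℚ) := by push_cast; ring
  rw [squareTerm, this, descPochhammer_eval_coe_nat_of_lt (by omega), zero_mul]

lemma sum_trinomialTerm {n N : ℕ} (h : n < 2 * N) :
    ∑ k ∈ range N, trinomialTerm n k = (genCentralTrinomial 2 2 n : ℚ) / 2 ^ n := by
  rw [← sum_subset (s₁ := range (n / 2 + 1)) (range_mono (by omega))
    fun k _ hk => trinomialTerm_eq_zero (by simp at hk; omega), genCentralTrinomial]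
  push_cast
  rw [sum_div]
  refine sum_congr rfl fun k hk => ?_
  have hk : 2 * k ≤ n := by simp at hk; omega
  have h1 : (n.descFactorial (2 * k) : ℚ) = (2 * k).factorial * n.choose (2 * k) := by
    exact_mod_cast Nat.descFactorial_eq_factorial_mul_choose n (2 * k)
  have h2 : ((2 * k).choose k : ℚ) * k.factorial ^ 2 = (2 * k).factorial := by
    have := Nat.choose_mul_factorial_mul_factorial (n := 2 * k) (k := k) (by omega)
    rw [show 2 * k - k = k by omega] at this
    rw [← this]; push_cast; ring
  have h3 : (2 : ℚ) ^ n = 2 ^ (n - 2 * k) * 2 ^ k * 2 ^ k := by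
    rw [← pow_add, ← pow_add]; congr 1; omega
  rw [trinomialTerm, descPochhammer_eval_eq_descFactorial, h1, ← h2, h3]
  field_simp

lemma trinomial_recurrence (n : ℕ) :
    ((n : ℚ) + 2) * ((genCentralTrinomial 2 2 (n + 2) : ℚ) / 2 ^ (n + 2)) =
      (2 * n + 3) * ((genCentralTrinomial 2 2 (n + 1) : ℚ) / 2 ^ (n + 1)) +
        (n + 1) * ((genCentralTrinomial 2 2 n : ℚ) / 2 ^ n) := by
  have h := sum_trinomialTerm_recurrence (n + 1 : ℕ) (n + 2)
  have e0 : ((n + 1 : ℕ) : ℚ) - 1 = n := by push_cast; ring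
  have e2 : ((n + 1 : ℕ) : ℚ) + 1 = (n + 2 : ℕ) := by push_cast; ring
  rw [e0, e2, trinomialTerm_eq_zero (n := n) (by omega)] at h
  simp only [sum_sub_distrib, ← mul_sum] at h
  rw [sum_trinomialTerm (by omega), sum_trinomialTerm (by omega), sum_trinomialTerm (by omega)] at h
  push_cast at h
  linarith

lemma sum_squareTerm_extend {n N M : ℕ} (h : n < 2 * N) (hM : N ≤ M) :
    ∑ j ∈ range M, squareTerm n j = ∑ j ∈ range N, squareTerm n j :=
  (sum_subset (range_mono hM) fun j _ hj => squareTerm_eq_zero (by simp at hj; omega)).symm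

lemma trinomial_sq_eq_sum {n N : ℕ} (h : n < 2 * N) :
    (genCentralTrinomial 2 2 n : ℚ) ^ 2 / 4 ^ n = ∑ j ∈ range N, squareTerm n j := by
  have key : ∀ n, ((genCentralTrinomial 2 2 n : ℚ) / 2 ^ n) ^ 2
      = ∑ j ∈ range (n + 1), squareTerm n j := by
    intro n
    induction n using Nat.strong_induction_on with
    | _ n ih =>
      match n with
      | 0 => simp [genCentralTrinomial, squareTerm]
      | 1 =>
        rw [sum_squareTerm_extend (N := 1) (by omega) (by omega)]
        simp [genCentralTrinomial, squareTerm]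
      | 2 =>
        rw [sum_squareTerm_extend (N := 2) (by omega) (by omega)]
        simp [genCentralTrinomial, squareTerm, sum_range_succ, descPochhammer_eval_succ_left,
          Nat.centralBinom, Nat.choose, Nat.factorial]
        norm_num
      | n + 3 =>
        have i0 := ih n (by omega)
        have i1 := ih (n + 1) (by omega)
        have i2 := ih (n + 2) (by omega)
        have h := sum_squareTerm_recurrence (n + 1 : ℕ) (n + 3)
        have e0 : ((n + 1 : ℕ) : ℚ) - 1 = n := by push_cast; ring
        have e2 : ((n + 1 : ℕ) : ℚ) + 1 = (n + 2 : ℕ) := by push_cast; ring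
        have e3 : ((n + 1 : ℕ) : ℚ) + 2 = (n + 3 : ℕ) := by push_cast; ring
        have e4 : ((n + 1 : ℕ) : ℚ) + 2 * (n + 3 : ℕ) + 1 = (3 * n + 8 : ℕ) := by push_cast; ring
        rw [e0, e2, e3, e4, descPochhammer_eval_coe_nat_of_lt (by omega)] at h
        simp only [sum_sub_distrib, ← mul_sum] at h
        rw [sum_squareTerm_extend (n := n) (N := n + 1) (by omega) (by omega),
          sum_squareTerm_extend (n := n + 1) (N := n + 1 + 1) (by omega) (by omega),
          sum_squareTerm_extend (n := n + 2) (N := n + 2 + 1) (by omega) (by omega),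
          ← i0, ← i1, ← i2] at h
        have r1 := trinomial_recurrence n
        have r2 := trinomial_recurrence (n + 1)
        push_cast at h r1 r2 ⊢
        generalize (genCentralTrinomial 2 2 n : ℚ) / 2 ^ n = a at *
        generalize (genCentralTrinomial 2 2 (n + 1) : ℚ) / 2 ^ (n + 1) = b at *
        generalize (genCentralTrinomial 2 2 (n + 2) : ℚ) / 2 ^ (n + 2) = c at *
        generalize (genCentralTrinomial 2 2 (n + 3) : ℚ) / 2 ^ (n + 3) = d at *
        have h3 : (2 * (n : ℚ) + 3) * (n + 3) ^ 2 ≠ 0 := by positivity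
        refine mul_left_cancel₀ h3 ?_
        linear_combination -h + (2 * (n : ℚ) + 3) *
            ((n + 3) * d + (2 * n + 5) * c + (n + 2) * b) * r2
          - (2 * (n : ℚ) + 5) * ((n + 2) * c + (2 * n + 3) * b + (n + 1) * a) * r1
          + 2 * (2 * (n : ℚ) + 3) * (2 * n + 5) * b * r1
  rw [← sum_squareTerm_extend (M := N + n + 1) h (by omega),
    sum_squareTerm_extend (N := n + 1) (by omega) (by omega), ← key, div_pow, ← pow_mul,
    mul_comm n 2, pow_mul]
  norm_num

lemma descPochhammer_eval_add (x : ℚ) (k : ℕ) :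
    (descPochhammer ℚ (2 * k + 1)).eval (x + k) =
      x * ∏ i ∈ range k, (x ^ 2 - ((i : ℚ) + 1) ^ 2) := by
  induction k with
  | zero => simp
  | succ k ih =>
    rw [prod_range_succ, ← mul_assoc, ← ih, show 2 * (k + 1) + 1 = 2 * k + 1 + 1 + 1 by ring,
      descPochhammer_eval_succ_left, show x + (k + 1 : ℕ) - 1 = x + k by push_cast; ring,
      descPochhammer_succ_eval]
    push_cast; ring

lemma sum_range_descPochhammer_eval (k l n : ℕ) :
    ∑ i ∈ range n, (descPochhammer ℚ (k + l)).eval ((i : ℚ) + k) =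
      ((descPochhammer ℚ (k + l + 1)).eval ((n : ℚ) + k) -
        (descPochhammer ℚ (k + l + 1)).eval (k : ℚ)) / (k + l + 1) := by
  rw [eq_div_iff (by positivity)]
  induction n with
  | zero => simp
  | succ n ih =>
    rw [sum_range_succ, add_mul, ih, descPochhammer_succ_eval,
      descPochhammer_eval_succ_left (((n + 1 : ℕ) : ℚ) + k),
      show ((n + 1 : ℕ) : ℚ) + k - 1 = n + k by push_cast; ring]
    push_cast; ring

lemma sum_trinomial_sq (n m : ℕ) (h : n ≤ 2 * m + 1) :
    ∑ i ∈ range n, (genCentralTrinomial 2 2 i : ℚ) ^ 2 / 4 ^ i =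
      n * ∑ j ∈ range (m + 1), (j.centralBinom : ℚ) *
        (4 ^ j * ((2 * j).factorial : ℚ) ^ 2)⁻¹ *
        (∏ i ∈ range (2 * j), ((n : ℚ) ^ 2 - ((i : ℚ) + 1) ^ 2)) * (4 * j + 1 : ℚ)⁻¹ := by
  rw [sum_congr rfl fun i hi => trinomial_sq_eq_sum (n := i) (N := m + 1)
    (by simp at hi; omega), sum_comm, mul_sum]
  refine sum_congr rfl fun j _ => ?_
  have h1 := sum_range_descPochhammer_eval (2 * j) (2 * j) n
  have h2 := descPochhammer_eval_add n (2 * j)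
  rw [show 2 * (2 * j) + 1 = 2 * j + 2 * j + 1 by ring] at h2
  rw [h2, descPochhammer_eval_coe_nat_of_lt (by omega)] at h1
  push_cast at h1
  simp only [squareTerm, ← sum_mul]
  rw [show 4 * j = 2 * j + 2 * j by ring, h1]
  have : (4 * j + 1 : ℚ) ≠ 0 := by positivity
  field_simp
  ring

/-- `PadicReduces a z` says that `a` is a `p`-adic integer whose reduction modulo `p` is `z`. -/
def PadicReduces {p : ℕ} [Fact p.Prime] (a : ℚ_[p]) (z : ZMod p) : Prop :=
  ∃ b : ℤ_[p], (b : ℚ_[p]) = a ∧ PadicInt.toZMod b = z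

namespace PadicReduces

variable {p : ℕ} [Fact p.Prime] {a b : ℚ_[p]} {y z : ZMod p}

lemma natCast (n : ℕ) : PadicReduces (n : ℚ_[p]) (n : ZMod p) := ⟨n, by simp, by simp⟩

lemma mul (ha : PadicReduces a y) (hb : PadicReduces b z) : PadicReduces (a * b) (y * z) := by
  obtain ⟨a, rfl, rfl⟩ := ha
  obtain ⟨b, rfl, rfl⟩ := hb
  exact ⟨a * b, by simp, by simp⟩

lemma add (ha : PadicReduces a y) (hb : PadicReduces b z) : PadicReduces (a + b) (y + z) := by
  obtain ⟨a, rfl, rfl⟩ := ha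
  obtain ⟨b, rfl, rfl⟩ := hb
  exact ⟨a + b, by simp, by simp⟩

lemma sub (ha : PadicReduces a y) (hb : PadicReduces b z) : PadicReduces (a - b) (y - z) := by
  obtain ⟨a, rfl, rfl⟩ := ha
  obtain ⟨b, rfl, rfl⟩ := hb
  exact ⟨a - b, by simp, by simp⟩

lemma pow (ha : PadicReduces a y) (n : ℕ) : PadicReduces (a ^ n) (y ^ n) := by
  obtain ⟨a, rfl, rfl⟩ := ha
  exact ⟨a ^ n, by simp, by simp⟩

lemma inv (ha : PadicReduces a y) (hy : y ≠ 0) : PadicReduces a⁻¹ y⁻¹ := by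
  obtain ⟨a, rfl, rfl⟩ := ha
  have hu : IsUnit a := by
    by_contra h
    exact hy (by rwa [← RingHom.mem_ker, PadicInt.ker_toZMod, IsLocalRing.mem_maximalIdeal])
  obtain ⟨u, rfl⟩ := hu
  refine ⟨↑u⁻¹, eq_inv_of_mul_eq_one_left ?_, eq_inv_of_mul_eq_one_left ?_⟩
  · rw [← PadicInt.coe_mul]; simp
  · rw [← map_mul]; simp

lemma sum {ι : Type*} {s : Finset ι} {f : ι → ℚ_[p]} {g : ι → ZMod p}
    (h : ∀ i ∈ s, PadicReduces (f i) (g i)) : PadicReduces (∑ i ∈ s, f i) (∑ i ∈ s, g i) := by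
  choose! F hF hG using h
  exact ⟨∑ i ∈ s, F i, by rw [← sum_congr rfl hF]; exact map_sum PadicInt.Coe.ringHom _ _,
    by rw [map_sum, sum_congr rfl hG]⟩

lemma prod {ι : Type*} {s : Finset ι} {f : ι → ℚ_[p]} {g : ι → ZMod p}
    (h : ∀ i ∈ s, PadicReduces (f i) (g i)) : PadicReduces (∏ i ∈ s, f i) (∏ i ∈ s, g i) := by
  choose! F hF hG using h
  exact ⟨∏ i ∈ s, F i, by rw [← prod_congr rfl hF]; exact map_prod PadicInt.Coe.ringHom _ _,
    by rw [map_prod, prod_congr rfl hG]⟩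

lemma norm_sub_le (ha : PadicReduces a z) (hb : PadicReduces b z) :
    ‖a - b‖ ≤ (p : ℝ)⁻¹ := by
  obtain ⟨c, hc, h0⟩ := ha.sub hb
  rw [sub_self, ← RingHom.mem_ker, PadicInt.ker_toZMod, PadicInt.maximalIdeal_eq_span_p] at h0
  rw [← pow_one (p : ℤ_[p]), ← PadicInt.norm_le_pow_iff_mem_span_pow] at h0
  rw [← hc, ← PadicInt.norm_def]
  simpa using h0

end PadicReduces

lemma sum_neg_one_pow_choose_div {K : Type*} [Field K] (m : ℕ) (x : K)
    (hx : ∀ j ≤ m, x + j ≠ 0) :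
    ∑ j ∈ range (m + 1), (-1) ^ j * (m.choose j : K) * (x + j)⁻¹ =
      m.factorial * (∏ j ∈ range (m + 1), (x + j))⁻¹ := by
  induction m generalizing x with
  | zero => simp
  | succ m ih =>
    have h1 := ih x fun j hj => hx j (by omega)
    have h2 := ih (x + 1) fun j hj => by
      have := hx (j + 1) (by omega)
      push_cast at this
      rwa [add_assoc, add_comm (1 : K)]
    have hsum : ∑ j ∈ range (m + 1 + 1), (-1) ^ j * ((m + 1).choose j : K) * (x + j)⁻¹ =
        ∑ j ∈ range (m + 1), (-1) ^ j * (m.choose j : K) * (x + j)⁻¹ -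
          ∑ j ∈ range (m + 1), (-1) ^ j * (m.choose j : K) * (x + 1 + j)⁻¹ := by
      have : ∑ j ∈ range (m + 1), (-1) ^ j * (m.choose j : K) * (x + j)⁻¹ =
          ∑ j ∈ range (m + 1 + 1), (-1) ^ j * (m.choose j : K) * (x + j)⁻¹ := by
        rw [sum_range_succ _ (m + 1)]; simp
      rw [this, sum_range_succ', sum_range_succ' _ (m + 1), add_sub_right_comm, ← sum_sub_distrib]
      congr 1
      · refine sum_congr rfl fun j _ => ?_
        rw [Nat.choose_succ_succ, add_assoc x 1, add_comm (1 : K)]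
        push_cast; ring
      · simp
    have hP : ∏ j ∈ range m, (x + 1 + j) ≠ 0 := by
      rw [prod_ne_zero_iff]
      intro j hj
      have := hx (j + 1) (by simp at hj; omega)
      push_cast at this
      rwa [add_assoc, add_comm (1 : K)]
    have hs : ∀ n, ∏ j ∈ range (n + 1), (x + j) = (∏ j ∈ range n, (x + 1 + j)) * x := by
      intro n
      rw [prod_range_succ']
      simp only [Nat.cast_add, Nat.cast_one, Nat.cast_zero, add_zero]
      congr 1
      exact prod_congr rfl fun j _ => by ring
    have hx0 : x ≠ 0 := by simpa using hx 0 (by omega)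
    have hxm : x + 1 + m ≠ 0 := by
      have := hx (m + 1) le_rfl
      push_cast at this
      rwa [add_assoc, add_comm (1 : K)]
    rw [hsum, h1, h2, hs, hs, prod_range_succ, Nat.factorial_succ]
    push_cast
    field_simp
    ring

namespace ZMod

variable {p : ℕ} [Fact p.Prime]

lemma natCast_factorial_ne_zero {n : ℕ} (h : n < p) : (n.factorial : ZMod p) ≠ 0 := by
  rw [Ne, natCast_eq_zero_iff, (Fact.out : p.Prime).dvd_factorial]
  omega

lemma factorial_mul_factorial {k l : ℕ} (h : k + l + 1 = p) :
    (k.factorial : ZMod p) * l.factorial = (-1) ^ (k + 1) := by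
  induction k generalizing l with
  | zero => simp [show l = p - 1 by omega]
  | succ k ih =>
    have h1 := ih (l := l + 1) (by omega)
    have h2 : ((k + 1 + l + 1 : ℕ) : ZMod p) = 0 := by rw [h]; simp
    rw [Nat.factorial_succ] at h1 ⊢
    push_cast at h1 h2 ⊢
    rw [pow_succ, ← h1]
    linear_combination (k.factorial : ZMod p) * l.factorial * h2

lemma centralBinom_eq {m j : ℕ} (hp : 2 * m + 1 = p) (hj : j ≤ m) :
    (j.centralBinom : ZMod p) = (-4) ^ j * m.choose j := by
  have hm : ((2 * m + 1 : ℕ) : ZMod p) = 0 := by rw [hp]; simp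
  push_cast at hm
  induction j with
  | zero => simp
  | succ j ih =>
    have h0 : ((j + 1 : ℕ) : ZMod p) ≠ 0 := by
      rw [Ne, natCast_eq_zero_iff]
      exact Nat.not_dvd_of_pos_of_lt (by omega) (by omega)
    have h1 : ((j + 1 : ℕ) : ZMod p) * (j + 1).centralBinom = 2 * (2 * j + 1) * j.centralBinom := by
      exact_mod_cast congrArg (Nat.cast : ℕ → ZMod p) (Nat.succ_mul_centralBinom_succ j)
    have h2 : (m.choose (j + 1) : ZMod p) * (j + 1 : ℕ) = m.choose j * (m - j) := by
      rw [← Nat.cast_sub (by omega)]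
      exact_mod_cast congrArg (Nat.cast : ℕ → ZMod p) (Nat.choose_succ_right_eq m j)
    refine mul_left_cancel₀ h0 ?_
    rw [h1, ih (by omega)]
    linear_combination (-1) * (-4) ^ (j + 1) * h2 + 2 * (-4) ^ j * (m.choose j : ZMod p) * hm

lemma sum_centralBinom_div {r : ℕ} (hp : 4 * r + 3 = p) :
    ∑ j ∈ range (2 * r + 2), (j.centralBinom : ZMod p) * (4 ^ j)⁻¹ * (4 * j + 1 : ZMod p)⁻¹ =
      (-1) ^ (r + 1) * 2 * ((2 * r + 2).choose (r + 1) : ZMod p)⁻¹ := by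
  have h4 : (4 : ZMod p) * (r + 1) = 1 := by
    have : ((4 * r + 3 : ℕ) : ZMod p) = 0 := by rw [hp]; simp
    push_cast at this
    linear_combination this
  have hf : (4 : ZMod p) ≠ 0 := left_ne_zero_of_mul_eq_one h4
  have hr : (r + 1 : ZMod p) ≠ 0 := right_ne_zero_of_mul_eq_one h4
  have h2 : (2 : ZMod p) ≠ 0 := fun h => hf (by linear_combination 2 * h)
  have hterm : ∀ j ∈ range (2 * r + 2),
      (j.centralBinom : ZMod p) * (4 ^ j)⁻¹ * (4 * j + 1 : ZMod p)⁻¹ =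
      4⁻¹ * ((-1) ^ j * ((2 * r + 1).choose j : ZMod p) * ((r + 1 : ZMod p) + j)⁻¹) := by
    intro j hj
    rw [centralBinom_eq (m := 2 * r + 1) (by omega) (by simp at hj; omega),
      show (4 * j + 1 : ZMod p) = 4 * (r + 1 + j) by linear_combination -h4, mul_inv,
      show (-4 : ZMod p) = -1 * 4 by ring, mul_pow]
    field_simp
  have hprod : ∀ n, (r.factorial : ZMod p) * ∏ j ∈ range n, ((r + 1 : ZMod p) + j) =
      (r + n).factorial := by
    intro n
    have := congrArg (Nat.cast : ℕ → ZMod p) (Nat.factorial_mul_ascFactorial r n)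
    rw [Nat.ascFactorial_eq_prod_range] at this
    push_cast at this
    exact this
  have hP := hprod (2 * r + 2)
  have hW := factorial_mul_factorial (p := p) (k := r) (l := r + (2 * r + 2)) (by omega)
  have hM := factorial_mul_factorial (p := p) (k := 2 * r + 1) (l := 2 * r + 1) (by omega)
  rw [show 2 * r + 1 + 1 = 2 * (r + 1) by ring, pow_mul] at hM
  have hC : ((2 * r + 2).choose (r + 1) : ZMod p) * ((r + 1) * r.factorial) ^ 2 =
      2 * (r + 1) * (2 * r + 1).factorial := by
    have := congrArg (Nat.cast : ℕ → ZMod p) (Nat.choose_mul_factorial_mul_factorial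
      (n := 2 * r + 2) (k := r + 1) (by omega))
    rw [show 2 * r + 2 - (r + 1) = r + 1 by omega, Nat.factorial_succ,
      Nat.factorial_succ (2 * r + 1)] at this
    push_cast at this
    linear_combination this
  have hrf : (r.factorial : ZMod p) ≠ 0 := natCast_factorial_ne_zero (by omega)
  have hmf : ((2 * r + 1).factorial : ZMod p) ≠ 0 := natCast_factorial_ne_zero (by omega)
  have hbf : ((r + (2 * r + 2)).factorial : ZMod p) ≠ 0 := natCast_factorial_ne_zero (by omega)
  have hC0 : ((2 * r + 2).choose (r + 1) : ZMod p) ≠ 0 := fun h => by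
    rw [h, zero_mul] at hC
    exact mul_ne_zero (mul_ne_zero h2 hr) hmf hC.symm
  have hP0 : ∏ j ∈ range (2 * r + 2), ((r + 1 : ZMod p) + j) ≠ 0 := fun h => by
    rw [h, mul_zero] at hP
    exact hbf hP.symm
  rw [sum_congr rfl hterm, ← mul_sum, sum_neg_one_pow_choose_div (2 * r + 1) _
    fun j hj => (prod_ne_zero_iff.mp hP0) j (by simp; omega)]
  rw [← hP] at hW
  set P := ∏ j ∈ range (2 * r + 2), ((r + 1 : ZMod p) + j)
  have hs : ((-1 : ZMod p) ^ (r + 1)) ^ 2 = 1 := by rw [← pow_mul, mul_comm, pow_mul]; simp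
  set s := (-1 : ZMod p) ^ (r + 1)
  have hfP : (r.factorial : ZMod p) ^ 2 * P = s := by linear_combination hW
  have hfC : (r.factorial : ZMod p) ^ 2 * ((2 * r + 2).choose (r + 1) : ZMod p) =
      8 * (2 * r + 1).factorial := by
    linear_combination 16 * hC - ((2 * r + 2).choose (r + 1) * (r.factorial : ZMod p) ^ 2 *
      (4 * (r + 1) + 1) - 8 * (2 * r + 1).factorial) * h4
  rw [neg_one_sq, one_pow] at hM
  have hPC : ((2 * r + 1).factorial : ZMod p) * (2 * r + 2).choose (r + 1) = 8 * s * P := by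
    refine mul_left_cancel₀ (pow_ne_zero 2 hrf) ?_
    linear_combination (2 * r + 1).factorial * hfC + 8 * hM - 8 * hs - 8 * s * hfP
  rw [show 2 * r + 1 + 1 = 2 * r + 2 by ring]
  change 4⁻¹ * (((2 * r + 1).factorial : ZMod p) * P⁻¹) = _
  field_simp
  linear_combination hPC

lemma prod_neg_sq (k : ℕ) :
    ∏ i ∈ range (2 * k), (((p : ℕ) : ZMod p) ^ 2 - ((i : ZMod p) + 1) ^ 2) =
      ((2 * k).factorial : ZMod p) ^ 2 := by
  simp only [natCast_self, ne_eq, OfNat.ofNat_ne_zero, not_false_eq_true, zero_pow, zero_sub]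
  rw [prod_neg, card_range, pow_mul, prod_pow, ← prod_range_add_one_eq_factorial]
  push_cast
  simp

end ZMod

theorem sum_T22_sq_div_four_pow_three_mod_four (p : ℕ) [Fact p.Prime]
    (hp3 : p % 4 = 3) :
    ‖(∑ k ∈ Finset.range p,
        (genCentralTrinomial 2 2 k : ℚ_[p]) ^ 2 / (4 : ℚ_[p]) ^ k) -
      (-1 : ℚ_[p]) ^ ((p + 1) / 4) * 2 * (p : ℚ_[p]) /
        (((p + 1) / 2).choose ((p + 1) / 4) : ℚ_[p])‖ ≤
      (p : ℝ)⁻¹ ^ 2 := by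
  obtain ⟨r, hr⟩ : ∃ r, 4 * r + 3 = p := ⟨p / 4, by omega⟩
  rw [show (p + 1) / 4 = r + 1 by omega, show (p + 1) / 2 = 2 * r + 2 by omega]
  have hpp : p.Prime := Fact.out
  have hS := congrArg (Rat.cast : ℚ → ℚ_[p]) (sum_trinomial_sq p (2 * r + 1) (by omega))
  push_cast at hS
  rw [hS]
  have hfour : ((4 : ℕ) : ZMod p) ≠ 0 := by
    rw [Ne, ZMod.natCast_eq_zero_iff]
    intro h
    have := (Nat.prime_dvd_prime_iff_eq hpp Nat.prime_two).1
      (hpp.dvd_of_dvd_pow (show p ∣ 2 ^ 2 from h))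
    omega
  have h1 : PadicReduces (∑ j ∈ range (2 * r + 1 + 1), (j.centralBinom : ℚ_[p]) *
        (4 ^ j * ((2 * j).factorial : ℚ_[p]) ^ 2)⁻¹ *
        (∏ i ∈ range (2 * j), ((p : ℚ_[p]) ^ 2 - ((i : ℚ_[p]) + 1) ^ 2)) *
        (4 * j + 1 : ℚ_[p])⁻¹)
      ((-1) ^ (r + 1) * 2 * ((2 * r + 2).choose (r + 1) : ZMod p)⁻¹) := by
    rw [← ZMod.sum_centralBinom_div hr]
    refine PadicReduces.sum fun j hj => ?_
    have hj : j < 2 * r + 2 := mem_range.1 hj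
    have hfac : ((2 * j).factorial : ZMod p) ≠ 0 := ZMod.natCast_factorial_ne_zero (by omega)
    have hden : ((4 * j + 1 : ℕ) : ZMod p) ≠ 0 := by
      rw [Ne, ZMod.natCast_eq_zero_iff]
      rintro ⟨c, hc⟩
      have : c < 2 := by
        by_contra! h
        have := Nat.mul_le_mul_left p h
        omega
      interval_cases c <;> omega
    have e : (j.centralBinom : ZMod p) * (4 ^ j)⁻¹ * (4 * j + 1 : ZMod p)⁻¹ =
        j.centralBinom * (((4 : ℕ) : ZMod p) ^ j * ((2 * j).factorial : ZMod p) ^ 2)⁻¹ *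
        (∏ i ∈ range (2 * j), (((p : ℕ) : ZMod p) ^ 2 - ((i : ZMod p) + 1) ^ 2)) *
        ((4 * j + 1 : ℕ) : ZMod p)⁻¹ := by
      rw [ZMod.prod_neg_sq]
      push_cast at hfour ⊢
      field_simp
    rw [e]
    have one : PadicReduces (1 : ℚ_[p]) 1 := by simpa using PadicReduces.natCast (p := p) 1
    have four := PadicReduces.natCast (p := p) 4
    have hd := PadicReduces.natCast (p := p) (4 * j + 1)
    refine (((PadicReduces.natCast _).mul (((by exact_mod_cast four.pow j : PadicReduces _ _).mul
      ((PadicReduces.natCast _).pow 2)).inv ?_)).mul (PadicReduces.prod fun i _ =>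
      ((PadicReduces.natCast p).pow 2).sub (((PadicReduces.natCast i).add one).pow 2))).mul
      ((by exact_mod_cast hd : PadicReduces _ _).inv hden)
    exact mul_ne_zero (pow_ne_zero _ hfour) (pow_ne_zero _ hfac)
  have h2 : PadicReduces ((-1 : ℚ_[p]) ^ (r + 1) * 2 * ((2 * r + 2).choose (r + 1) : ℚ_[p])⁻¹)
      ((-1) ^ (r + 1) * 2 * ((2 * r + 2).choose (r + 1) : ZMod p)⁻¹) := by
    have one : PadicReduces (-1 : ℚ_[p]) (-1) := ⟨-1, by simp, by simp⟩
    have two : PadicReduces (2 : ℚ_[p]) 2 := by simpa using PadicReduces.natCast (p := p) 2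
    refine ((one.pow _).mul two).mul ((PadicReduces.natCast _).inv ?_)
    rw [Ne, ZMod.natCast_eq_zero_iff]
    intro h
    have := (hpp.dvd_factorial).1 (h.trans <| ((Dvd.intro _ rfl).mul_right _).trans
      (Nat.choose_mul_factorial_mul_factorial (show r + 1 ≤ 2 * r + 2 by omega)).dvd)
    omega
  have h3 := h1.norm_sub_le h2
  rw [div_eq_mul_inv, mul_right_comm _ (p : ℚ_[p]), mul_comm _ (p : ℚ_[p]), ← mul_sub, norm_mul,
    Padic.norm_p, sq (p : ℝ)⁻¹]
  gcongr
end

section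
/- Let p be a prime with p ≡ 1 (mod 4), and write p = x^2 + 4y^2 with integers x, y and x ≡ 1 (mod 4). Then ∑_{k=0}^{p-1} T_k(2,-1)^2 / (-8)^k ≡ 2x - p/(2x) (mod p^2); both sides are p-adic integers since p ∤ 2x. -/
namespace TrinomialSum

open Finset

/-- A sum of the form `∑ (α k + β k * y) * y ^ k` telescopes when `α (k + 1) + β k = 0`. -/
lemma sum_shift {K : Type*} [CommRing K] (α β : ℕ → K) (y : K) (h0 : α 0 = 0)
    (h : ∀ k, α (k + 1) + β k = 0) (N : ℕ) :
    ∑ k ∈ range (N + 1), (α k + β k * y) * y ^ k = β N * y ^ (N + 1) := by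
  induction N with
  | zero => simp [h0]
  | succ N ih =>
    rw [sum_range_succ, ih]
    linear_combination h N * y ^ (N + 1)

lemma cast_choose_succ_right {K : Type*} [CommRing K] (m k : ℕ) :
    ((k : K) + 1) * (m.choose (k + 1) : K) = ((m : K) - k) * (m.choose k : K) := by
  rcases le_or_gt k m with h | h
  · have h2 := congrArg (Nat.cast : ℕ → K) (Nat.choose_succ_right_eq m k)
    push_cast [Nat.cast_sub h] at h2
    linear_combination h2
  · simp [Nat.choose_eq_zero_of_lt h, Nat.choose_eq_zero_of_lt (Nat.lt_succ_of_lt h)]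

lemma cast_centralBinom_succ {K : Type*} [CommRing K] (j : ℕ) :
    ((j : K) + 1) * (Nat.centralBinom (j + 1) : K)
      = 2 * (2 * j + 1) * (Nat.centralBinom j : K) := by
  exact_mod_cast congrArg (Nat.cast : ℕ → K) (Nat.succ_mul_centralBinom_succ j)

/-- The partial sums defining `T_n(2, -1) / 2 ^ n`. -/
def tauSum (N n : ℕ) : ℚ :=
  ∑ k ∈ range N, (n.choose (2 * k) : ℚ) * (Nat.centralBinom k : ℚ) * (-1 / 4) ^ k

lemma tauSum_rec (N n : ℕ) (hN : n < N) :
    ((n : ℚ) + 2) * tauSum (N + 1) (n + 2)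
      = (2 * n + 3) * tauSum (N + 1) (n + 1) - 2 * (n + 1) * tauSum (N + 1) n := by
  have key := sum_shift
    (fun k => (((n : ℚ) + 2) * ((n + 2).choose (2 * k) : ℚ)
      - (2 * n + 3) * ((n + 1).choose (2 * k) : ℚ) + (n + 1) * (n.choose (2 * k) : ℚ))
      * (Nat.centralBinom k : ℚ))
    (fun k => -4 * ((n : ℚ) + 1) * (n.choose (2 * k) : ℚ) * (Nat.centralBinom k : ℚ)) (-1 / 4)
    (by simp; ring) (fun k => ?_) N
  · simp only [Nat.choose_eq_zero_of_lt (show n < 2 * N by lia)] at key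
    simp only [tauSum, mul_sum, ← sum_sub_distrib]
    rw [← sub_eq_zero, ← sum_sub_distrib]
    refine Eq.trans (sum_congr rfl fun k _ => ?_) (key.trans (by simp))
    ring
  · have e1 := cast_choose_succ_right (K := ℚ) n (2 * k)
    have e2 := cast_choose_succ_right (K := ℚ) n (2 * k + 1)
    have e3 := cast_centralBinom_succ (K := ℚ) k
    have p1 : ((n + 1).choose (2 * (k + 1)) : ℚ)
        = (n.choose (2 * k + 1) : ℚ) + n.choose (2 * k + 1 + 1) := by
      rw [show 2 * (k + 1) = 2 * k + 1 + 1 by ring, Nat.choose_succ_succ]; push_cast; ring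
    have p2 : ((n + 2).choose (2 * (k + 1)) : ℚ)
        = (n.choose (2 * k) : ℚ) + 2 * n.choose (2 * k + 1) + n.choose (2 * k + 1 + 1) := by
      rw [show 2 * (k + 1) = 2 * k + 1 + 1 by ring, Nat.choose_succ_succ,
        Nat.choose_succ_succ n, Nat.choose_succ_succ n]
      push_cast; ring
    simp only [p1, p2]
    rw [show 2 * (k + 1) = 2 * k + 1 + 1 by ring]
    push_cast at *
    have hk : (k : ℚ) + 1 ≠ 0 := by positivity
    have hk2 : 2 * (k : ℚ) + 1 ≠ 0 := by positivity
    rw [show (Nat.centralBinom (k + 1) : ℚ)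
      = 2 * (2 * k + 1) * (Nat.centralBinom k : ℚ) / (k + 1) by field_simp; linarith]
    rw [show (n.choose (2 * k + 1 + 1) : ℚ)
      = (n - (2 * k + 1)) * (n.choose (2 * k + 1) : ℚ) / (2 * k + 2) by field_simp; linarith]
    rw [show (n.choose (2 * k + 1) : ℚ)
      = (n - 2 * k) * (n.choose (2 * k) : ℚ) / (2 * k + 1) by field_simp; linarith]
    field_simp
    ring

lemma genCentralTrinomial_eq (N n : ℕ) (hN : n < N) :
    (genCentralTrinomial 2 (-1) n : ℚ) = 2 ^ n * tauSum N n := by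
  have hsub : range (n / 2 + 1) ⊆ range N := range_subset_range.2 (by lia)
  unfold genCentralTrinomial tauSum
  rw [← sum_subset hsub]
  · push_cast
    rw [mul_sum]
    refine sum_congr rfl fun k hk => ?_
    have h2 : 2 * k ≤ n := by have := mem_range.1 hk; lia
    obtain ⟨m, rfl⟩ := Nat.exists_eq_add_of_le h2
    have : (-1 : ℚ) ^ k = 2 ^ (2 * k) * (-1 / 4) ^ k := by
      rw [pow_mul, ← mul_pow]; norm_num
    rw [Nat.add_sub_cancel_left, this, Nat.centralBinom]
    ring
  · intro k _ hk
    have : n < 2 * k := by have := mt mem_range.2 hk; lia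
    simp [Nat.choose_eq_zero_of_lt this]

lemma genCentralTrinomial_rec (n : ℕ) :
    ((n : ℚ) + 2) * genCentralTrinomial 2 (-1) (n + 2)
      = 2 * (2 * n + 3) * genCentralTrinomial 2 (-1) (n + 1)
        - 8 * (n + 1) * genCentralTrinomial 2 (-1) n := by
  rw [genCentralTrinomial_eq (n + 4) n (by lia), genCentralTrinomial_eq (n + 4) (n + 1) (by lia),
    genCentralTrinomial_eq (n + 4) (n + 2) (by lia)]
  linear_combination 2 ^ (n + 2) * tauSum_rec (n + 3) n (by lia)

lemma choose_shift_rel (n j : ℕ) :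
    ((n : ℚ) + 1 - j) * ((n + 1 + j).choose (2 * j) : ℚ)
      = (n + 1 + j) * ((n + j).choose (2 * j) : ℚ) := by
  rcases le_or_gt j (n + 1) with h | h
  · have := Nat.choose_mul_succ_eq (n + j) (2 * j)
    have h2 : (((n + j).choose (2 * j) * (n + j + 1) : ℕ) : ℚ)
      = (((n + j + 1).choose (2 * j) * (n + j + 1 - 2 * j) : ℕ) : ℚ) := by rw [this]
    push_cast [Nat.cast_sub (show 2 * j ≤ n + j + 1 by lia)] at h2
    rw [show n + 1 + j = n + j + 1 by ring]
    linarith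
  · simp [Nat.choose_eq_zero_of_lt (show n + j < 2 * j by lia),
      Nat.choose_eq_zero_of_lt (show n + 1 + j < 2 * j by lia)]

lemma choose_shift_expand (n j : ℕ) :
    ((n + (j + 1)).choose (2 * (j + 1)) : ℚ) = ((n + 1 + j).choose (2 * j + 2) : ℚ) ∧
    ((n + 1 + (j + 1)).choose (2 * (j + 1)) : ℚ)
      = ((n + 1 + j).choose (2 * j + 1) : ℚ) + (n + 1 + j).choose (2 * j + 2) ∧
    ((n + 2 + (j + 1)).choose (2 * (j + 1)) : ℚ) = ((n + 1 + j).choose (2 * j) : ℚ)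
      + 2 * (n + 1 + j).choose (2 * j + 1) + (n + 1 + j).choose (2 * j + 2) ∧
    ((n + 1 + j).choose (2 * j + 1) : ℚ)
      = (n + 1 - j) * ((n + 1 + j).choose (2 * j) : ℚ) / (2 * j + 1) ∧
    ((n + 1 + j).choose (2 * j + 2) : ℚ)
      = (n - j) * (n + 1 - j) * ((n + 1 + j).choose (2 * j) : ℚ)
        / ((2 * j + 1) * (2 * j + 2)) := by
  have e1 := cast_choose_succ_right (K := ℚ) (n + 1 + j) (2 * j)
  have e2 := cast_choose_succ_right (K := ℚ) (n + 1 + j) (2 * j + 1)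
  push_cast at e1 e2
  have h1 : ((n + 1 + j).choose (2 * j + 1) : ℚ)
      = (n + 1 - j) * ((n + 1 + j).choose (2 * j) : ℚ) / (2 * j + 1) := by
    field_simp; linarith
  refine ⟨?_, ?_, ?_, h1, ?_⟩
  · congr 2; ring
  · rw [show n + 1 + (j + 1) = (n + 1 + j) + 1 by ring, show 2 * (j + 1) = 2 * j + 1 + 1 by ring,
      Nat.choose_succ_succ]
    push_cast; ring
  · rw [show n + 2 + (j + 1) = (n + 1 + j) + 1 + 1 by ring,
      show 2 * (j + 1) = 2 * j + 1 + 1 by ring,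
      Nat.choose_succ_succ, Nat.choose_succ_succ (n + 1 + j), Nat.choose_succ_succ (n + 1 + j)]
    push_cast; ring
  · rw [h1] at e2
    field_simp at e2 ⊢
    linarith

/-- The sum representing `T_n(2, -1) ^ 2 / 8 ^ n`. -/
def sqSum (N n : ℕ) : ℚ :=
  ∑ j ∈ range N, ((n + j).choose (2 * j) : ℚ) * (Nat.centralBinom j : ℚ) ^ 2 * (-1 / 8) ^ j

/-- The sum representing `(n + 1) * T_n(2, -1) * T_{n + 1}(2, -1) / (2 * 8 ^ n)`. -/
def mixSum (N n : ℕ) : ℚ :=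
  ∑ j ∈ range N, ((n : ℚ) + 1 + j) * ((n + j).choose (2 * j) : ℚ)
    * (Nat.centralBinom j : ℚ) ^ 2 * (-1 / 8) ^ j

lemma mixSum_succ_add (N n : ℕ) :
    mixSum N (n + 1) + mixSum N n = (2 * n + 3) * sqSum N (n + 1) := by
  unfold mixSum sqSum
  rw [← sum_add_distrib, mul_sum]
  refine sum_congr rfl fun j _ => ?_
  push_cast
  linear_combination (-(Nat.centralBinom j : ℚ) ^ 2 * (-1 / 8) ^ j) * choose_shift_rel n j

lemma sqSum_rec (N n : ℕ) (hN : n + 1 < N) :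
    ((n : ℚ) + 2) ^ 2 * sqSum (N + 1) (n + 2)
      = (2 * n + 3) / 2 * (mixSum (N + 1) (n + 1) - mixSum (N + 1) n)
        + (n + 1) ^ 2 * sqSum (N + 1) n := by
  have key := sum_shift
    (fun j => (((n : ℚ) + 2) ^ 2 * ((n + 2 + j).choose (2 * j) : ℚ)
      - (n + 1) ^ 2 * ((n + j).choose (2 * j) : ℚ)
      - (2 * n + 3) * (2 * j + 1) * ((n + 1 + j).choose (2 * j) : ℚ))
      * (Nat.centralBinom j : ℚ) ^ 2)
    (fun j => -4 * (2 * (n : ℚ) + 3) * (2 * j + 1) * ((n + 1 + j).choose (2 * j) : ℚ)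
      * (Nat.centralBinom j : ℚ) ^ 2) (-1 / 8)
    (by simp; ring) (fun j => ?_) N
  · simp only [Nat.choose_eq_zero_of_lt (show n + 1 + N < 2 * N by lia)] at key
    simp only [sqSum, mixSum, mul_sum, ← sum_sub_distrib, ← sum_add_distrib]
    rw [← sub_eq_zero, ← sum_sub_distrib]
    refine Eq.trans (sum_congr rfl fun j _ => ?_) (key.trans (by simp))
    push_cast
    linear_combination ((2 * n + 3) / 2 * -(Nat.centralBinom j : ℚ) ^ 2 * (-1 / 8) ^ j)
      * choose_shift_rel n j
  · obtain ⟨p0, p1, p2, p3, p4⟩ := choose_shift_expand n j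
    have e3 := cast_centralBinom_succ (K := ℚ) j
    simp only [p0, p1, p2, p3, p4]
    push_cast at *
    rw [show (Nat.centralBinom (j + 1) : ℚ)
      = 2 * (2 * j + 1) * (Nat.centralBinom j : ℚ) / (j + 1) by field_simp; linarith]
    field_simp
    ring

lemma genCentralTrinomial_sq_aux (N n : ℕ) (hN : n + 2 < N) :
    ((genCentralTrinomial 2 (-1) n : ℚ) ^ 2 = 8 ^ n * sqSum N n ∧
    ((n : ℚ) + 1) * genCentralTrinomial 2 (-1) n * genCentralTrinomial 2 (-1) (n + 1)
      = 2 * 8 ^ n * mixSum N n) ∧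
    (genCentralTrinomial 2 (-1) (n + 1) : ℚ) ^ 2 = 8 ^ (n + 1) * sqSum N (n + 1) := by
  induction n with
  | zero =>
    obtain ⟨M, rfl⟩ : ∃ M, N = M + 2 := ⟨N - 2, by lia⟩
    have h : ∀ k, (0 + (k + 1 + 1)).choose (2 * (k + 1 + 1)) = 0 :=
      fun k => Nat.choose_eq_zero_of_lt (by lia)
    have h' : ∀ k, (0 + 1 + (k + 1 + 1)).choose (2 * (k + 1 + 1)) = 0 :=
      fun k => Nat.choose_eq_zero_of_lt (by lia)
    simp only [sqSum, mixSum, sum_range_succ' _ (M + 1), sum_range_succ' _ M, h, h']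
    simp [genCentralTrinomial, Nat.centralBinom]
    norm_num
  | succ n ih =>
    obtain ⟨⟨h1, h2⟩, h3⟩ := ih (by lia)
    have r := genCentralTrinomial_rec n
    obtain ⟨M, rfl⟩ : ∃ M, N = M + 1 := ⟨N - 1, by lia⟩
    have s1 := mixSum_succ_add (M + 1) n
    have s2 := sqSum_rec M n (by lia)
    have h4 : ((n + 1 : ℕ) + 1 : ℚ) * genCentralTrinomial 2 (-1) (n + 1)
        * genCentralTrinomial 2 (-1) (n + 1 + 1) = 2 * 8 ^ (n + 1) * mixSum (M + 1) (n + 1) := by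
      push_cast
      linear_combination (genCentralTrinomial 2 (-1) (n + 1) : ℚ) * r + 2 * (2 * n + 3) * h3
        - 8 * h2 - 2 * 8 ^ (n + 1) * s1
    refine ⟨⟨h3, h4⟩, ?_⟩
    push_cast at h4
    have hn : ((n : ℚ) + 2) ^ 2 ≠ 0 := by positivity
    apply mul_left_cancel₀ hn
    linear_combination ((n : ℚ) + 2) * genCentralTrinomial 2 (-1) (n + 2) * r
      + 2 * (2 * n + 3) * h4 - 8 * (n + 1) * genCentralTrinomial 2 (-1) n * r
      - 16 * (2 * n + 3) * h2 + 64 * (n + 1) ^ 2 * h1 - 8 ^ (n + 2) * s2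

lemma genCentralTrinomial_sq (N n : ℕ) (hN : n < N) :
    (genCentralTrinomial 2 (-1) n) ^ 2 * 8 ^ N
      = ∑ j ∈ range N, 8 ^ n * (((n + j).choose (2 * j) : ℤ) * (Nat.centralBinom j : ℤ) ^ 2
        * (-1) ^ j * 8 ^ (N - j)) := by
  have h := (genCentralTrinomial_sq_aux (N + 2) n (by lia)).1.1
  have e : sqSum (N + 2) n = sqSum N n := by
    simp only [sqSum, sum_range_succ, Nat.choose_eq_zero_of_lt (show n + N < 2 * N by lia),
      Nat.choose_eq_zero_of_lt (show n + (N + 1) < 2 * (N + 1) by lia)]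
    simp
  have : ((genCentralTrinomial 2 (-1) n : ℚ)) ^ 2 * 8 ^ N
      = ∑ j ∈ range N, 8 ^ n * (((n + j).choose (2 * j) : ℚ) * (Nat.centralBinom j : ℚ) ^ 2
        * (-1) ^ j * 8 ^ (N - j)) := by
    rw [h, e, sqSum, mul_sum, sum_mul]
    refine sum_congr rfl fun j hj => ?_
    obtain ⟨m, rfl⟩ := Nat.exists_eq_add_of_lt (mem_range.1 hj)
    rw [show j + m + 1 - j = m + 1 by lia, div_pow, pow_add, pow_add]
    field_simp
    ring
  exact_mod_cast this

/-- The value at `0` of the Legendre polynomial of even degree. -/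
lemma legendre_zero (i N : ℕ) (hN : 2 * i < N) :
    ∑ j ∈ range N, ((2 * i + j).choose (2 * j) : ℚ) * (Nat.centralBinom j : ℚ) * (-1 / 2) ^ j
      = (-1) ^ i * (Nat.centralBinom i : ℚ) / 4 ^ i := by
  induction i with
  | zero =>
    obtain ⟨M, rfl⟩ : ∃ M, N = M + 1 := ⟨N - 1, by lia⟩
    have h : ∀ k, (k + 1).choose (2 * (k + 1)) = 0 :=
      fun k => Nat.choose_eq_zero_of_lt (by lia)
    simp [sum_range_succ' _ M, h]
  | succ i ih =>
    specialize ih (by lia)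
    obtain ⟨M, rfl⟩ : ∃ M, N = M + 1 := ⟨N - 1, by lia⟩
    set n := 2 * i with hn
    have key := sum_shift
      (fun j => (((n : ℚ) + 2) * ((n + 2 + j).choose (2 * j) : ℚ)
        - (2 * n + 3) * ((n + 1 + j).choose (2 * j) : ℚ)
        + (n + 1) * ((n + j).choose (2 * j) : ℚ)) * (Nat.centralBinom j : ℚ))
      (fun j => -2 * (2 * (n : ℚ) + 3) * ((n + 1 + j).choose (2 * j) : ℚ)
        * (Nat.centralBinom j : ℚ)) (-1 / 2)
      (by simp; ring) (fun j => ?_) M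
    · simp only [Nat.choose_eq_zero_of_lt (show n + 1 + M < 2 * M by lia)] at key
      have h2 : ((n : ℚ) + 2) * ∑ j ∈ range (M + 1), ((n + 2 + j).choose (2 * j) : ℚ)
          * (Nat.centralBinom j : ℚ) * (-1 / 2) ^ j + (n + 1) * ∑ j ∈ range (M + 1),
          ((n + j).choose (2 * j) : ℚ) * (Nat.centralBinom j : ℚ) * (-1 / 2) ^ j = 0 := by
        rw [mul_sum, mul_sum, ← sum_add_distrib]
        refine Eq.trans (sum_congr rfl fun j _ => ?_) (key.trans (by simp))
        ring
      rw [ih] at h2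
      have e3 := cast_centralBinom_succ (K := ℚ) i
      rw [show 2 * (i + 1) = n + 2 by lia]
      have hn2 : (n : ℚ) + 2 ≠ 0 := by positivity
      apply mul_left_cancel₀ hn2
      have hnq : (n : ℚ) = 2 * i := by simp [hn]
      rw [hnq] at h2 ⊢
      rw [eq_neg_of_add_eq_zero_left h2]
      rw [pow_succ (4 : ℚ)]
      linear_combination ((-1) ^ i / 4 ^ i / 2 : ℚ) * e3
    · obtain ⟨p0, p1, p2, p3, p4⟩ := choose_shift_expand n j
      have e3 := cast_centralBinom_succ (K := ℚ) j
      simp only [p0, p1, p2, p3, p4]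
      rw [show (Nat.centralBinom (j + 1) : ℚ)
        = 2 * (2 * j + 1) * (Nat.centralBinom j : ℚ) / (j + 1) by field_simp; linarith]
      field_simp
      ring

lemma isUnit_natCast_of_not_dvd {p m : ℕ} (hp : p.Prime) (h : ¬ p ∣ m) :
    IsUnit (m : ZMod (p ^ 2)) := by
  rw [ZMod.isUnit_iff_coprime]
  exact ((hp.coprime_iff_not_dvd.2 h).pow_left 2).symm

lemma isUnit_natCast_of_lt {p m : ℕ} (hp : p.Prime) (h0 : 0 < m) (h : m < p) :
    IsUnit (m : ZMod (p ^ 2)) :=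
  isUnit_natCast_of_not_dvd hp (Nat.not_dvd_of_pos_of_lt h0 h)

lemma natCast_sq_eq_zero (p : ℕ) : (p : ZMod (p ^ 2)) ^ 2 = 0 := by
  exact_mod_cast ZMod.natCast_self (p ^ 2)

lemma alternating_sum_choose (N j : ℕ) :
    ∑ k ∈ range (N + 1), (-1 : ℤ) ^ k * ((k + j).choose (2 * j) : ℤ)
      + 4 * ∑ k ∈ range (N + 1), (-1 : ℤ) ^ k * ((k + (j + 1)).choose (2 * (j + 1)) : ℤ)
      = (-1) ^ N * (((N + 1 + (j + 1)).choose (2 * (j + 1)) : ℤ)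
        + ((N + (j + 1)).choose (2 * (j + 1)) : ℤ)) := by
  induction N with
  | zero =>
    rcases j with _ | j
    · simp
    · simp [Nat.choose_eq_zero_of_lt (show j + 1 < 2 * (j + 1) by lia),
        Nat.choose_eq_zero_of_lt (show j + 1 + 1 < 2 * (j + 1 + 1) by lia),
        Nat.choose_eq_zero_of_lt (show 1 + (j + 1 + 1) < 2 * (j + 1 + 1) by lia)]
  | succ N ih =>
    rw [sum_range_succ, sum_range_succ _ (N + 1)]
    have key : ((N + 1 + j).choose (2 * j) : ℤ) + 4 * ((N + 1 + (j + 1)).choose (2 * (j + 1)) : ℤ)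
        = ((N + 2 + (j + 1)).choose (2 * (j + 1)) : ℤ)
        + 2 * ((N + 1 + (j + 1)).choose (2 * (j + 1)) : ℤ)
        + ((N + (j + 1)).choose (2 * (j + 1)) : ℤ) := by
      obtain ⟨p0, p1, p2, -, -⟩ := choose_shift_expand N j
      have : ((N + 1 + j).choose (2 * j) : ℚ)
        + 4 * ((N + 1 + (j + 1)).choose (2 * (j + 1)) : ℚ)
        = ((N + 2 + (j + 1)).choose (2 * (j + 1)) : ℚ)
        + 2 * ((N + 1 + (j + 1)).choose (2 * (j + 1)) : ℚ)
        + ((N + (j + 1)).choose (2 * (j + 1)) : ℚ) := by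
        rw [p0, p1, p2]; ring
      exact_mod_cast this
    rw [show N + 1 + 1 + (j + 1) = N + 2 + (j + 1) by ring]
    linear_combination ih + (-1) ^ (N + 1) * key

lemma sq_dvd_choose_add_choose {p J : ℕ} (hp : p.Prime) (h0 : 0 < J) (h : 2 * J < p) :
    p ^ 2 ∣ (p + J).choose (2 * J) + (p - 1 + J).choose (2 * J) := by
  obtain ⟨j, rfl⟩ : ∃ j, J = j + 1 := ⟨J - 1, by lia⟩
  obtain ⟨P, rfl⟩ : ∃ P, p = P + 1 := ⟨p - 1, by lia⟩
  have hr := choose_shift_rel P (j + 1)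
  have hP : ((P + 1 + (j + 1)).choose (2 * (j + 1)) : ℚ)
      = ((P + 1 + j).choose (2 * j + 1) : ℚ) + ((P + (j + 1)).choose (2 * (j + 1)) : ℚ) := by
    rw [show P + 1 + (j + 1) = (P + 1 + j) + 1 by ring, show 2 * (j + 1) = 2 * j + 1 + 1 by ring,
      Nat.choose_succ_succ, show P + (j + 1) = P + 1 + j by ring]
    push_cast; ring
  have e : (j + 1) * ((P + 1 + (j + 1)).choose (2 * (j + 1))
      + (P + (j + 1)).choose (2 * (j + 1))) = (P + 1) * (P + 1 + j).choose (2 * j + 1) := by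
    have : ((j : ℚ) + 1) * (((P + 1 + (j + 1)).choose (2 * (j + 1)) : ℚ)
      + ((P + (j + 1)).choose (2 * (j + 1)) : ℚ))
      = ((P : ℚ) + 1) * ((P + 1 + j).choose (2 * j + 1) : ℚ) := by
      push_cast at hr
      linear_combination ((P : ℚ) + 1) * hP - hr
    exact_mod_cast this
  have hd : P + 1 ∣ (P + 1 + j).choose (2 * j + 1) := by
    have : Fact (P + 1).Prime := ⟨hp⟩
    have := Choose.choose_modEq_choose_mod_mul_choose_div_nat (n := P + 1 + j) (k := 2 * j + 1)
      (p := P + 1)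
    rw [Nat.add_mod_left, Nat.mod_eq_of_lt (show j < P + 1 by lia),
      Nat.mod_eq_of_lt (show 2 * j + 1 < P + 1 by lia),
      Nat.choose_eq_zero_of_lt (show j < 2 * j + 1 by lia), zero_mul] at this
    exact (Nat.modEq_zero_iff_dvd).1 this
  have hd2 : (P + 1) ^ 2 ∣ (j + 1) * ((P + 1 + (j + 1)).choose (2 * (j + 1))
      + (P + (j + 1)).choose (2 * (j + 1))) := by
    rw [e, sq]; exact mul_dvd_mul_left _ hd
  exact Nat.Coprime.dvd_of_dvd_mul_left ((hp.coprime_iff_not_dvd.2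
    (Nat.not_dvd_of_pos_of_lt (by lia) (by lia))).pow_left 2) hd2

lemma neg_four_pow_mul_alternating_sum {p : ℕ} (hp : p.Prime) (hodd : p % 2 = 1) (j : ℕ)
    (hj : 2 * j < p) :
    (-4 : ZMod (p ^ 2)) ^ j
      * (∑ k ∈ range p, (-1 : ℤ) ^ k * ((k + j).choose (2 * j) : ℤ) : ℤ) = 1 := by
  have hP : p = (p - 1) + 1 := by have := hp.pos; lia
  have hev : Even (p - 1) := ⟨p / 2, by lia⟩
  induction j with
  | zero =>
    have : ∑ k ∈ range p, (-1 : ℤ) ^ k = 1 := by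
      rw [hP, sum_range_succ, neg_one_geom_sum, if_pos hev, hev.neg_one_pow]; rfl
    simp only [add_zero, mul_zero, Nat.choose_zero_right, pow_zero, Nat.cast_one, mul_one, this]
    simp
  | succ j ih =>
    have h := alternating_sum_choose (p - 1) j
    rw [← hP, hev.neg_one_pow, one_mul] at h
    have hz : ((((p + (j + 1)).choose (2 * (j + 1)) : ℤ)
        + ((p - 1 + (j + 1)).choose (2 * (j + 1)) : ℤ) : ℤ) : ZMod (p ^ 2)) = 0 := by
      have := (ZMod.natCast_eq_zero_iff _ _).2
        (sq_dvd_choose_add_choose hp (Nat.succ_pos j) hj)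
      exact_mod_cast this
    rw [← h] at hz
    specialize ih (by lia)
    rw [Int.cast_add, Int.cast_mul] at hz
    set X : ZMod (p ^ 2) :=
      ((∑ k ∈ range p, (-1 : ℤ) ^ k * ((k + j).choose (2 * j) : ℤ) : ℤ) : ZMod (p ^ 2))
    set Y : ZMod (p ^ 2) := ((∑ k ∈ range p,
      (-1 : ℤ) ^ k * ((k + (j + 1)).choose (2 * (j + 1)) : ℤ) : ℤ) : ZMod (p ^ 2))
    rw [Int.cast_ofNat] at hz
    linear_combination ih - (-4 : ZMod (p ^ 2)) ^ j * hz

lemma choose_mul_centralBinom_rec (n j : ℕ) :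
    ((j : ℤ) + 1) ^ 2 * (((n + (j + 1)).choose (2 * (j + 1)) : ℤ) * (Nat.centralBinom (j + 1) : ℤ))
      = (n - j) * (n + j + 1) * (((n + j).choose (2 * j) : ℤ) * (Nat.centralBinom j : ℤ)) := by
  have h : ((j : ℚ) + 1) ^ 2 * (((n + (j + 1)).choose (2 * (j + 1)) : ℚ)
      * (Nat.centralBinom (j + 1) : ℚ))
      = (n - j) * (n + j + 1) * (((n + j).choose (2 * j) : ℚ) * (Nat.centralBinom j : ℚ)) := by
    obtain ⟨p0, -, -, -, p4⟩ := choose_shift_expand n j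
    have e3 := cast_centralBinom_succ (K := ℚ) j
    have hr := choose_shift_rel n j
    rw [p0, p4, show (Nat.centralBinom (j + 1) : ℚ)
      = 2 * (2 * j + 1) * (Nat.centralBinom j : ℚ) / (j + 1) by field_simp; linarith]
    field_simp
    linear_combination ((n : ℚ) - j) * (Nat.centralBinom j : ℚ) * hr
  exact_mod_cast h

lemma centralBinom_sq_eq {i : ℕ} (hp : (4 * i + 1).Prime) (j : ℕ) (hj : j ≤ 2 * i) :
    (Nat.centralBinom j : ZMod ((4 * i + 1) ^ 2)) ^ 2
      = (-16) ^ j * (((2 * i + j).choose (2 * j) : ZMod ((4 * i + 1) ^ 2))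
        * (Nat.centralBinom j : ZMod ((4 * i + 1) ^ 2))) := by
  induction j with
  | zero => simp
  | succ j ih =>
    specialize ih (by lia)
    have hu := isUnit_natCast_of_lt hp (Nat.succ_pos j) (by lia)
    have h1 := congrArg (Int.cast : ℤ → ZMod ((4 * i + 1) ^ 2))
      (choose_mul_centralBinom_rec (2 * i) j)
    have h2 := cast_centralBinom_succ (K := ZMod ((4 * i + 1) ^ 2)) j
    have hz := natCast_sq_eq_zero (4 * i + 1)
    apply (hu.pow 2).mul_left_cancel
    push_cast at h1 hz ⊢
    generalize ((2 * i + j).choose (2 * j) : ZMod ((4 * i + 1) ^ 2)) = a at *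
    generalize ((2 * i + (j + 1)).choose (2 * (j + 1)) : ZMod ((4 * i + 1) ^ 2)) = a' at *
    generalize (Nat.centralBinom (j + 1) : ZMod ((4 * i + 1) ^ 2)) = b' at *
    generalize (Nat.centralBinom j : ZMod ((4 * i + 1) ^ 2)) = b at *
    linear_combination (((j : ZMod ((4 * i + 1) ^ 2)) + 1) * b' + 2 * (2 * j + 1) * b) * h2
      + 4 * (2 * j + 1) ^ 2 * ih - (-16) ^ (j + 1) * h1
      + 4 * (-16) ^ j * (a * b) * hz

lemma centralBinom_sq_eq_zero {p : ℕ} (hp : p.Prime) (j : ℕ) (hj : j < p) (h : p < 2 * j) :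
    (Nat.centralBinom j : ZMod (p ^ 2)) ^ 2 = 0 := by
  have : p ∣ Nat.centralBinom j := by
    rw [Nat.centralBinom]
    exact hp.dvd_choose hj (by lia) h.le
  have h2 : p ^ 2 ∣ Nat.centralBinom j ^ 2 := pow_dvd_pow_of_dvd this 2
  exact_mod_cast (ZMod.natCast_eq_zero_iff _ _).2 h2

lemma legendre_zero_int (i N : ℕ) (hN : 2 * i < N) :
    4 ^ i * ∑ j ∈ range N, ((2 * i + j).choose (2 * j) : ℤ) * (Nat.centralBinom j : ℤ)
      * ((-1) ^ j * 2 ^ (N - j)) = 2 ^ N * ((-1) ^ i * (Nat.centralBinom i : ℤ)) := by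
  have h := legendre_zero i N hN
  have : (4 : ℚ) ^ i * ∑ j ∈ range N, ((2 * i + j).choose (2 * j) : ℚ)
      * (Nat.centralBinom j : ℚ) * ((-1) ^ j * 2 ^ (N - j))
      = 2 ^ N * ((-1) ^ i * (Nat.centralBinom i : ℚ)) := by
    have e : ∑ j ∈ range N, ((2 * i + j).choose (2 * j) : ℚ)
        * (Nat.centralBinom j : ℚ) * ((-1) ^ j * 2 ^ (N - j))
        = 2 ^ N * ∑ j ∈ range N, ((2 * i + j).choose (2 * j) : ℚ)
        * (Nat.centralBinom j : ℚ) * (-1 / 2) ^ j := by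
      rw [mul_sum]
      refine sum_congr rfl fun j hj => ?_
      obtain ⟨m, rfl⟩ := Nat.exists_eq_add_of_lt (mem_range.1 hj)
      rw [show j + m + 1 - j = m + 1 by lia, div_pow, add_assoc, pow_add]
      field_simp
      ring
    rw [e, h]
    field_simp
  exact_mod_cast this

lemma sum_genCentralTrinomial_sq {i : ℕ} (hp : (4 * i + 1).Prime) :
    (4 : ZMod ((4 * i + 1) ^ 2)) ^ i * ((∑ k ∈ range (4 * i + 1),
        genCentralTrinomial 2 (-1) k ^ 2 * (-8) ^ (4 * i + 1 - k) : ℤ) : ZMod ((4 * i + 1) ^ 2))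
      = (-8) ^ (4 * i + 1) * ((-1) ^ i * (Nat.centralBinom i : ZMod ((4 * i + 1) ^ 2))) := by
  set p := 4 * i + 1 with hpi
  have hodd : p % 2 = 1 := by lia
  have hneg : (-1 : ℤ) ^ p = -1 := Odd.neg_one_pow ⟨2 * i, by lia⟩
  have e1 : ∑ k ∈ range p, genCentralTrinomial 2 (-1) k ^ 2 * (-8) ^ (p - k)
      = -∑ j ∈ range p, (Nat.centralBinom j : ℤ) ^ 2 * (-1) ^ j * 8 ^ (p - j)
        * ∑ k ∈ range p, (-1) ^ k * ((k + j).choose (2 * j) : ℤ) := by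
    simp only [mul_sum]
    rw [sum_comm, ← sum_neg_distrib]
    refine sum_congr rfl fun k hk => ?_
    apply mul_right_cancel₀ (pow_ne_zero p (show (8 : ℤ) ≠ 0 by norm_num))
    have hk' := mem_range.1 hk
    have hs : (8 : ℤ) ^ k * (-8) ^ (p - k) = -(8 ^ p * (-1) ^ k) := by
      have h8 : (8 : ℤ) ^ p = 8 ^ k * 8 ^ (p - k) := by rw [← pow_add]; congr 1; lia
      have h1 : (-1 : ℤ) ^ p = (-1) ^ k * (-1) ^ (p - k) := by rw [← pow_add]; congr 1; lia
      have hkk : (-1 : ℤ) ^ k * (-1) ^ k = 1 := by rw [← mul_pow]; simp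
      rw [hneg] at h1
      rw [neg_pow (8 : ℤ), h8]
      linear_combination (-(8 : ℤ) ^ k * 8 ^ (p - k) * (-1) ^ k) * h1
        - 8 ^ k * 8 ^ (p - k) * (-1) ^ (p - k) * hkk
    have hq := genCentralTrinomial_sq p k hk'
    rw [← mul_sum] at hq
    calc _ = (genCentralTrinomial 2 (-1) k ^ 2 * 8 ^ p) * (-8) ^ (p - k) := by ring
      _ = _ := by
        rw [hq, neg_mul, sum_mul]
        rw [show ∀ s : ℤ, 8 ^ k * s * (-8) ^ (p - k) = (8 ^ k * (-8) ^ (p - k)) * s from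
          fun s => by ring, hs, neg_mul, mul_sum]
        congr 1
        exact sum_congr rfl fun j _ => by ring
  have e2 : ((∑ k ∈ range p, genCentralTrinomial 2 (-1) k ^ 2 * (-8) ^ (p - k) : ℤ) :
      ZMod (p ^ 2)) = -4 ^ p * ((∑ j ∈ range p, ((2 * i + j).choose (2 * j) : ℤ)
        * (Nat.centralBinom j : ℤ) * ((-1) ^ j * 2 ^ (p - j)) : ℤ) : ZMod (p ^ 2)) := by
    rw [e1, Int.cast_neg, Int.cast_sum, Int.cast_sum, neg_mul, mul_sum]
    congr 1
    refine sum_congr rfl fun j hj => ?_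
    have hj' := mem_range.1 hj
    rcases le_or_gt j (2 * i) with h | h
    · have hB := centralBinom_sq_eq hp j h
      have hA := neg_four_pow_mul_alternating_sum hp hodd j (by lia)
      rw [Int.cast_mul]
      set X : ZMod (p ^ 2) :=
        ((∑ k ∈ range p, (-1 : ℤ) ^ k * ((k + j).choose (2 * j) : ℤ) : ℤ) : ZMod (p ^ 2))
      push_cast
      rw [hB]
      have h4 : (4 : ZMod (p ^ 2)) ^ p = 4 ^ j * 4 ^ (p - j) := by
        rw [← pow_add]; congr 1; lia
      have h8 : (8 : ZMod (p ^ 2)) ^ (p - j) = 4 ^ (p - j) * 2 ^ (p - j) := by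
        rw [← mul_pow]; norm_num
      have h16 : (-16 : ZMod (p ^ 2)) ^ j * (-1) ^ j = (-4) ^ j * (-4) ^ j := by
        rw [← mul_pow, ← mul_pow]; norm_num
      have h44 : (-4 : ZMod (p ^ 2)) ^ j = (-1) ^ j * 4 ^ j := by
        rw [← mul_pow]; norm_num
      rw [h4, h8]
      generalize ((2 * i + j).choose (2 * j) : ZMod (p ^ 2)) = a
      generalize (Nat.centralBinom j : ZMod (p ^ 2)) = b
      linear_combination (a * b * 4 ^ (p - j) * 2 ^ (p - j) * X) * h16
        + a * b * 4 ^ (p - j) * 2 ^ (p - j) * (-4) ^ j * hA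
        + a * b * 4 ^ (p - j) * 2 ^ (p - j) * h44
    · have hB := centralBinom_sq_eq_zero hp j hj' (by lia)
      rw [Nat.choose_eq_zero_of_lt (show 2 * i + j < 2 * j by lia)]
      push_cast
      rw [hB]
      ring
  have h3 := congrArg (Int.cast : ℤ → ZMod (p ^ 2)) (legendre_zero_int i p (by lia))
  rw [Int.cast_mul] at h3
  rw [e2]
  set Z : ZMod (p ^ 2) := ((∑ j ∈ range p, ((2 * i + j).choose (2 * j) : ℤ)
        * (Nat.centralBinom j : ℤ) * ((-1) ^ j * 2 ^ (p - j)) : ℤ) : ZMod (p ^ 2))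
  push_cast at h3
  have h8 : (-8 : ZMod (p ^ 2)) ^ p = -(4 ^ p * 2 ^ p) := by
    rw [← mul_pow, Odd.neg_pow ⟨2 * i, by lia⟩]; norm_num
  rw [h8]
  linear_combination (-4 ^ p) * h3

section Harmonic

variable {K : Type*} [CommRing K]

lemma choose_add_two_expand (i k : ℕ) :
    ((2 * i + 2).choose (i + k + 2) : K) = ((2 * i).choose (i + k) : K)
      + 2 * ((2 * i).choose (i + k + 1) : K) + ((2 * i).choose (i + k + 2) : K) := by
  rw [Nat.choose_succ_succ, Nat.choose_succ_succ (2 * i), Nat.choose_succ_succ (2 * i)]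
  push_cast
  ring

lemma alternating_sum_mul_choose (i N : ℕ) :
    ∑ k ∈ range N, (-1 : K) ^ (k + 1) * ((k + 1) * ((2 * i + 2).choose (i + k + 2) : K))
      = -((2 * i).choose i : K) + (-1) ^ N * ((i + 1)
        * (((2 * i).choose (i + N) : K) - ((2 * i).choose (i + N + 1) : K))) := by
  induction N with
  | zero =>
    have h := cast_choose_succ_right (K := K) (2 * i) i
    push_cast at h
    simp only [range_zero, sum_empty, pow_zero, add_zero]
    linear_combination h
  | succ N ih =>
    have h1 := cast_choose_succ_right (K := K) (2 * i) (i + N)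
    have h2 := cast_choose_succ_right (K := K) (2 * i) (i + N + 1)
    push_cast at h1 h2
    rw [sum_range_succ, ih, choose_add_two_expand]
    simp only [← add_assoc]
    rw [show i + N + 1 + 1 = i + N + 2 by ring] at *
    linear_combination (-1) ^ (N + 1) * (h1 + h2)

lemma sub_sq_mul_choose (i k : ℕ) :
    (((i : K) + 1) ^ 2 - (k + 1) ^ 2) * ((2 * i + 2).choose (i + k + 2) : K)
      = (2 * i + 2) * (2 * i + 1) * ((2 * i).choose (i + k + 1) : K) := by
  have h1 := cast_choose_succ_right (K := K) (2 * i) (i + k)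
  have h2 := cast_choose_succ_right (K := K) (2 * i) (i + k + 1)
  rw [choose_add_two_expand]
  push_cast at h1 h2
  rw [show i + k + 1 + 1 = i + k + 2 by ring] at h2
  linear_combination (-((i : K) + k + 2)) * h1 + ((i : K) - k) * h2

lemma alternating_sum_choose_half (j N : ℕ) :
    ∑ k ∈ range N, (-1 : K) ^ k * ((2 * j + 2).choose (j + k + 2) : K)
      = ((2 * j + 1).choose (j + 1) : K) - (-1) ^ N * ((2 * j + 1).choose (j + N + 1) : K) := by
  induction N with
  | zero => simp
  | succ N ih =>
    have h : (2 * j + 2).choose (j + N + 2)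
        = (2 * j + 1).choose (j + N + 1) + (2 * j + 1).choose (j + N + 2) :=
      Nat.choose_succ_succ (2 * j + 1) (j + N + 1)
    rw [sum_range_succ, ih, h, show j + (N + 1) + 1 = j + N + 2 by ring]
    push_cast
    ring

end Harmonic

lemma sum_choose_div_eq {F : Type*} [Field F] (i : ℕ)
    (hF : ∀ m : ℕ, 0 < m → m ≤ 2 * i → (m : F) ≠ 0) :
    ∑ k ∈ range i, (-1 : F) ^ (k + 1) * ((2 * i).choose (i + k + 1) : F) / (k + 1)
      = -((2 * i).choose i : F) * ∑ m ∈ range (2 * i), (-1) ^ m / ((m : F) + 1) := by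
  induction i with
  | zero => simp
  | succ i ih =>
    specialize ih fun m h0 h => hF m h0 (by lia)
    have hi : (i : F) + 1 ≠ 0 := by exact_mod_cast hF (i + 1) (by lia) (by lia)
    have h1 : 2 * (i : F) + 1 ≠ 0 := by exact_mod_cast hF (2 * i + 1) (by lia) (by lia)
    have h2 : 2 * (i : F) + 2 ≠ 0 := by exact_mod_cast hF (2 * i + 2) (by lia) (by lia)
    have hz : (2 * i).choose (i + i + 1) = 0 := Nat.choose_eq_zero_of_lt (by lia)
    have e : ((i : F) + 1) ^ 2 * ∑ k ∈ range (i + 1),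
        (-1 : F) ^ (k + 1) * ((2 * (i + 1)).choose (i + 1 + k + 1) : F) / (k + 1)
        - (2 * i + 2) * (2 * i + 1) * ∑ k ∈ range (i + 1),
        (-1 : F) ^ (k + 1) * ((2 * i).choose (i + k + 1) : F) / (k + 1)
        = -((2 * i).choose i : F) := by
      have hV := alternating_sum_mul_choose (K := F) i (i + 1)
      rw [Nat.choose_eq_zero_of_lt (show 2 * i < i + (i + 1) by lia),
        Nat.choose_eq_zero_of_lt (show 2 * i < i + (i + 1) + 1 by lia)] at hV
      simp only [Nat.cast_zero, sub_zero, mul_zero, add_zero] at hV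
      rw [← hV, mul_sum, mul_sum, ← sum_sub_distrib]
      refine sum_congr rfl fun k hk => ?_
      have hk1 : (k : F) + 1 ≠ 0 := by
        exact_mod_cast hF (k + 1) (by lia) (by have := mem_range.1 hk; lia)
      have := sub_sq_mul_choose (K := F) i k
      rw [show 2 * (i + 1) = 2 * i + 2 by ring, show i + 1 + k + 1 = i + k + 2 by ring]
      field_simp
      linear_combination this
    have hlast : ∑ k ∈ range (i + 1), (-1 : F) ^ (k + 1) * ((2 * i).choose (i + k + 1) : F) / (k + 1)
        = ∑ k ∈ range i, (-1 : F) ^ (k + 1) * ((2 * i).choose (i + k + 1) : F) / (k + 1) := by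
      rw [sum_range_succ, hz]
      simp
    rw [hlast, ih] at e
    rw [show 2 * (i + 1) = 2 * i + 1 + 1 by ring, sum_range_succ _ (2 * i + 1),
      sum_range_succ _ (2 * i)] at *
    have hc := cast_centralBinom_succ (K := F) i
    rw [Nat.centralBinom, Nat.centralBinom, show 2 * (i + 1) = 2 * i + 1 + 1 by ring] at hc
    have hev : (-1 : F) ^ (2 * i) = 1 := by rw [pow_mul]; simp
    have h2' : 2 * (i : F) + 1 + 1 ≠ 0 := by rw [add_assoc, one_add_one_eq_two]; exact h2
    rw [pow_succ, hev]
    apply mul_left_cancel₀ (pow_ne_zero 2 hi)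
    generalize ((2 * i + 1 + 1).choose (i + 1) : F) = b' at *
    generalize ((2 * i).choose i : F) = b at *
    rw [eq_add_of_sub_eq e]
    have hb : b' = 2 * (2 * i + 1) * b / (i + 1) := by field_simp; linear_combination hc
    rw [hb]
    push_cast
    have h3 : (2 : F) ≠ 0 := by
      intro h; apply h2; rw [show 2 * (i : F) + 2 = 2 * (i + 1) by ring, h, zero_mul]
    field_simp
    ring

/-- The correction term, modulo `p`, in the expansion of a quartic Jacobi sum. -/
lemma correction_term {F : Type*} [Field F] {i : ℕ} (hi : 0 < i) (b : ℕ → F)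
    (hF : ∀ m : ℕ, 0 < m → m < 4 * i + 1 → (m : F) ≠ 0) (hp0 : 4 * (i : F) + 1 = 0)
    (hb : ∀ r, 0 < r → r < 4 * i + 1 → b r * r = -1) :
    (2 * i) * ∑ s ∈ range (2 * i), (-1) ^ s * ((2 * i - 1).choose s : F)
        * b (if s < i then i - s else 5 * i - s)
      = (-1) ^ i * (Nat.centralBinom i : F)
        * (1 - ∑ m ∈ range (2 * i), (-1) ^ (m + 1) * b (2 * (m + 1))) := by
  have hb' : ∀ r, 0 < r → r < 4 * i + 1 → b r = -1 / r := fun r h0 h => by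
    rw [eq_div_iff (hF r h0 h), hb r h0 h]
  have hH := sum_choose_div_eq (F := F) i fun m h0 h => hF m h0 (by lia)
  obtain ⟨j, rfl⟩ : ∃ j, i = j + 1 := ⟨i - 1, by lia⟩
  have hsplit : ∑ s ∈ range (2 * (j + 1)), (-1) ^ s * ((2 * (j + 1) - 1).choose s : F)
        * b (if s < j + 1 then j + 1 - s else 5 * (j + 1) - s)
      = 2 * (-1) ^ (j + 1) * ∑ k ∈ range (j + 1),
        (-1) ^ k * ((2 * j + 1).choose (j + k + 1) : F) / (k + 1) := by
    rw [two_mul (j + 1), sum_range_add, ← sum_range_reflect, ← sum_add_distrib, mul_sum]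
    refine sum_congr rfl fun k hk => ?_
    have hk' := mem_range.1 hk
    have hk1 : (k : F) + 1 ≠ 0 := by exact_mod_cast hF (k + 1) (by lia) (by lia)
    rw [if_pos (by lia), if_neg (by lia), show j + 1 - (j + 1 - 1 - k) = k + 1 by lia,
      show 5 * (j + 1) - (j + 1 + k) = 4 * (j + 1) - k by lia,
      show j + 1 + (j + 1) - 1 = 2 * j + 1 by lia, show j + 1 - 1 - k = j - k by lia,
      show j + 1 + k = j + k + 1 by ring, hb' _ (by lia) (by lia), hb' _ (by lia) (by lia),
      Nat.cast_sub (by lia), ← Nat.choose_symm (show j - k ≤ 2 * j + 1 by lia),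
      show 2 * j + 1 - (j - k) = j + k + 1 by lia,
      show (-1 : F) ^ (j - k) = (-1) ^ (j + k) by
        rw [show j + k = (j - k) + 2 * k by lia, pow_add, pow_mul]; simp]
    have h4 : ((4 * (j + 1) : ℕ) : F) - k = -(k + 1) := by
      push_cast at hp0 ⊢
      linear_combination hp0
    rw [h4]
    push_cast
    have : -((k : F) + 1) ≠ 0 := neg_ne_zero.2 hk1
    field_simp
    ring
  have hmul : (2 * ((j + 1 : ℕ) : F)) * ∑ k ∈ range (j + 1),
        (-1) ^ k * ((2 * j + 1).choose (j + k + 1) : F) / (k + 1)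
      = ∑ k ∈ range (j + 1), (-1) ^ k * ((2 * j + 2).choose (j + k + 2) : F)
        - (j + 1) * ∑ k ∈ range (j + 1),
          (-1) ^ (k + 1) * ((2 * (j + 1)).choose (j + 1 + k + 1) : F) / (k + 1) := by
    rw [mul_sum, mul_sum, ← sum_sub_distrib]
    refine sum_congr rfl fun k hk => ?_
    have hk' := mem_range.1 hk
    have hk1 : (k : F) + 1 ≠ 0 := by exact_mod_cast hF (k + 1) (by lia) (by lia)
    have h : ((2 * j + 1 + 1 : ℕ) : F) * ((2 * j + 1).choose (j + k + 1) : F)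
        = ((2 * j + 2).choose (j + k + 2) : F) * ((j + k + 1 + 1 : ℕ) : F) := by
      rw [← Nat.cast_mul, ← Nat.cast_mul]
      exact congrArg _ (Nat.add_one_mul_choose_eq (2 * j + 1) (j + k + 1))
    rw [show 2 * (j + 1) = 2 * j + 2 by ring, show j + 1 + k + 1 = j + k + 2 by ring]
    push_cast at h ⊢
    field_simp
    linear_combination (-1) ^ k * h
  have hhalf := alternating_sum_choose_half (K := F) j (j + 1)
  rw [Nat.choose_eq_zero_of_lt (show 2 * j + 1 < j + (j + 1) + 1 by lia)] at hhalf
  have hcen : 2 * ((2 * j + 1).choose (j + 1) : F) = ((2 * (j + 1)).choose (j + 1) : F) := by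
    have h2 : (2 * (j + 1)).choose (j + 1)
        = (2 * j + 1).choose j + (2 * j + 1).choose (j + 1) :=
      Nat.choose_succ_succ (2 * j + 1) j
    have h3 : (2 * j + 1).choose j = (2 * j + 1).choose (j + 1) := by
      rw [← Nat.choose_symm (show j ≤ 2 * j + 1 by lia)]
      congr 1
      lia
    rw [h2, h3]
    push_cast
    ring
  have h2F : (2 : F) ≠ 0 := by exact_mod_cast hF 2 (by lia) (by lia)
  have hQ : ∑ m ∈ range (2 * (j + 1)), (-1) ^ (m + 1) * b (2 * (m + 1))
      = 2⁻¹ * ∑ m ∈ range (2 * (j + 1)), (-1) ^ m / ((m : F) + 1) := by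
    rw [mul_sum]
    refine sum_congr rfl fun m hm => ?_
    have hm' := mem_range.1 hm
    have hm1 : (m : F) + 1 ≠ 0 := by exact_mod_cast hF (m + 1) (by lia) (by lia)
    rw [hb' _ (by lia) (by lia)]
    push_cast
    field_simp
    ring
  rw [hsplit, hQ, Nat.centralBinom]
  generalize ∑ m ∈ range (2 * (j + 1)), (-1) ^ m / ((m : F) + 1) = H at *
  rw [hH, hhalf] at hmul
  push_cast at hmul hp0 ⊢
  have h22 : (2 : F) * 2⁻¹ = 1 := mul_inv_cancel₀ h2F
  generalize (2 : F)⁻¹ = t at *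
  linear_combination 2 * (-1) ^ (j + 1) * hmul + (-1) ^ (j + 1) * hcen
    + (-1) ^ (j + 1) * ((2 * (j + 1)).choose (j + 1) : F) * H * (t * hp0 - 2 * (j + 1) * h22)

/-- The even part of the binomial expansion of `(1 + √-1) ^ (4 * i + 1)`. -/
lemma alternating_sum_even_choose (i : ℕ) :
    ∑ m ∈ range (2 * i + 1), (-1 : ℤ) ^ m * ((4 * i + 1).choose (2 * m) : ℤ) = (-1) ^ i * 4 ^ i := by
  have hI : (⟨0, 1⟩ : GaussianInt) ^ 2 = -1 := by ext <;> simp [sq]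
  have h := add_pow (⟨0, 1⟩ : GaussianInt) 1 (4 * i + 1)
  have hl : ((⟨0, 1⟩ : GaussianInt) + 1) ^ (4 * i + 1) = (((-1) ^ i * 4 ^ i : ℤ) : GaussianInt)
      * (⟨0, 1⟩ + 1) := by
    rw [pow_succ, pow_mul, show ((⟨0, 1⟩ : GaussianInt) + 1) ^ 4 = -4 by
      linear_combination ((⟨0, 1⟩ : GaussianInt) ^ 2 + 4 * ⟨0, 1⟩ + 5) * hI, ← mul_pow]
    norm_num
  have hs : ∀ (f : ℕ → GaussianInt) (N : ℕ),
      ∑ m ∈ range (2 * N), f m = ∑ m ∈ range N, (f (2 * m) + f (2 * m + 1)) := by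
    intro f N
    induction N with
    | zero => simp
    | succ N ih => rw [mul_add, mul_one, sum_range_succ, sum_range_succ, ih, sum_range_succ]; ring
  have hr : ∑ m ∈ range (4 * i + 1 + 1), (⟨0, 1⟩ : GaussianInt) ^ m * 1 ^ (4 * i + 1 - m)
      * ((4 * i + 1).choose m : GaussianInt)
      = ((∑ m ∈ range (2 * i + 1), (-1 : ℤ) ^ m * ((4 * i + 1).choose (2 * m) : ℤ) : ℤ) :
          GaussianInt)
      + ((∑ m ∈ range (2 * i + 1), (-1 : ℤ) ^ m * ((4 * i + 1).choose (2 * m + 1) : ℤ) : ℤ) :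
          GaussianInt) * ⟨0, 1⟩ := by
    rw [show 4 * i + 1 + 1 = 2 * (2 * i + 1) by ring, hs, sum_add_distrib]
    push_cast
    rw [sum_mul]
    congr 1 <;> refine sum_congr rfl fun m _ => ?_
    · rw [pow_mul, hI]; simp
    · rw [pow_succ, pow_mul, hI]; simp only [one_pow]; ring
  rw [hl, hr] at h
  generalize ((-1) ^ i * 4 ^ i : ℤ) = Z at *
  generalize ∑ m ∈ range (2 * i + 1), (-1 : ℤ) ^ m * ((4 * i + 1).choose (2 * m) : ℤ) = X at *
  generalize ∑ m ∈ range (2 * i + 1), (-1 : ℤ) ^ m * ((4 * i + 1).choose (2 * m + 1) : ℤ) = Y at *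
  have := congrArg Zsqrtd.re h
  simpa using this.symm

lemma natCast_mul_eq_of_cast_eq {p : ℕ} {X Y : ℤ} (h : (X : ZMod p) = Y) :
    (p : ZMod (p ^ 2)) * (X : ZMod (p ^ 2)) = p * (Y : ZMod (p ^ 2)) := by
  obtain ⟨c, hc⟩ := (ZMod.intCast_eq_intCast_iff_dvd_sub _ _ _).1 h
  have h0 := natCast_sq_eq_zero p
  rw [show Y = X + p * c by linarith]
  push_cast
  linear_combination (-(c : ZMod (p ^ 2))) * h0

/-- The integer `(-1) ^ r * p.choose r / p`. -/
def signedChooseDiv (p r : ℕ) : ℤ := (-1) ^ r * ((p.choose r / p : ℕ) : ℤ)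

lemma mul_signedChooseDiv {p r : ℕ} (hp : p.Prime) (h0 : 0 < r) (h : r < p) :
    (p : ℤ) * signedChooseDiv p r = (-1) ^ r * (p.choose r : ℤ) := by
  have hd : p * (p.choose r / p) = p.choose r :=
    Nat.mul_div_cancel' (hp.dvd_choose_self h0.ne' h)
  rw [signedChooseDiv, mul_left_comm]
  exact_mod_cast congrArg (fun z : ℕ => (-1 : ℤ) ^ r * (z : ℤ)) hd

lemma cast_choose_pred {p : ℕ} (hp : p.Prime) {r : ℕ} (h : r < p) :
    ((p - 1).choose r : ZMod p) = (-1) ^ r := by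
  have := Fact.mk hp
  induction r with
  | zero => simp
  | succ r ih =>
    have h1 : p.choose (r + 1) = (p - 1).choose r + (p - 1).choose (r + 1) := by
      conv_lhs => rw [show p = (p - 1) + 1 by have := hp.pos; lia]
      exact Nat.choose_succ_succ _ _
    have h2 : (p.choose (r + 1) : ZMod p) = 0 :=
      (ZMod.natCast_eq_zero_iff _ _).2 (hp.dvd_choose_self (by lia) h)
    rw [h1, Nat.cast_add, ih (by lia)] at h2
    rw [pow_succ]
    linear_combination h2

lemma cast_signedChooseDiv_mul {p r : ℕ} (hp : p.Prime) (h0 : 0 < r) (h : r < p) :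
    (signedChooseDiv p r : ZMod p) * r = -1 := by
  obtain ⟨s, rfl⟩ : ∃ s, r = s + 1 := ⟨r - 1, by lia⟩
  have h1 : p * (p - 1).choose s = p.choose (s + 1) * (s + 1) := by
    have := Nat.add_one_mul_choose_eq (p - 1) s
    rwa [Nat.sub_add_cancel hp.one_le] at this
  have h2 : signedChooseDiv p (s + 1) * ((s + 1 : ℕ) : ℤ)
      = (-1) ^ (s + 1) * ((p - 1).choose s : ℤ) := by
    apply mul_left_cancel₀ (show (p : ℤ) ≠ 0 by exact_mod_cast hp.ne_zero)
    have h2 : (p : ℤ) * ((p - 1).choose s : ℤ) = (p.choose (s + 1) : ℤ) * ((s + 1 : ℕ) : ℤ) := by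
      exact_mod_cast h1
    rw [← mul_assoc, mul_signedChooseDiv hp h0 h]
    linear_combination (-(-1) ^ (s + 1)) * h2
  have h3 := congrArg (Int.cast : ℤ → ZMod p) h2
  rw [Int.cast_mul, Int.cast_mul, Int.cast_natCast, Int.cast_natCast,
    cast_choose_pred hp (show s < p by lia)] at h3
  rw [h3]
  push_cast
  rw [← pow_add, show s + 1 + s = 2 * s + 1 by ring, pow_succ, pow_mul]
  simp

section RootOfUnity

variable {R : Type*} [CommRing R]

lemma sum_root_pow {N : ℕ} {w : R} (hw : w ^ N = 1)
    (hu : ∀ m, 0 < m → m < N → IsUnit (w ^ m - 1)) (m : ℕ) :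
    ∑ k ∈ range N, w ^ (m * k) = if N ∣ m then (N : R) else 0 := by
  split_ifs with h
  · obtain ⟨c, rfl⟩ := h
    simp [mul_assoc, pow_mul, hw]
  · rcases Nat.eq_zero_or_pos N with rfl | hN
    · simp
    have hm : 0 < m % N := Nat.pos_of_ne_zero fun h' => h (Nat.dvd_of_mod_eq_zero h')
    have hmod : w ^ m = w ^ (m % N) := by
      conv_lhs => rw [← Nat.div_add_mod m N, pow_add, pow_mul, hw, one_pow, one_mul]
    have hunit := hu _ hm (Nat.mod_lt _ hN)
    rw [← hmod] at hunit
    apply hunit.mul_left_cancel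
    simp only [pow_mul]
    rw [mul_comm, geom_sum_mul, ← pow_mul, mul_comm m, pow_mul, hw, one_pow, sub_self, mul_zero]

lemma one_sub_pow_eq_sum (y : R) (n : ℕ) :
    (1 - y) ^ n = ∑ s ∈ range (n + 1), (-1) ^ s * (n.choose s : R) * y ^ s := by
  rw [sub_eq_add_neg, add_comm, add_pow]
  refine sum_congr rfl fun s _ => ?_
  rw [neg_pow]
  simp
  ring

lemma one_sub_pow_prime {p : ℕ} (hp : p.Prime) (hodd : Odd p) (y : R) :
    (1 - y) ^ p = 1 - y ^ p + p * ∑ r ∈ range (p - 1), (signedChooseDiv p (r + 1) : R)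
      * y ^ (r + 1) := by
  have h1 : p = p - 1 + 1 := (Nat.sub_add_cancel hp.one_le).symm
  rw [one_sub_pow_eq_sum, sum_range_succ, hodd.neg_one_pow]
  conv_lhs => rw [h1, sum_range_succ']
  rw [← h1, mul_sum]
  have : ∀ r ∈ range (p - 1), (-1) ^ (r + 1) * (p.choose (r + 1) : R) * y ^ (r + 1)
      = p * ((signedChooseDiv p (r + 1) : R) * y ^ (r + 1)) := by
    intro r hr
    have := congrArg (Int.cast : ℤ → R) (mul_signedChooseDiv hp (Nat.succ_pos r)
      (by have := mem_range.1 hr; lia))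
    push_cast at this
    rw [← mul_assoc, this]
  rw [sum_congr rfl this]
  simp
  ring

lemma add_mul_pow_of_sq_eq_zero {ε : R} (hε : ε ^ 2 = 0) (a b : R) (n : ℕ) :
    (a + ε * b) ^ (n + 1) = a ^ (n + 1) + ε * ((n + 1) * a ^ n * b) := by
  induction n with
  | zero => simp
  | succ n ih =>
    rw [pow_succ, ih]
    push_cast
    linear_combination ((n + 1) * a ^ n * b ^ 2) * hε

end RootOfUnity

lemma sum_root_pow_mul_one_sub_pow {i : ℕ} (hp : (4 * i + 1).Prime) {w : ZMod ((4 * i + 1) ^ 2)}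
    (hw : w ^ (4 * i) = 1) (hu : ∀ m, 0 < m → m < 4 * i → IsUnit (w ^ m - 1)) :
    4 ^ i * ∑ k ∈ range (4 * i), w ^ (3 * i * k) * (1 - w ^ k) ^ ((4 * i + 1) * (2 * i))
      = -(Nat.centralBinom i : ZMod ((4 * i + 1) ^ 2)) := by
  have hi : 0 < i := by
    rcases Nat.eq_zero_or_pos i with rfl | h
    · exact absurd hp (by norm_num)
    · exact h
  set b := signedChooseDiv (4 * i + 1) with hb
  set W : ℤ := (2 * i) * ∑ s ∈ range (2 * i), (-1) ^ s * ((2 * i - 1).choose s : ℤ)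
        * b (if s < i then i - s else 5 * i - s) with hW
  set Q : ℤ := ∑ m ∈ range (2 * i), (-1) ^ (m + 1) * b (2 * (m + 1)) with hQ
  have hWQ : ((4 * i + 1 : ℕ) : ZMod ((4 * i + 1) ^ 2)) * (W : ZMod ((4 * i + 1) ^ 2))
      = (4 * i + 1 : ℕ) * (((-1) ^ i * (Nat.centralBinom i : ℤ) * (1 - Q) : ℤ) :
        ZMod ((4 * i + 1) ^ 2)) := by
    apply natCast_mul_eq_of_cast_eq
    have := Fact.mk hp
    have := correction_term (F := ZMod (4 * i + 1)) hi (fun r => (b r : ZMod (4 * i + 1)))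
      (fun m h0 h hm => absurd (Nat.le_of_dvd h0 ((ZMod.natCast_eq_zero_iff _ _).1 hm)) (by lia))
      (by exact_mod_cast ZMod.natCast_self (4 * i + 1))
      (fun r h0 h => cast_signedChooseDiv_mul hp h0 h)
    rw [hW, hQ]
    push_cast
    exact this
  have h4 : (-1) ^ i * 4 ^ i = 1 + ((4 * i + 1 : ℕ) : ℤ) * Q := by
    have h : ∀ m ∈ range (2 * i), (-1 : ℤ) ^ (m + 1) * ((4 * i + 1).choose (2 * (m + 1)) : ℤ)
        = ((4 * i + 1 : ℕ) : ℤ) * ((-1) ^ (m + 1) * b (2 * (m + 1))) := by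
      intro m hm
      have hm' := mem_range.1 hm
      rw [mul_left_comm, mul_signedChooseDiv hp (by lia) (by lia), pow_mul (-1) 2]
      simp
    rw [← alternating_sum_even_choose, sum_range_succ', hQ, mul_sum, sum_congr rfl h]
    simp [add_comm]
  have hmain : ∑ k ∈ range (4 * i), w ^ (3 * i * k) * (1 - w ^ k) ^ ((4 * i + 1) * (2 * i))
      = (4 * i) * ((-1) ^ i * (Nat.centralBinom i : ZMod ((4 * i + 1) ^ 2))
        + (4 * i + 1 : ℕ) * (W : ZMod ((4 * i + 1) ^ 2))) := by
    have hterm : ∀ k, w ^ (3 * i * k) * (1 - w ^ k) ^ ((4 * i + 1) * (2 * i))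
        = w ^ (3 * i * k) * (1 - w ^ k) ^ (2 * i) + (4 * i + 1 : ℕ) * ((2 * i)
          * (w ^ (3 * i * k) * ((1 - w ^ k) ^ (2 * i - 1) * ∑ r ∈ range (4 * i),
            (b (r + 1) : ZMod ((4 * i + 1) ^ 2)) * (w ^ k) ^ (r + 1)))) := by
      intro k
      have hk : (w ^ k) ^ (4 * i + 1) = w ^ k := by
        rw [pow_succ (w ^ k), ← pow_mul, mul_comm k, pow_mul, hw, one_pow, one_mul]
      have h1 := one_sub_pow_prime hp ⟨2 * i, by ring⟩ (w ^ k)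
      rw [hk, Nat.add_sub_cancel] at h1
      rw [pow_mul (1 - w ^ k), h1]
      obtain ⟨j, hj⟩ : ∃ j, 2 * i = j + 1 := ⟨2 * i - 1, by lia⟩
      have hj' : (2 * (i : ZMod ((4 * i + 1) ^ 2))) = j + 1 := by exact_mod_cast congrArg _ hj
      rw [hj', hj, add_mul_pow_of_sq_eq_zero (natCast_sq_eq_zero _), Nat.add_sub_cancel]
      ring
    have hA : ∑ k ∈ range (4 * i), w ^ (3 * i * k) * (1 - w ^ k) ^ (2 * i)
        = (4 * i) * ((-1) ^ i * (Nat.centralBinom i : ZMod ((4 * i + 1) ^ 2))) := by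
      simp only [one_sub_pow_eq_sum, mul_sum]
      rw [sum_comm]
      have : ∀ s ∈ range (2 * i + 1), ∑ k ∈ range (4 * i), w ^ (3 * i * k)
          * ((-1) ^ s * ((2 * i).choose s : ZMod ((4 * i + 1) ^ 2)) * (w ^ k) ^ s)
          = if s = i then (4 * i) * ((-1) ^ i * (Nat.centralBinom i : ZMod ((4 * i + 1) ^ 2)))
            else 0 := by
        intro s hs
        have hs' := mem_range.1 hs
        have h1 : ∀ k, w ^ (3 * i * k)
          * ((-1) ^ s * ((2 * i).choose s : ZMod ((4 * i + 1) ^ 2)) * (w ^ k) ^ s)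
          = ((-1) ^ s * ((2 * i).choose s : ZMod ((4 * i + 1) ^ 2))) * w ^ ((3 * i + s) * k) := by
          intro k; ring
        simp only [h1]
        rw [← mul_sum, sum_root_pow hw hu]
        split_ifs with hd he he
        · subst he
          rw [Nat.centralBinom]
          push_cast
          ring
        · obtain ⟨c, hc⟩ := hd
          have : c = 1 := by nlinarith
          subst this
          lia
        · exact absurd ⟨1, by lia⟩ hd
        · simp
      rw [sum_congr rfl this, sum_ite_eq', if_pos (mem_range.2 (by lia))]
    have hB : ∑ k ∈ range (4 * i), w ^ (3 * i * k) * ((1 - w ^ k) ^ (2 * i - 1)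
          * ∑ r ∈ range (4 * i), (b (r + 1) : ZMod ((4 * i + 1) ^ 2)) * (w ^ k) ^ (r + 1))
        = (4 * i) * ∑ s ∈ range (2 * i), (-1) ^ s
          * ((2 * i - 1).choose s : ZMod ((4 * i + 1) ^ 2))
          * (b (if s < i then i - s else 5 * i - s) : ZMod ((4 * i + 1) ^ 2)) := by
      have h1 : ∀ k, w ^ (3 * i * k) * ((1 - w ^ k) ^ (2 * i - 1)
          * ∑ r ∈ range (4 * i), (b (r + 1) : ZMod ((4 * i + 1) ^ 2)) * (w ^ k) ^ (r + 1))
          = ∑ s ∈ range (2 * i), ∑ r ∈ range (4 * i), ((-1) ^ s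
            * ((2 * i - 1).choose s : ZMod ((4 * i + 1) ^ 2)) * b (r + 1))
              * w ^ ((3 * i + s + (r + 1)) * k) := by
        intro k
        rw [one_sub_pow_eq_sum, Nat.sub_add_cancel (by lia), sum_mul, mul_sum]
        refine sum_congr rfl fun s _ => ?_
        rw [mul_sum, mul_sum]
        refine sum_congr rfl fun r _ => ?_
        ring
      simp only [h1]
      rw [sum_comm, mul_sum]
      refine sum_congr rfl fun s hs => ?_
      have hs' := mem_range.1 hs
      rw [sum_comm]
      simp only [← mul_sum, sum_root_pow hw hu]
      set r₀ := if s < i then i - s else 5 * i - s with hr₀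
      have hr : 0 < r₀ ∧ r₀ ≤ 4 * i ∧ 4 * i ∣ 3 * i + s + r₀ := by
        rw [hr₀]
        split_ifs with h
        · exact ⟨by lia, by lia, 1, by lia⟩
        · exact ⟨by lia, by lia, 2, by lia⟩
      rw [sum_eq_single (r₀ - 1)]
      · rw [Nat.sub_add_cancel hr.1, if_pos hr.2.2]
        push_cast
        ring
      · intro r hrm hne
        have hr' := mem_range.1 hrm
        rw [if_neg, mul_zero]
        intro hd
        have h2 := (Nat.dvd_sub hd hr.2.2)
        have h3 := (Nat.dvd_sub hr.2.2 hd)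
        rcases lt_or_gt_of_ne hne with h | h
        · have := Nat.le_of_dvd (by lia) h3
          lia
        · have := Nat.le_of_dvd (by lia) h2
          lia
      · intro h
        exact absurd (mem_range.2 (by lia)) h
    rw [sum_congr rfl fun k _ => hterm k, sum_add_distrib, hA, ← mul_sum, ← mul_sum, hB, hW]
    push_cast
    ring
  have h0 := natCast_sq_eq_zero (4 * i + 1)
  have h4' := congrArg (Int.cast : ℤ → ZMod ((4 * i + 1) ^ 2)) h4
  have hsq : ((-1) ^ i * (-1) ^ i : ZMod ((4 * i + 1) ^ 2)) = 1 := by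
    rw [← mul_pow]; simp
  rw [hmain]
  rw [hWQ]
  push_cast at h0 h4' ⊢
  generalize (Nat.centralBinom i : ZMod ((4 * i + 1) ^ 2)) = C at *
  generalize (Q : ZMod ((4 * i + 1) ^ 2)) = q at *
  generalize (4 : ZMod ((4 * i + 1) ^ 2)) ^ i = f at *
  generalize (-1 : ZMod ((4 * i + 1) ^ 2)) ^ i = e at *
  have hf : f = e * (1 + (4 * i + 1) * q) := by
    linear_combination e * h4' - f * hsq
  linear_combination (4 * i * (e * C + (4 * i + 1) * (e * C * (1 - q)))) * hf
    + C * (4 * i) * (1 + (4 * i + 1) - (4 * i + 1) * q) * (1 + (4 * i + 1) * q) * hsq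
    + C * (1 + 4 * i * (q - q ^ 2)) * h0

section Reduction

variable {p : ℕ}

/-- Reduction from `ℤ/p²` to `ℤ/p`. -/
abbrev reduce (p : ℕ) : ZMod (p ^ 2) →+* ZMod p :=
  ZMod.castHom (dvd_pow_self p two_ne_zero) (ZMod p)

lemma reduce_natCast_val (hp : p.Prime) (r : ZMod (p ^ 2)) :
    ((r.val : ℕ) : ZMod (p ^ 2)) = r ∧ reduce p r = (r.val : ZMod p) := by
  have : NeZero p := ⟨hp.ne_zero⟩
  have h : ((r.val : ℕ) : ZMod (p ^ 2)) = r := ZMod.natCast_zmod_val r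
  refine ⟨h, ?_⟩
  conv_lhs => rw [← h]
  exact map_natCast _ _

lemma isUnit_of_reduce_ne_zero (hp : p.Prime) {r : ZMod (p ^ 2)} (h : reduce p r ≠ 0) :
    IsUnit r := by
  obtain ⟨h1, h2⟩ := reduce_natCast_val hp r
  rw [← h1]
  apply isUnit_natCast_of_not_dvd hp
  rw [h2, Ne, ZMod.natCast_eq_zero_iff] at h
  exact h

lemma dvd_of_reduce_eq_zero (hp : p.Prime) {r : ZMod (p ^ 2)} (h : reduce p r = 0) :
    (p : ZMod (p ^ 2)) ∣ r := by
  obtain ⟨h1, h2⟩ := reduce_natCast_val hp r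
  rw [h2, ZMod.natCast_eq_zero_iff] at h
  rw [← h1]
  exact Nat.cast_dvd_cast h

lemma pow_prime_eq_of_reduce_eq (hp : p.Prime) {r s : ZMod (p ^ 2)}
    (h : reduce p r = reduce p s) : r ^ p = s ^ p := by
  have h1 := dvd_of_reduce_eq_zero hp (show reduce p (r - s) = 0 by rw [map_sub, h, sub_self])
  have h2 := dvd_sub_pow_of_dvd_sub h1 1
  simp only [pow_one, one_add_one_eq_two] at h2
  rw [natCast_sq_eq_zero, zero_dvd_iff] at h2
  exact sub_eq_zero.1 h2

lemma cast_quadraticChar_eq_pow [Fact p.Prime] (hodd : p % 2 = 1) (r : ZMod (p ^ 2)) :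
    ((quadraticChar (ZMod p) (reduce p r) : ℤ) : ZMod (p ^ 2)) = r ^ (p * (p / 2)) := by
  have hp : p.Prime := Fact.out
  have hc : ringChar (ZMod p) ≠ 2 := by
    rw [ZMod.ringChar_zmod_n]
    rintro rfl
    simp at hodd
  have h1 := quadraticChar_eq_pow_of_char_ne_two' hc (reduce p r)
  rw [ZMod.card, ← map_pow, ← map_intCast (reduce p)] at h1
  rw [mul_comm, pow_mul, ← pow_prime_eq_of_reduce_eq hp h1]
  have hodd' : Odd p := Nat.odd_iff.2 hodd
  rcases quadraticChar_isQuadratic (ZMod p) (reduce p r) with h | h | h <;> rw [h]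
  · simp [hp.ne_zero]
  · simp
  · simp [hodd'.neg_one_pow]

lemma exists_teichmuller [Fact p.Prime] (g : ZMod p) (hg : g ≠ 0) :
    ∃ w : ZMod (p ^ 2), w ^ (p - 1) = 1 ∧ reduce p w = g := by
  have hp : p.Prime := Fact.out
  refine ⟨(g.val : ZMod (p ^ 2)) ^ p, ?_, ?_⟩
  · rw [pow_right_comm]
    conv_rhs => rw [← one_pow p]
    apply pow_prime_eq_of_reduce_eq hp
    rw [map_pow, map_natCast, ZMod.natCast_zmod_val, ZMod.pow_card_sub_one_eq_one hg, map_one]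
  · rw [map_pow, map_natCast, ZMod.natCast_zmod_val, ZMod.pow_card]

end Reduction

section JacobiSum

variable {p : ℕ} [Fact p.Prime]

/-- The quadratic character with values in the Gaussian integers. -/
noncomputable def gaussianQuadraticChar (p : ℕ) [Fact p.Prime] : MulChar (ZMod p) GaussianInt :=
  (quadraticChar (ZMod p)).ringHomComp (Int.castRingHom GaussianInt)

lemma sum_eq_zero_add_sum_pow {M : Type*} [AddCommMonoid M] {g : (ZMod p)ˣ}
    (hg : ∀ x, x ∈ Subgroup.zpowers g) (f : ZMod p → M) :
    ∑ x, f x = f 0 + ∑ k ∈ range (p - 1), f ((g : ZMod p) ^ k) := by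
  have hord : orderOf g = p - 1 := by
    rw [orderOf_eq_card_of_forall_mem_zpowers hg, Nat.card_eq_fintype_card, ZMod.card_units]
  rw [Fintype.sum_eq_add_sum_compl 0]
  congr 1
  symm
  refine sum_bij (fun k _ => (g : ZMod p) ^ k) ?_ ?_ ?_ ?_
  · intro k _
    simp
  · intro a ha b hb h
    have ha' := mem_range.1 ha
    have hb' := mem_range.1 hb
    rw [← hord] at ha' hb'
    refine pow_injOn_Iio_orderOf ha' hb' ?_
    ext
    simpa using h
  · intro x hx
    have hx0 : x ≠ 0 := by simpa using hx
    obtain ⟨k, hk, he⟩ := ((isOfFinOrder_of_finite g).mem_zpowers_iff_mem_range_orderOf).1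
      (hg (Units.mk0 x hx0)) |> mem_image.1
    refine ⟨k, by rwa [hord] at hk, ?_⟩
    rw [← Units.val_pow_eq_pow_val, he, Units.val_mk0]
  · intro k _
    rfl

lemma gaussian_I_sq : (⟨0, 1⟩ : GaussianInt) ^ 2 = -1 := by ext <;> simp [sq]

lemma exists_quarticChar (hp1 : p % 4 = 1) : ∃ (g : (ZMod p)ˣ) (χ : MulChar (ZMod p) GaussianInt),
    (∀ x, x ∈ Subgroup.zpowers g) ∧ χ g = ⟨0, 1⟩ := by
  obtain ⟨g, hg⟩ := IsCyclic.exists_generator (α := (ZMod p)ˣ)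
  have h4 : (⟨0, 1⟩ : GaussianInt) ^ 4 = 1 := by
    linear_combination ((⟨0, 1⟩ : GaussianInt) ^ 2 - 1) * gaussian_I_sq
  let ζ : GaussianIntˣ := Units.ofPowEqOne _ 4 h4 four_ne_zero
  have hζ4 : ζ ^ 4 = 1 := Units.pow_ofPowEqOne _ _
  have hζ : ζ ∈ rootsOfUnity (Fintype.card (ZMod p)ˣ) GaussianInt := by
    rw [mem_rootsOfUnity, ZMod.card_units, show p - 1 = 4 * (p / 4) by lia, pow_mul, hζ4, one_pow]
  exact ⟨g, MulChar.ofRootOfUnity hζ hg, hg, MulChar.ofRootOfUnity_spec hζ hg⟩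

lemma jacobiSum_norm (hp1 : p % 4 = 1) {g : (ZMod p)ˣ} {χ : MulChar (ZMod p) GaussianInt}
    (hχ : χ g = ⟨0, 1⟩) :
    (jacobiSum χ (gaussianQuadraticChar p)).re ^ 2 + (jacobiSum χ (gaussianQuadraticChar p)).im ^ 2
      = p := by
  set ψ := gaussianQuadraticChar p with hψ
  set χ' := χ.ringHomComp GaussianInt.toComplex with hχ'
  set ψ' := ψ.ringHomComp GaussianInt.toComplex with hψ'
  have hc : ringChar (ZMod p) ≠ 2 := by
    rw [ZMod.ringChar_zmod_n]
    rintro rfl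
    simp at hp1
  have hχg : χ' g = Complex.I := by
    rw [hχ', MulChar.ringHomComp_apply, hχ, GaussianInt.toComplex_def']
    simp
  have hψv : ∀ a, ψ' a = ((quadraticChar (ZMod p) a : ℤ) : ℂ) := by
    intro a
    rw [hψ', hψ, gaussianQuadraticChar, MulChar.ringHomComp_apply, MulChar.ringHomComp_apply]
    simp
  have h1 : χ' ≠ 1 := by
    intro h
    rw [h, MulChar.one_apply_coe] at hχg
    simpa using congrArg Complex.re hχg
  have h2 : ψ' ≠ 1 := by
    intro h
    obtain ⟨a, ha⟩ := quadraticChar_exists_neg_one' hc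
    have := hψv a
    rw [h, ha, MulChar.one_apply_coe] at this
    norm_num at this
  have h3 : χ' * ψ' ≠ 1 := by
    intro h
    have := congrArg (fun f : MulChar (ZMod p) ℂ => f g) h
    simp only [MulChar.mul_apply, MulChar.one_apply_coe, hχg, hψv] at this
    simpa using congrArg Complex.re this
  have h4 := jacobiSum_mul_jacobiSum_inv (by
    rw [ZMod.ringChar_zmod_n, ringChar.eq_zero]
    exact (Fact.out : p.Prime).ne_zero.symm) h1 h2 h3
  have h5 : jacobiSum χ'⁻¹ ψ'⁻¹ = star (jacobiSum χ' ψ') := by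
    simp only [jacobiSum, star_sum, star_mul', MulChar.star_apply']
  rw [h5, hχ', hψ', jacobiSum_ringHomComp, ZMod.card] at h4
  have h6 : jacobiSum χ ψ * star (jacobiSum χ ψ) = p := by
    apply GaussianInt.toComplex_injective
    rw [map_mul, GaussianInt.toComplex_star, map_natCast]
    exact h4
  have h7 := congrArg Zsqrtd.re h6
  rw [Zsqrtd.re_mul, Zsqrtd.re_star, Zsqrtd.im_star, Zsqrtd.re_natCast] at h7
  linear_combination h7

lemma dvd_jacobiSum_add (hp1 : p % 4 = 1) {g : (ZMod p)ˣ} (hg : ∀ x, x ∈ Subgroup.zpowers g)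
    {χ : MulChar (ZMod p) GaussianInt} (hχ : χ g = ⟨0, 1⟩) :
    (2 * (⟨0, 1⟩ - 1) : GaussianInt) ∣ jacobiSum χ (gaussianQuadraticChar p) + p := by
  set ψ := gaussianQuadraticChar p with hψ
  have hc : ringChar (ZMod p) ≠ 2 := by
    rw [ZMod.ringChar_zmod_n]
    rintro rfl
    simp at hp1
  have hψv : ∀ a, ψ a = ((quadraticChar (ZMod p) a : ℤ) : GaussianInt) := fun a => rfl
  have h1 : ∑ x, χ x = 0 := by
    apply MulChar.sum_eq_zero_of_ne_one
    intro h
    rw [h, MulChar.one_apply_coe] at hχ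
    simpa using congrArg Zsqrtd.re hχ
  have h2 : ∑ x, ψ (1 - x) = 0 := by
    refine ((Equiv.subLeft (1 : ZMod p)).sum_comp ψ).trans ?_
    simp only [hψv]
    rw [← Int.cast_sum, quadraticChar_sum_zero hc, Int.cast_zero]
  have h3 : jacobiSum χ ψ + p = ∑ x, (χ x - 1) * (ψ (1 - x) - 1) := by
    have : ∀ x, (χ x - 1) * (ψ (1 - x) - 1) = χ x * ψ (1 - x) - χ x - ψ (1 - x) + 1 :=
      fun x => by ring
    simp only [this, sum_add_distrib, sum_sub_distrib, h1, h2, jacobiSum]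
    simp
  rw [h3]
  refine dvd_sum fun x _ => ?_
  by_cases hx : x = 0
  · simp [hx]
  by_cases hx1 : x = 1
  · simp [hx1]
  rw [mul_comm (χ x - 1)]
  refine mul_dvd_mul ?_ ?_
  · rw [hψv]
    rcases quadraticChar_dichotomy (sub_ne_zero.2 (Ne.symm hx1)) with h | h <;> rw [h]
    · simp
    · exact ⟨-1, by norm_num⟩
  · obtain ⟨k, hk⟩ := (mem_powers_iff_mem_zpowers.2 (hg (Units.mk0 x hx)))
    have : x = (g : ZMod p) ^ k := by
      rw [← Units.val_pow_eq_pow_val]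
      exact (congrArg Units.val hk).symm
    rw [this, map_pow, hχ]
    exact sub_one_dvd_pow_sub_one _ _

end JacobiSum

/-- A quartic Jacobi sum `a + b√-1` evaluated in `ℤ/p²` for a suitable choice of `√-1`. -/
lemma exists_jacobiSum_cast {i : ℕ} (hp : (4 * i + 1).Prime) :
    ∃ a b : ℤ, a ^ 2 + b ^ 2 = 4 * i + 1 ∧ 2 ∣ b ∧ 4 ∣ a - b + 1 ∧
      ∃ u : ZMod ((4 * i + 1) ^ 2), u ^ 2 = -1 ∧
        4 ^ i * ((a : ZMod ((4 * i + 1) ^ 2)) + (b : ZMod ((4 * i + 1) ^ 2)) * u)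
          = -(Nat.centralBinom i : ZMod ((4 * i + 1) ^ 2)) := by
  have := Fact.mk hp
  have hi : 0 < i := by
    rcases Nat.eq_zero_or_pos i with rfl | h
    · exact absurd hp (by norm_num)
    · exact h
  have hp1 : (4 * i + 1) % 4 = 1 := by lia
  obtain ⟨g, χ, hg, hχ⟩ := exists_quarticChar hp1
  have hord : orderOf g = 4 * i := by
    rw [orderOf_eq_card_of_forall_mem_zpowers hg, Nat.card_eq_fintype_card, ZMod.card_units,
      Nat.add_sub_cancel]
  obtain ⟨w, hw, hwg⟩ := exists_teichmuller (g : ZMod (4 * i + 1)) g.ne_zero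
  rw [Nat.add_sub_cancel] at hw
  have hu : ∀ m, 0 < m → m < 4 * i → IsUnit (w ^ m - 1) := by
    intro m h0 h
    apply isUnit_of_reduce_ne_zero hp
    rw [map_sub, map_pow, hwg, map_one, sub_ne_zero]
    intro he
    have : g ^ m = 1 := by ext; simpa using he
    exact absurd (Nat.le_of_dvd h0 (orderOf_dvd_of_pow_eq_one this)) (by lia)
  have hw2 : w ^ (2 * i) = -1 := by
    have h1 : (w ^ (2 * i) - 1) * (w ^ (2 * i) + 1) = 0 := by
      linear_combination hw
    exact eq_neg_of_add_eq_zero_left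
      (((hu (2 * i) (by lia) (by lia)).mul_right_eq_zero).1 h1)
  have hu2 : (w ^ (3 * i)) ^ 2 = -1 := by
    linear_combination w ^ (4 * i) * hw2 - hw
  let φ : GaussianInt →+* ZMod ((4 * i + 1) ^ 2) :=
    Zsqrtd.lift ⟨w ^ (3 * i), by rw [← sq, hu2]; simp⟩
  have hφ : ∀ z : GaussianInt, φ z = z.re + z.im * w ^ (3 * i) := fun z => rfl
  set J := jacobiSum χ (gaussianQuadraticChar (4 * i + 1)) with hJ
  have hnorm := jacobiSum_norm hp1 hχ
  obtain ⟨z, hz⟩ := dvd_jacobiSum_add hp1 hg hχ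
  rw [← hJ] at hnorm hz
  have hre := congrArg Zsqrtd.re hz
  have him := congrArg Zsqrtd.im hz
  simp at hre him
  refine ⟨J.re, J.im, by exact_mod_cast hnorm, by lia, by lia, w ^ (3 * i), hu2, ?_⟩
  rw [← hφ, ← sum_root_pow_mul_one_sub_pow hp hw hu, hJ, jacobiSum, map_sum,
    sum_eq_zero_add_sum_pow hg, Nat.add_sub_cancel]
  simp only [MulChar.map_zero, zero_mul, map_zero, zero_add]
  congr 1
  refine sum_congr rfl fun k _ => ?_
  rw [map_mul, map_pow χ, hχ, map_pow φ, hφ]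
  congr 1
  · simp [pow_mul]
  · have h1 := cast_quadraticChar_eq_pow (p := 4 * i + 1) (by lia) (1 - w ^ k)
    rw [show (4 * i + 1) / 2 = 2 * i by lia, map_sub, map_one, map_pow, hwg] at h1
    rw [← h1]
    exact map_intCast φ _

lemma sq_eq_sq_of_sum_sq_eq_prime {p : ℕ} (hp : p.Prime) {a b c d : ℤ}
    (hab : a ^ 2 + b ^ 2 = p) (hcd : c ^ 2 + d ^ 2 = p) (ha : a % 2 = 1)
    (hb : b % 2 = 0) (hd : d % 2 = 0) : a ^ 2 = c ^ 2 := by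
  have hpos : (0 : ℤ) < p := by exact_mod_cast hp.pos
  have hpodd : (p : ℤ) % 2 = 1 := by
    obtain ⟨m, rfl⟩ : ∃ m, a = 2 * m + 1 := ⟨a / 2, by lia⟩
    obtain ⟨n, rfl⟩ : ∃ n, b = 2 * n := ⟨b / 2, by lia⟩
    rw [← hab, show (2 * m + 1) ^ 2 + (2 * n) ^ 2 = 1 + 2 * (2 * m ^ 2 + 2 * m + 2 * n ^ 2) by ring]
    lia
  have key : ∀ e : ℤ, e % 2 = 0 → c ^ 2 + e ^ 2 = p → (p : ℤ) ∣ a * e - b * c →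
      a ^ 2 = c ^ 2 := by
    rintro e he hce ⟨t, ht⟩
    have hbr : (a * e - b * c) ^ 2 + (a * c + b * e) ^ 2 = (p : ℤ) ^ 2 := by
      linear_combination (c ^ 2 + e ^ 2) * hab + (p : ℤ) * hce
    have ht1 : t ^ 2 ≤ 1 := by
      rw [ht] at hbr
      have : (p : ℤ) ^ 2 * t ^ 2 ≤ (p : ℤ) ^ 2 * 1 := by nlinarith [sq_nonneg (a * c + b * e)]
      exact le_of_mul_le_mul_left this (by positivity)
    have heven : (a * e - b * c) % 2 = 0 := by
      rw [Int.sub_emod, Int.mul_emod, he, Int.mul_emod b, hb]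
      simp
    have ht2 : t % 2 = 0 := by
      rw [ht, Int.mul_emod, hpodd] at heven
      lia
    have ht0 : t = 0 := by
      have h1 : t ≤ 1 := by nlinarith
      have h2 : -1 ≤ t := by nlinarith
      lia
    rw [ht0, mul_zero] at ht
    apply mul_left_cancel₀ hpos.ne'
    linear_combination (-a ^ 2) * hce + c ^ 2 * hab + (a * e + b * c) * ht
  have hdvd : (p : ℤ) ∣ (a * d - b * c) * (a * (-d) - b * c) :=
    ⟨b ^ 2 - d ^ 2, by linear_combination (-d ^ 2) * hab + b ^ 2 * hcd⟩
  rcases (Nat.prime_iff_prime_int.1 hp).dvd_or_dvd hdvd with h | h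
  · exact key d hd hcd h
  · exact key (-d) (by lia) (by rw [neg_sq]; exact hcd) h

lemma eq_neg_one_pow_mul_of_sum_sq {i : ℕ} (hp : (4 * i + 1).Prime) {a b x y : ℤ}
    (hab : a ^ 2 + b ^ 2 = 4 * i + 1) (hb : 2 ∣ b) (hba : 4 ∣ a - b + 1)
    (hxy : x ^ 2 + 4 * y ^ 2 = 4 * i + 1) (hx : x % 4 = 1) : x = -(-1) ^ i * a := by
  obtain ⟨c, rfl⟩ := hb
  have hsq := sq_eq_sq_of_sum_sq_eq_prime hp (a := a) (b := 2 * c) (c := x) (d := 2 * y)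
    (by push_cast; exact hab) (by push_cast; linear_combination hxy)
    (by lia) (by lia) (by lia)
  obtain ⟨d, hd⟩ := hba
  have hic : (i : ℤ) % 2 = c % 2 := by
    have h1 : (i : ℤ) = 2 * (2 * d ^ 2 + c ^ 2 + 2 * d * c - d - c) + c := by
      rw [show a = 4 * d + 2 * c - 1 by linarith] at hab
      apply mul_left_cancel₀ (four_ne_zero (α := ℤ))
      linear_combination -hab
    lia
  rcases sq_eq_sq_iff_eq_or_eq_neg.1 hsq with rfl | rfl
  · have : Odd i := by
      rw [Nat.odd_iff]
      lia
    rw [this.neg_one_pow]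
    ring
  · have : Even i := by
      rw [Nat.even_iff]
      lia
    rw [this.neg_one_pow]
    ring

/-- The congruence with denominators cleared. -/
lemma sq_dvd_sum_sub {i : ℕ} (hp : (4 * i + 1).Prime) {x y : ℤ}
    (hxy : x ^ 2 + 4 * y ^ 2 = 4 * i + 1) (hx : x % 4 = 1) :
    (((4 * i + 1) ^ 2 : ℕ) : ℤ) ∣ 2 * x * (∑ k ∈ range (4 * i + 1),
        genCentralTrinomial 2 (-1) k ^ 2 * (-8) ^ (4 * i + 1 - k))
      - (4 * x ^ 2 - (4 * i + 1)) * (-8) ^ (4 * i + 1) := by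
  have hi : 0 < i := by
    rcases Nat.eq_zero_or_pos i with rfl | h
    · exact absurd hp (by norm_num)
    · exact h
  obtain ⟨a, b, hab, hb, hba, u, hu, hC⟩ := exists_jacobiSum_cast hp
  have hxa := eq_neg_one_pow_mul_of_sum_sq hp hab hb hba hxy hx
  have hS := sum_genCentralTrinomial_sq hp
  have hCunit : IsUnit (Nat.centralBinom i : ZMod ((4 * i + 1) ^ 2)) := by
    apply isUnit_natCast_of_not_dvd hp
    rw [Nat.centralBinom_eq_two_mul_choose]
    intro h
    have h1 : (2 * i).choose i ∣ (2 * i).factorial :=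
      ⟨_, (Nat.choose_mul_factorial_mul_factorial (show i ≤ 2 * i by lia)).symm.trans
        (mul_assoc _ _ _)⟩
    have := hp.dvd_factorial.1 (h.trans h1)
    lia
  have h4unit : IsUnit (4 ^ i : ZMod ((4 * i + 1) ^ 2)) := by
    have := isUnit_natCast_of_not_dvd hp (m := 4) (Nat.not_dvd_of_pos_of_lt (by lia) (by lia))
    exact_mod_cast this.pow i
  have hab' := congrArg (Int.cast : ℤ → ZMod ((4 * i + 1) ^ 2)) hab
  have hxa' := congrArg (Int.cast : ℤ → ZMod ((4 * i + 1) ^ 2)) hxa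
  have h0 := natCast_sq_eq_zero (4 * i + 1)
  rw [← ZMod.intCast_zmod_eq_zero_iff_dvd]
  rw [Int.cast_sub, Int.cast_mul]
  generalize ((∑ k ∈ range (4 * i + 1), genCentralTrinomial 2 (-1) k ^ 2
    * (-8) ^ (4 * i + 1 - k) : ℤ) : ZMod ((4 * i + 1) ^ 2)) = S at *
  have hsq : ((-1) ^ i * (-1) ^ i : ZMod ((4 * i + 1) ^ 2)) = 1 := by
    rw [← mul_pow]; simp
  push_cast at hab' hxa' h0 ⊢
  generalize (Nat.centralBinom i : ZMod ((4 * i + 1) ^ 2)) = C at *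
  generalize (4 : ZMod ((4 * i + 1) ^ 2)) ^ i = f at *
  generalize (-1 : ZMod ((4 * i + 1) ^ 2)) ^ i = e at *
  generalize (-8 : ZMod ((4 * i + 1) ^ 2)) ^ (4 * i + 1) = E at *
  generalize (a : ZMod ((4 * i + 1) ^ 2)) = α at *
  generalize (b : ZMod ((4 * i + 1) ^ 2)) = β at *
  generalize (x : ZMod ((4 * i + 1) ^ 2)) = ξ at *
  generalize (i : ZMod ((4 * i + 1) ^ 2)) = ι at *
  have hprod : (α + β * u) * (α - β * u) = 4 * ι + 1 := by
    linear_combination hab' - β ^ 2 * hu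
  have hunit : IsUnit (α + β * u) := by
    apply isUnit_of_mul_isUnit_right (x := f)
    rw [hC]
    exact hCunit.neg
  have hconj : (α - β * u) ^ 2 = 0 := by
    apply (hunit.pow 2).mul_left_cancel
    rw [← mul_pow, hprod, mul_zero, h0]
  have hSu : S = -E * e * (α + β * u) := by
    apply h4unit.mul_left_cancel
    linear_combination hS + E * e * hC
  rw [hSu, hxa']
  linear_combination (2 * α * (α + β * u) * E - 4 * α ^ 2 * E) * hsq - E * hprod - E * hconj

end TrinomialSum

theorem sum_T2neg1_sq_div_neg_eight_pow_one_mod_four (p : ℕ) [Fact p.Prime]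
    (hp1 : p % 4 = 1) (x y : ℤ) (hxy : (p : ℤ) = x ^ 2 + 4 * y ^ 2)
    (hx : x % 4 = 1) :
    ‖(∑ k ∈ Finset.range p,
        (genCentralTrinomial 2 (-1) k : ℚ_[p]) ^ 2 / (-8 : ℚ_[p]) ^ k) -
      (2 * (x : ℚ_[p]) - (p : ℚ_[p]) / (2 * (x : ℚ_[p])))‖ ≤
      (p : ℝ)⁻¹ ^ 2 := by
  have hp : p.Prime := Fact.out
  have hdvd : ((p ^ 2 : ℕ) : ℤ) ∣ 2 * x * (∑ k ∈ Finset.range p,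
      genCentralTrinomial 2 (-1) k ^ 2 * (-8) ^ (p - k)) - (4 * x ^ 2 - p) * (-8) ^ p := by
    obtain ⟨i, rfl⟩ : ∃ i, p = 4 * i + 1 := ⟨p / 4, by lia⟩
    push_cast at hxy
    have := TrinomialSum.sq_dvd_sum_sub hp hxy.symm hx
    push_cast at this ⊢
    exact this
  have h2x : ¬ (p : ℤ) ∣ 2 * x := by
    intro h
    rcases (Nat.prime_iff_prime_int.1 hp).dvd_or_dvd h with h | ⟨c, rfl⟩
    · have := Int.le_of_dvd two_pos h
      have := hp.two_le
      lia
    · have hp5 : (5 : ℤ) ≤ p := by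
        have := hp.two_le
        lia
      rcases eq_or_ne c 0 with rfl | hc
      · simp at hx
      · have hc1 : 1 ≤ c ^ 2 := by
          have := sq_pos_of_ne_zero hc
          lia
        have hle : (p : ℤ) ^ 2 * 1 ≤ p ^ 2 * c ^ 2 := mul_le_mul_of_nonneg_left hc1 (sq_nonneg _)
        nlinarith [sq_nonneg y]
  have h8 : ¬ (p : ℤ) ∣ (-8) ^ p := by
    intro h
    have h1 := (Nat.prime_iff_prime_int.1 hp).dvd_of_dvd_pow h
    have h2 : (p : ℤ) ∣ 2 ^ 3 := by
      rw [← dvd_neg]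
      exact_mod_cast h1
    have h3 := Int.le_of_dvd two_pos ((Nat.prime_iff_prime_int.1 hp).dvd_of_dvd_pow h2)
    have := hp.two_le
    lia
  have hn1 : ‖((2 * x : ℤ) : ℚ_[p])‖ = 1 :=
    Padic.norm_intCast_eq_one_iff.2 ((Nat.prime_iff_prime_int.1 hp).coprime_iff_not_dvd.2 h2x).symm
  have hn2 : ‖(((-8) ^ p : ℤ) : ℚ_[p])‖ = 1 :=
    Padic.norm_intCast_eq_one_iff.2 ((Nat.prime_iff_prime_int.1 hp).coprime_iff_not_dvd.2 h8).symm
  have hx0 : (x : ℚ_[p]) ≠ 0 := by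
    rintro h
    simp [h] at hn1
  have h80 : (-8 : ℚ_[p]) ≠ 0 := by norm_num
  have hN := (Padic.norm_int_le_pow_iff_dvd (p := p) _ 2).2 hdvd
  have key : ((∑ k ∈ Finset.range p,
        (genCentralTrinomial 2 (-1) k : ℚ_[p]) ^ 2 / (-8 : ℚ_[p]) ^ k) -
      (2 * (x : ℚ_[p]) - (p : ℚ_[p]) / (2 * (x : ℚ_[p])))) * (((2 * x : ℤ) : ℚ_[p])
        * (((-8) ^ p : ℤ) : ℚ_[p])) = ((2 * x * (∑ k ∈ Finset.range p,
      genCentralTrinomial 2 (-1) k ^ 2 * (-8) ^ (p - k)) - (4 * x ^ 2 - p) * (-8) ^ p : ℤ) :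
        ℚ_[p]) := by
    have hsum : (∑ k ∈ Finset.range p,
        (genCentralTrinomial 2 (-1) k : ℚ_[p]) ^ 2 / (-8 : ℚ_[p]) ^ k) * (-8) ^ p
        = ∑ k ∈ Finset.range p,
          (genCentralTrinomial 2 (-1) k : ℚ_[p]) ^ 2 * (-8) ^ (p - k) := by
      rw [Finset.sum_mul]
      refine Finset.sum_congr rfl fun k hk => ?_
      rw [pow_sub₀ _ h80 (Finset.mem_range.1 hk).le]
      ring
    push_cast
    rw [← hsum]
    generalize ∑ k ∈ Finset.range p,
      (genCentralTrinomial 2 (-1) k : ℚ_[p]) ^ 2 / (-8 : ℚ_[p]) ^ k = T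
    field_simp
    ring
  have hnorm := congrArg norm key
  rw [norm_mul, norm_mul, hn1, hn2, mul_one, mul_one] at hnorm
  rw [hnorm]
  refine hN.trans (le_of_eq ?_)
  rw [zpow_neg, inv_pow]
  norm_cast
end
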